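/- Fix a positive integer k and positive integers d_1, …, d_k, and set t = d_1·d_2 ⋯ d_k. There exists a constant c > 0, depending only on d_1, …, d_k, such that for every prime power q the following holds: if f_1, …, f_k are chosen independently, with each f_i uniform on F_q[X_1,…,X_k]_{≤d_i}, then the probability that the number of points x ∈ F_q^k with f_1(x) = ⋯ = f_k(x) = 0 is exactly t is at least (1 − c·q^{−1/2})/t!. -/

import Mathlib

open Polynomial
set_option linter.unusedSectionVars false
set_option linter.unusedSimpArgs false


theorem fix_contract {A : Type*} [CommRing A] {ι : Type*}
    (Ψ : (ι → PowerSeries A) → (ι → PowerSeries A)) (Q : ι → ℕ → A → Prop)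
    (hc : ∀ (n : ℕ) (x y : ι → PowerSeries A), (∀ i, PowerSeries.X ^ n ∣ x i - y i) →
      ∀ i, PowerSeries.X ^ (n + 1) ∣ Ψ x i - Ψ y i)
    (hQ : ∀ x : ι → PowerSeries A, (∀ i l, Q i l (PowerSeries.coeff l (x i))) →
      ∀ i l, Q i l (PowerSeries.coeff l (Ψ x i)))
    (h0 : ∀ i l, Q i l 0) :
    ∃ x, Ψ x = x ∧ ∀ i l, Q i l (PowerSeries.coeff l (x i)) := by
  classical
  set y : ℕ → ι → PowerSeries A := fun n => Ψ^[n] 0 with hy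
  have hys : ∀ n, y (n + 1) = Ψ (y n) := fun n => by
    simp only [hy, Function.iterate_succ_apply']
  have h1 : ∀ n i, PowerSeries.X ^ n ∣ y (n + 1) i - y n i := by
    intro n
    induction n with
    | zero => intro i; simp
    | succ n ih =>
      intro i
      rw [hys (n + 1), hys n]
      exact hc n _ _ (by rw [← hys n]; exact ih) i
  have h2 : ∀ n m i, PowerSeries.X ^ n ∣ y (n + m) i - y n i := by
    intro n m i
    induction m with
    | zero => simp
    | succ m ih =>
      have := (pow_dvd_pow (PowerSeries.X : PowerSeries A) (Nat.le_add_right n m)).trans (h1 (n + m) i)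
      have h3 := dvd_add this ih
      rwa [sub_add_sub_cancel] at h3
  have hq : ∀ n i l, Q i l (PowerSeries.coeff l (y n i)) := by
    intro n
    induction n with
    | zero => intro i l; simpa [hy] using h0 i l
    | succ n ih => rw [hys]; exact hQ _ ih
  set x : ι → PowerSeries A := fun i => PowerSeries.mk fun n => PowerSeries.coeff n (y (n + 1) i) with hx
  have h4 : ∀ n i, PowerSeries.X ^ n ∣ x i - y n i := by
    intro n i
    rw [PowerSeries.X_pow_dvd_iff]
    intro m hm
    obtain ⟨r, rfl⟩ := Nat.exists_eq_add_of_lt hm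
    have := PowerSeries.X_pow_dvd_iff.1 (h2 (m + 1) r i) m (by omega)
    rw [map_sub, sub_eq_zero, show m + 1 + r = m + r + 1 by omega] at this
    rw [map_sub, hx, PowerSeries.coeff_mk, sub_eq_zero, ← this]
  refine ⟨x, ?_, fun i l => ?_⟩
  · funext i
    ext n
    have a := hc n x (y n) (h4 n) i
    rw [← hys] at a
    have b := h4 (n + 1) i
    have := PowerSeries.X_pow_dvd_iff.1 (dvd_sub a b) n (by omega)
    rw [sub_sub_sub_cancel_right, map_sub, sub_eq_zero] at this
    exact this
  · rw [hx, PowerSeries.coeff_mk]; exact hq _ _ _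

/-- multiplicative filtration -/
structure MFil (B : Type*) [CommRing B] where
  G : ℤ → AddSubgroup B
  mono : ∀ {a b}, a ≤ b → G a ≤ G b
  one : 1 ∈ G 0
  mul : ∀ {a b x y}, x ∈ G a → y ∈ G b → x * y ∈ G (a + b)

namespace MFil
variable {B : Type*} [CommRing B] (φ : MFil B)

theorem pow {a x} (h : x ∈ φ.G a) (n : ℕ) : x ^ n ∈ φ.G (n * a) := by
  induction n with
  | zero => simpa using φ.one
  | succ n ih =>
    rw [pow_succ]
    have := φ.mul ih h
    convert this using 2; push_cast; ring

theorem mul' {a b c x y} (hx : x ∈ φ.G a) (hy : y ∈ φ.G b) (h : a + b ≤ c) : x * y ∈ φ.G c :=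
  φ.mono h (φ.mul hx hy)

/-- polynomial extension, X of weight 0 -/
def poly : MFil B[X] where
  G a := { carrier := {p | ∀ n, p.coeff n ∈ φ.G a}
           add_mem' := fun hp hq n => by rw [coeff_add]; exact add_mem (hp n) (hq n)
           zero_mem' := fun n => by rw [coeff_zero]; exact zero_mem _
           neg_mem' := fun hp n => by rw [coeff_neg]; exact neg_mem (hp n) }
  mono h _ hp n := φ.mono h (hp n)
  one n := by
    rw [coeff_one]; split_ifs
    · exact φ.one
    · exact zero_mem _
  mul := by
    intro a b x y hx hy n
    rw [coeff_mul]
    exact sum_mem fun c _ => φ.mul (hx _) (hy _)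

theorem poly_X : (X : B[X]) ∈ φ.poly.G 0 := by
  intro n
  rw [coeff_X]; split_ifs
  · exact φ.one
  · exact zero_mem _

theorem poly_C {a x} (h : x ∈ φ.G a) : (C x : B[X]) ∈ φ.poly.G a := by
  intro n
  rw [coeff_C]; split_ifs
  · exact h
  · exact zero_mem _

/-- power series extension, X of weight -c -/
def ps (c : ℤ) : MFil (PowerSeries B) where
  G a := { carrier := {p | ∀ n : ℕ, PowerSeries.coeff n p ∈ φ.G (a + c * n)}
           add_mem' := fun hp hq n => by rw [map_add]; exact add_mem (hp n) (hq n)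
           zero_mem' := fun n => by rw [map_zero]; exact zero_mem _
           neg_mem' := fun hp n => by rw [map_neg]; exact neg_mem (hp n) }
  mono h _ hp n := φ.mono (by linarith) (hp n)
  one n := by
    rw [PowerSeries.coeff_one]; split_ifs with h
    · simpa [h] using φ.one
    · exact zero_mem _
  mul := by
    intro a b x y hx hy n
    rw [PowerSeries.coeff_mul]
    refine sum_mem fun p hp => ?_
    have : p.1 + p.2 = n := by simpa using hp
    refine φ.mul' (hx _) (hy _) (le_of_eq ?_)
    rw [← this]; push_cast; ring

theorem ps_X (c : ℤ) : (PowerSeries.X : PowerSeries B) ∈ (φ.ps c).G (-c) := by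
  intro n
  rw [PowerSeries.coeff_X]; split_ifs with h
  · simpa [h] using φ.one
  · exact zero_mem _

theorem ps_C (c : ℤ) {a x} (h : x ∈ φ.G a) : (PowerSeries.C x : PowerSeries B) ∈ (φ.ps c).G a := by
  intro n
  rw [PowerSeries.coeff_C]; split_ifs with h'
  · simpa [h'] using h
  · exact zero_mem _

end MFil

/-- Evaluate a bivariate polynomial over `F` in an `F`-algebra. -/
noncomputable def bev {F E : Type*} [CommRing F] [CommRing E] [Algebra F E] (x z : E) : F[X][X] →+* E :=
  eval₂RingHom (aeval (R := F) x : F[X] →+* E) z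

section bev
variable {F E E' : Type*} [CommRing F] [CommRing E] [Algebra F E] [CommRing E'] [Algebra F E']

theorem bev_X (x z : E) : bev (F := F) x z X = z := by simp [bev]
theorem bev_C (x z : E) (p : F[X]) : bev (F := F) x z (C p) = aeval x p := by simp [bev]
theorem bev_CX (x z : E) : bev (F := F) x z (C X) = x := by simp [bev]
theorem bev_CC (x z : E) (c : F) : bev (F := F) x z (C (C c)) = algebraMap F E c := by simp [bev]

theorem bev_hom_ext {F E : Type*} [CommRing F] [CommRing E] {f g : F[X][X] →+* E} (h1 : ∀ c : F, f (C (C c)) = g (C (C c)))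
    (h2 : f (C X) = g (C X)) (h3 : f X = g X) : f = g := by
  refine Polynomial.ringHom_ext (fun a => ?_) h3
  have : f.comp C = g.comp C := Polynomial.ringHom_ext h1 h2
  exact congrArg (fun h : F[X] →+* E => h a) this

theorem map_bev (f : E →+* E') (hf : ∀ c, f (algebraMap F E c) = algebraMap F E' c) (x z : E) (p : F[X][X]) :
    f (bev x z p) = bev (f x) (f z) p := by
  have : f.comp (bev (F := F) x z) = bev (f x) (f z) := by
    apply bev_hom_ext
    · intro c; simp [bev_CC, hf]
    · simp [bev_CX]
    · simp [bev_X]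
  exact congrArg (fun h : F[X][X] →+* E' => h p) this

theorem bev_eq_sum (x z : E) (p : F[X][X]) {N D : ℕ} (hN : p.natDegree ≤ N)
    (hD : ∀ n, (p.coeff n).natDegree ≤ D) :
    bev x z p = ∑ j ∈ Finset.range (N + 1), ∑ i ∈ Finset.range (D + 1),
      algebraMap F E ((p.coeff j).coeff i) * x ^ i * z ^ j := by
  simp only [bev, coe_eval₂RingHom]
  rw [eval₂_eq_sum_range' _ (Nat.lt_succ_of_le hN)]
  refine Finset.sum_congr rfl fun j _ => ?_
  rw [← Finset.sum_mul]
  congr 1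
  simp only [RingHom.coe_coe, aeval_def]
  rw [eval₂_eq_sum_range' _ (Nat.lt_succ_of_le (hD j))]

theorem MFil.bev_mem (φ : MFil E) (hF : ∀ c, algebraMap F E c ∈ φ.G 0) (x z : E) {d : ℕ}
    (hx : x ∈ φ.G 1) (hz : z ∈ φ.G d) (p : F[X][X]) {N D : ℕ} (hN : p.natDegree ≤ N)
    (hD : ∀ n, (p.coeff n).natDegree ≤ D) : bev x z p ∈ φ.G (D + N * d : ℕ) := by
  rw [bev_eq_sum x z p hN hD]
  refine sum_mem fun j hj => sum_mem fun i hi => ?_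
  have hj' : j ≤ N := by simpa [Nat.lt_succ_iff] using hj
  have hi' : i ≤ D := by simpa [Nat.lt_succ_iff] using hi
  refine φ.mul' (φ.mul (hF _) (φ.pow hx i)) (φ.pow hz j) ?_
  have : j * d ≤ N * d := Nat.mul_le_mul_right _ hj'
  push_cast
  have : (j : ℤ) * d ≤ N * d := by exact_mod_cast this
  have : (i : ℤ) ≤ D := by exact_mod_cast hi'
  linarith

end bev

section BR
variable {F : Type*} [Field F] {R : F[X][X]}

theorem pb_eq (hR : R.Monic) (i : Fin R.natDegree) :
    AdjoinRoot.powerBasisAux' hR i = AdjoinRoot.root R ^ (i : ℕ) :=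
  (AdjoinRoot.powerBasis' hR).basis_eq_pow i

noncomputable abbrev lmm (hR : R.Monic) : AdjoinRoot R →ₐ[F[X]] Matrix (Fin R.natDegree) (Fin R.natDegree) F[X] :=
  Algebra.leftMulMatrix (AdjoinRoot.powerBasisAux' hR)

noncomputable def bfil (hR : R.Monic) : MFil (AdjoinRoot R) where
  G z := { carrier := {x | ∀ i j (n : ℕ), (n : ℤ) ≤ z ∨ (lmm hR x i j).coeff n = 0}
           add_mem' := fun {x y} hx hy i j n => by
             rcases hx i j n with h | h
             · exact Or.inl h
             · rcases hy i j n with h' | h'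
               · exact Or.inl h'
               · right; simp [h, h']
           zero_mem' := fun i j n => Or.inr (by simp)
           neg_mem' := fun {x} hx i j n => by
             rcases hx i j n with h | h
             · exact Or.inl h
             · right; simp [h] }
  mono h x hx i j n := (hx i j n).imp (fun h' => h'.trans h) id
  one i j n := by
    rcases Nat.eq_zero_or_pos n with h | h
    · left; simp [h]
    · right
      rw [map_one, Matrix.one_apply]
      split_ifs
      · rw [coeff_one, if_neg (by omega)]
      · simp
  mul := by
    intro a b x y hx hy i j n
    by_cases hn : (n : ℤ) ≤ a + b
    · exact Or.inl hn
    right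
    rw [map_mul, Matrix.mul_apply, finsetSum_coeff]
    refine Finset.sum_eq_zero fun k _ => ?_
    rw [coeff_mul]
    refine Finset.sum_eq_zero fun p hp => ?_
    have hp' : p.1 + p.2 = n := by simpa using hp
    rcases hx i k p.1 with h | h
    · rcases hy k j p.2 with h' | h'
      · exfalso; omega
      · rw [h', mul_zero]
    · rw [h, zero_mul]

theorem bfil_algebraMap (hR : R.Monic) (p : F[X]) {v : ℕ} (hp : p.natDegree ≤ v) :
    algebraMap F[X] (AdjoinRoot R) p ∈ (bfil hR).G v := by
  intro i j n
  by_cases hn : (n : ℤ) ≤ v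
  · exact Or.inl hn
  right
  rw [AlgHom.commutes, Matrix.algebraMap_matrix_apply]
  split_ifs
  · exact coeff_eq_zero_of_natDegree_lt (by simp at hn ⊢; omega)
  · simp

theorem bfil_root (hR : R.Monic) {D : ℕ} (hD : ∀ n, (R.coeff n).natDegree ≤ D) :
    AdjoinRoot.root R ∈ (bfil hR).G D := by
  intro i j n
  by_cases hn : (n : ℤ) ≤ D
  · exact Or.inl hn
  right
  have hn' : D < n := by omega
  rw [Algebra.leftMulMatrix_eq_repr_mul, pb_eq, ← pow_succ']
  by_cases hj : (j : ℕ) + 1 < R.natDegree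
  · rw [← pb_eq hR ⟨j + 1, hj⟩, Module.Basis.repr_self, Finsupp.single_apply]
    split_ifs
    · rw [coeff_one, if_neg (by omega)]
    · simp
  · have hj' : (j : ℕ) + 1 = R.natDegree := by omega
    rw [AdjoinRoot.powerBasisAux'_repr_apply_to_fun, hj']
    have : AdjoinRoot.root R ^ R.natDegree = AdjoinRoot.mk R (X ^ R.natDegree - R) := by
      simp
    rw [this, AdjoinRoot.modByMonicHom_mk, (modByMonic_eq_self_iff hR).2]
    · rw [coeff_sub, coeff_X_pow, if_neg (by omega), zero_sub, coeff_neg, neg_eq_zero]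
      exact coeff_eq_zero_of_natDegree_lt (lt_of_le_of_lt (hD _) hn')
    · rw [← degree_neg, neg_sub]
      have : (X ^ R.natDegree : F[X][X]).degree = R.natDegree := degree_X_pow _
      refine degree_sub_lt_left ?_ hR.ne_zero ?_
      · rw [this, degree_eq_natDegree hR.ne_zero]
      · simp [hR.leadingCoeff]

theorem bfil_natDegree (hR : R.Monic) {v : ℕ} {x : AdjoinRoot R} (hx : x ∈ (bfil hR).G v) (i j) :
    (lmm hR x i j).natDegree ≤ v := by
  rw [natDegree_le_iff_coeff_eq_zero]
  intro n hn
  rcases hx i j n with h | h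
  · omega
  · exact h

theorem norm_natDegree (hR : R.Monic) {v : ℕ} {x : AdjoinRoot R} (hx : x ∈ (bfil hR).G v) :
    (Algebra.norm F[X] x).natDegree ≤ R.natDegree * v := by
  rw [Algebra.norm_eq_matrix_det (AdjoinRoot.powerBasisAux' hR), Matrix.det_apply]
  refine natDegree_sum_le_of_forall_le _ _ fun σ _ => ?_
  refine (natDegree_smul_le _ _).trans ((natDegree_prod_le _ _).trans ?_)
  refine (Finset.sum_le_card_nsmul _ _ v fun i _ => bfil_natDegree hR hx _ _).trans ?_
  simp

theorem repr_natDegree (hR : R.Monic) (hN : 0 < R.natDegree) {v : ℕ} {x : AdjoinRoot R}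
    (hx : x ∈ (bfil hR).G v) (i) :
    ((AdjoinRoot.powerBasisAux' hR).repr x i).natDegree ≤ v := by
  have := bfil_natDegree hR hx i ⟨0, hN⟩
  rwa [Algebra.leftMulMatrix_eq_repr_mul, pb_eq, pow_zero, mul_one] at this

variable {E : Type*} [CommRing E] [Algebra F E]

noncomputable def brlift (x z : E) (h : bev x z R = 0) : AdjoinRoot R →+* E :=
  AdjoinRoot.lift (aeval (R := F) x : F[X] →+* E) z h

theorem brlift_root (x z : E) (h : bev x z R = 0) : brlift x z h (AdjoinRoot.root R) = z :=
  AdjoinRoot.lift_root _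

theorem brlift_alg (x z : E) (h : bev x z R = 0) (p : F[X]) :
    brlift x z h (algebraMap F[X] (AdjoinRoot R) p) = aeval x p :=
  AdjoinRoot.lift_of _

theorem brlift_mk (x z : E) (h : bev x z R = 0) (p : F[X][X]) :
    brlift x z h (AdjoinRoot.mk R p) = bev x z p :=
  AdjoinRoot.lift_mk _ _

theorem bev_mk (p : F[X][X]) :
    bev (algebraMap F[X] (AdjoinRoot R) X) (AdjoinRoot.root R) p = AdjoinRoot.mk R p := by
  have : bev (algebraMap F[X] (AdjoinRoot R) X) (AdjoinRoot.root R) = AdjoinRoot.mk R := by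
    apply bev_hom_ext
    · intro c; rw [bev_CC]; rfl
    · rw [bev_CX]; rfl
    · rw [bev_X]; rfl
  rw [this]

theorem brlift_row (hR : R.Monic) (x z : E) (h : bev x z R = 0) (y : AdjoinRoot R)
    (j : Fin R.natDegree) :
    brlift x z h y * z ^ (j : ℕ) = ∑ i, aeval x (lmm hR y i j) * z ^ (i : ℕ) := by
  have h1 : y * AdjoinRoot.root R ^ (j : ℕ) = ∑ i, lmm hR y i j • AdjoinRoot.powerBasisAux' hR i := by
    simp_rw [Algebra.leftMulMatrix_eq_repr_mul]
    rw [Module.Basis.sum_repr, pb_eq]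
  have h2 := congrArg (brlift x z h) h1
  rw [map_mul, map_pow, brlift_root, map_sum] at h2
  rw [h2]
  refine Finset.sum_congr rfl fun i _ => ?_
  rw [Algebra.smul_def, map_mul, brlift_alg, pb_eq, map_pow, brlift_root]

/-- The element divides the image of its norm. -/
theorem brlift_dvd_norm (hR : R.Monic) (hN : 0 < R.natDegree) (x z : E) (h : bev x z R = 0)
    (y : AdjoinRoot R) : brlift x z h y ∣ aeval x (Algebra.norm F[X] y) := by
  classical
  set H : Matrix (Fin R.natDegree) (Fin R.natDegree) E := (lmm hR y).map (aeval x) with hH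
  set v : Fin R.natDegree → E := fun i => z ^ (i : ℕ) with hv
  have h1 : Matrix.vecMul v H = brlift x z h y • v := by
    funext j
    simp only [Matrix.vecMul, dotProduct, hv, hH, Matrix.map_apply, Pi.smul_apply, smul_eq_mul]
    rw [brlift_row hR]
    exact Finset.sum_congr rfl fun i _ => mul_comm _ _
  have h2 : Matrix.vecMul (Matrix.vecMul v H) H.adjugate = H.det • v := by
    rw [Matrix.vecMul_vecMul, Matrix.mul_adjugate, Matrix.vecMul_smul, Matrix.vecMul_one]
  have h3 : H.det = aeval x (Algebra.norm F[X] y) := by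
    rw [Algebra.norm_eq_matrix_det (AdjoinRoot.powerBasisAux' hR), hH]
    exact ((aeval x : F[X] →ₐ[F] E).map_det _).symm
  rw [h1, Matrix.smul_vecMul] at h2
  have h4 := congrFun h2 ⟨0, hN⟩
  simp only [Pi.smul_apply, smul_eq_mul, hv, pow_zero, mul_one] at h4
  rw [← h3, ← h4]
  exact dvd_mul_right _ _

/-- Norm as product over a full set of roots. -/
theorem br_norm_prod (hR : R.Monic) (x : E) (z : Fin R.natDegree → E) (h : ∀ i, bev x (z i) R = 0)
    (hu : IsUnit (Matrix.vandermonde z).det) (y : AdjoinRoot R) :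
    aeval x (Algebra.norm F[X] y) = ∏ i, brlift x (z i) (h i) y := by
  classical
  set H : Matrix (Fin R.natDegree) (Fin R.natDegree) E := (lmm hR y).map (aeval x) with hH
  have h3 : H.det = aeval x (Algebra.norm F[X] y) := by
    rw [Algebra.norm_eq_matrix_det (AdjoinRoot.powerBasisAux' hR), hH]
    exact ((aeval x : F[X] →ₐ[F] E).map_det _).symm
  have h1 : Matrix.vandermonde z * H =
      Matrix.diagonal (fun i => brlift x (z i) (h i) y) * Matrix.vandermonde z := by
    ext i j
    rw [Matrix.diagonal_mul, Matrix.mul_apply, Matrix.vandermonde_apply, brlift_row hR]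
    refine Finset.sum_congr rfl fun k _ => ?_
    rw [Matrix.vandermonde_apply, hH, Matrix.map_apply, mul_comm]
  have h2 := congrArg Matrix.det h1
  rw [Matrix.det_mul, Matrix.det_mul, Matrix.det_diagonal, mul_comm] at h2
  rw [← h3]
  exact hu.mul_right_cancel h2

end BR

section newton
variable {F : Type*} [Field F] {R : F[X][X]}

theorem exists_degbound {B : Type*} [CommRing B] (p : B[X][X]) :
    ∃ D1, ∀ n, (p.coeff n).natDegree ≤ D1 := by
  refine ⟨p.support.sup fun n => (p.coeff n).natDegree, fun n => ?_⟩
  by_cases h : n ∈ p.support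
  · exact Finset.le_sup (f := fun n => (p.coeff n).natDegree) h
  · rw [notMem_support_iff.1 h]; simp

noncomputable def Rtil (R : F[X][X]) : (AdjoinRoot R)[X][X] :=
  bev (C (C (algebraMap F[X] (AdjoinRoot R) X)) + C X) (C (C (AdjoinRoot.root R)) + X) R

theorem Rtil_eval {E : Type*} [CommRing E] [Algebra F E] [Algebra (AdjoinRoot R) E]
    [IsScalarTower F (AdjoinRoot R) E] (x z : E) :
    bev x z (Rtil R) = bev (algebraMap (AdjoinRoot R) E (algebraMap F[X] (AdjoinRoot R) X) + x)
      (algebraMap (AdjoinRoot R) E (AdjoinRoot.root R) + z) R := by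
  rw [Rtil, map_bev (bev x z)]
  · simp only [map_add, bev_CC, bev_CX, bev_X]
  · intro c
    have : algebraMap F (AdjoinRoot R)[X][X] c = C (C (algebraMap F (AdjoinRoot R) c)) := rfl
    rw [this, bev_CC, ← IsScalarTower.algebraMap_apply]

theorem Rtil_mem (hR : R.Monic) {D : ℕ} (hD1 : 1 ≤ D) (hD : ∀ n, (R.coeff n).natDegree ≤ D) (i j : ℕ) :
    ((Rtil R).coeff j).coeff i ∈ (bfil hR).G (D + R.natDegree * D : ℕ) := by
  have : Rtil R ∈ (bfil hR).poly.poly.G (D + R.natDegree * D : ℕ) := by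
    apply MFil.bev_mem _ _ _ _ _ _ R le_rfl hD
    · intro c
      have : algebraMap F (AdjoinRoot R)[X][X] c = C (C (algebraMap F[X] (AdjoinRoot R) (C c))) := rfl
      rw [this]
      exact MFil.poly_C _ (MFil.poly_C _ (bfil_algebraMap hR _ (by simp)))
    · refine add_mem (MFil.poly_C _ (MFil.poly_C _ (bfil_algebraMap hR _ (by simp)))) ?_
      exact MFil.poly_C _ ((bfil hR).poly.mono (by norm_num) (MFil.poly_X _))
    · refine add_mem (MFil.poly_C _ (MFil.poly_C _ (bfil_root hR hD))) ?_
      exact MFil.mono _ (by positivity) (MFil.poly_X _)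
  exact this j i

theorem Rtil_00 : ((Rtil R).coeff 0).coeff 0 = 0 := by
  have := Rtil_eval (R := R) (E := AdjoinRoot R) 0 0
  simp only [add_zero, Algebra.algebraMap_self, RingHom.id_apply] at this
  rw [bev_mk, AdjoinRoot.mk_self] at this
  rw [← this]
  simp [bev, coeff_zero_eq_eval_zero, eval₂_eq_eval_map]

theorem Rtil_01 : ((Rtil R).coeff 1).coeff 0 = AdjoinRoot.mk R (derivative R) := by
  have h1 : (Rtil R).map (evalRingHom 0) = taylor (AdjoinRoot.root R) (R.map (algebraMap F[X] (AdjoinRoot R))) := by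
    rw [Rtil, ← coe_mapRingHom, map_bev (E' := (AdjoinRoot R)[X])]
    · have : bev (mapRingHom (evalRingHom 0) (C (C (algebraMap F[X] (AdjoinRoot R) X)) + C X))
        (mapRingHom (evalRingHom 0) (C (C (AdjoinRoot.root R)) + X)) =
        (taylorAlgHom (AdjoinRoot.root R)).toRingHom.comp (mapRingHom (algebraMap F[X] (AdjoinRoot R))) := by
        apply bev_hom_ext
        · intro c
          rw [bev_CC]
          simp
          rfl
        · rw [bev_CX]; simp
        · rw [bev_X]; simp [add_comm]
      rw [this]; rfl
    · intro c
      have : algebraMap F (AdjoinRoot R)[X][X] c = C (C (algebraMap F (AdjoinRoot R) c)) := rfl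
      rw [this]; simp
  have h2 := congrArg (fun p => p.coeff 1) h1
  simp only [coeff_map, coe_evalRingHom, taylor_coeff_one] at h2
  rw [coeff_zero_eq_eval_zero, h2, derivative_map, eval_map_algebraMap, AdjoinRoot.aeval_eq]

theorem newton (hR : R.Monic) {D : ℕ} (hD1 : 1 ≤ D) (hD : ∀ n, (R.coeff n).natDegree ≤ D)
    {e : ℤ} (he : e = (D + R.natDegree * D : ℕ)) (δ : AdjoinRoot R) (hδ : δ = AdjoinRoot.mk R (derivative R)) :
    δ ∈ (bfil hR).G e ∧
    ∃ w : PowerSeries (AdjoinRoot R), w ∈ ((bfil hR).ps (2 * e)).G e ∧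
      bev (PowerSeries.C (algebraMap F[X] (AdjoinRoot R) X) + PowerSeries.C (δ ^ 2) * PowerSeries.X)
        (PowerSeries.C (AdjoinRoot.root R) + PowerSeries.C δ * PowerSeries.X * w) R = 0 := by
  classical
  have he0 : 0 ≤ e := he ▸ Int.natCast_nonneg _
  set r : ℕ → ℕ → AdjoinRoot R := fun i j => ((Rtil R).coeff j).coeff i with hr
  have hrm : ∀ i j, r i j ∈ (bfil hR).G e := fun i j => he ▸ Rtil_mem hR hD1 hD i j
  have hr1 : r 0 1 = δ := by rw [hδ]; exact Rtil_01
  have hr0 : r 0 0 = 0 := Rtil_00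
  have hδm : δ ∈ (bfil hR).G e := hr1 ▸ hrm 0 1
  refine ⟨hδm, ?_⟩
  obtain ⟨D1, hD1⟩ := exists_degbound (Rtil R)
  set N1 := (Rtil R).natDegree + 1 with hN1
  set I := (Finset.range (N1 + 1)) ×ˢ (Finset.range (D1 + 1)) with hI
  set I' := (I.erase (0, 0)).erase (1, 0) with hI'
  set ε : PowerSeries (AdjoinRoot R) := PowerSeries.X with hε
  set c : AdjoinRoot R →+* PowerSeries (AdjoinRoot R) := PowerSeries.C with hc
  set Φ := (bfil hR).ps (2 * e) with hΦ
  set Ψ : PowerSeries (AdjoinRoot R) → PowerSeries (AdjoinRoot R) := fun w =>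
    - ∑ p ∈ I', c (r p.2 p.1) * c δ ^ (2 * p.2 + p.1 - 2) * ε ^ (p.2 + p.1 - 1) * w ^ p.1 with hΨ
  have hI2 : ∀ p ∈ I', 1 ≤ p.2 ∨ 2 ≤ p.1 := by
    rintro ⟨j, i⟩ hp
    simp only [hI', Finset.mem_erase, ne_eq, Prod.mk.injEq] at hp
    show 1 ≤ i ∨ 2 ≤ j
    omega
  obtain ⟨w, hw, hwG⟩ := fix_contract (A := AdjoinRoot R) (ι := Unit) (fun x _ => Ψ (x ()))
    (fun _ l a => a ∈ (bfil hR).G (e + 2 * e * l)) (by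
      intro n x y hxy _
      simp only [hΨ]
      rw [neg_sub_neg, ← Finset.sum_sub_distrib]
      refine Finset.dvd_sum fun p hp => ?_
      rw [← mul_sub]
      rcases Nat.eq_zero_or_pos p.1 with h | h
      · simp [h]
      · have h1 : (1 : ℕ) ≤ p.2 + p.1 - 1 := by have := hI2 p hp; omega
        rw [mul_comm, pow_succ]
        refine mul_dvd_mul ?_ (Dvd.dvd.mul_left (dvd_pow_self ε (by omega)) _)
        have : x () - y () ∣ x () ^ p.1 - y () ^ p.1 := sub_dvd_pow_sub_pow _ _ _
        have h2 := (hxy ()).trans this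
        rw [← neg_sub]
        exact (dvd_neg.2 h2)) (by
      intro x hx _
      have hx' : x () ∈ Φ.G e := fun l => hx () l
      have : Ψ (x ()) ∈ Φ.G e := by
        refine neg_mem (sum_mem fun p hp => ?_)
        refine Φ.mul' (Φ.mul (Φ.mul (MFil.ps_C _ _ (hrm _ _)) (Φ.pow (MFil.ps_C _ _ hδm) _))
          (Φ.pow (MFil.ps_X _ _) _)) (Φ.pow hx' _) (le_of_eq ?_)
        have := hI2 p hp
        rw [Nat.cast_sub (by omega), Nat.cast_sub (by omega)]
        push_cast; ring
      exact fun l => this l) (fun _ l => zero_mem _)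
  refine ⟨w (), fun l => hwG () l, ?_⟩
  have hw' : Ψ (w ()) = w () := congrFun hw ()
  have := Rtil_eval (R := R) (E := PowerSeries (AdjoinRoot R)) (c (δ ^ 2) * ε) (c δ * ε * w ())
  refine Eq.trans this.symm ?_
  rw [bev_eq_sum (N := N1) (D := D1) _ _ _ (by omega) hD1, ← Finset.sum_product', ← hI]
  have m0 : ((0 : ℕ), (0 : ℕ)) ∈ I := by simp [hI]
  have m1 : ((1 : ℕ), (0 : ℕ)) ∈ I.erase (0, 0) := by simp [hI, hN1]
  rw [← Finset.add_sum_erase _ _ m0, ← Finset.add_sum_erase _ _ m1, ← hI']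
  have e0 : ((Rtil R).coeff 0).coeff 0 = 0 := hr0
  have e1 : ((Rtil R).coeff 1).coeff 0 = δ := hr1
  have key : ∑ x ∈ I', (algebraMap (AdjoinRoot R) (PowerSeries (AdjoinRoot R))) (((Rtil R).coeff x.1).coeff x.2) *
      (c (δ ^ 2) * ε) ^ x.2 * (c δ * ε * w ()) ^ x.1 = - (c δ ^ 2 * ε * Ψ (w ())) := by
    rw [hΨ]
    simp only
    rw [mul_neg, neg_neg, Finset.mul_sum]
    refine Finset.sum_congr rfl fun p hp => ?_
    have h2 := hI2 p hp
    have a1 : c δ ^ 2 * c δ ^ (2 * p.2 + p.1 - 2) = c δ ^ (2 * p.2) * c δ ^ p.1 := by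
      rw [← pow_add, ← pow_add]; congr 1; omega
    have a2 : ε * ε ^ (p.2 + p.1 - 1) = ε ^ p.2 * ε ^ p.1 := by
      rw [← pow_succ', ← pow_add]; congr 1; omega
    have a3 : (algebraMap (AdjoinRoot R) (PowerSeries (AdjoinRoot R))) (((Rtil R).coeff p.1).coeff p.2) = c (r p.2 p.1) := rfl
    rw [a3]
    calc _ = c (r p.2 p.1) * (c δ ^ (2 * p.2) * c δ ^ p.1) * (ε ^ p.2 * ε ^ p.1) * w () ^ p.1 := by
          rw [map_pow, mul_pow, mul_pow, mul_pow, ← pow_mul]; ring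
      _ = _ := by rw [← a1, ← a2]; ring
  rw [key, hw']
  simp only [e0, e1, map_zero]
  have a4 : (algebraMap (AdjoinRoot R) (PowerSeries (AdjoinRoot R))) δ = c δ := rfl
  rw [a4]; ring

end newton

section step
variable {F : Type*} [Field F] [Fintype F] {R : F[X][X]}

abbrev CIx (N J I : ℕ) := Fin N × Fin N × Fin J × Fin I

noncomputable abbrev sB (R : F[X][X]) : AdjoinRoot R := algebraMap F[X] (AdjoinRoot R) X

noncomputable def kk (R : F[X][X]) {N J I : ℕ} (c : CIx N J I → F) (a : Fin N) (j : Fin J) : AdjoinRoot R :=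
  ∑ a' : Fin N, ∑ i : Fin I, c (a, a', j, i) • (sB R ^ (i : ℕ) * AdjoinRoot.root R ^ (a' : ℕ))

noncomputable def hh (R : F[X][X]) {N J I : ℕ} (c : CIx N J I → F) : AdjoinRoot R :=
  ∑ a : Fin N, ∑ j : Fin J, sB R ^ (j : ℕ) * AdjoinRoot.root R ^ (a : ℕ) * kk R c a j ^ Fintype.card F

noncomputable def Eps (R : F[X][X]) {N J I : ℕ} (x y : PowerSeries (AdjoinRoot R)) (S δ : AdjoinRoot R) :
    (CIx N J I → F) →ₗ[F] PowerSeries (AdjoinRoot R) :=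
  ∑ p : CIx N J I, (LinearMap.toSpanSingleton F _
    (PowerSeries.C (sB R ^ (p.2.2.2 : ℕ) * (S ^ (p.2.1 : ℕ) * δ ^ (N - 1 - (p.2.1 : ℕ)))) *
      (x ^ (p.2.2.1 : ℕ) * y ^ (p.1 : ℕ)))).comp (LinearMap.proj p)

theorem Eps_apply {N J I : ℕ} (x y : PowerSeries (AdjoinRoot R)) (S δ : AdjoinRoot R) (c : CIx N J I → F) :
    Eps R x y S δ c = ∑ p, c p • (PowerSeries.C (sB R ^ (p.2.2.2 : ℕ) * (S ^ (p.2.1 : ℕ) * δ ^ (N - 1 - (p.2.1 : ℕ)))) *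
      (x ^ (p.2.2.1 : ℕ) * y ^ (p.1 : ℕ))) := by
  simp [Eps, LinearMap.sum_apply]

theorem bfil_smul (hR : R.Monic) {v : ℤ} {x : AdjoinRoot R} (hx : x ∈ (bfil hR).G v) (c : F) :
    c • x ∈ (bfil hR).G v := by
  have : c • x = algebraMap F[X] (AdjoinRoot R) (C c) * x := by
    rw [Algebra.smul_def]; rfl
  rw [this]
  exact (bfil hR).mul' (bfil_algebraMap hR (v := 0) _ (by simp)) hx (by simp)

theorem stepA (hR : R.Monic) (hN : 0 < R.natDegree) {D : ℕ} {J I M : ℕ} {e : ℕ}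
    {x y : PowerSeries (AdjoinRoot R)} {S δ : AdjoinRoot R}
    (hx : x ∈ ((bfil hR).ps (2 * (e : ℤ))).G 1) (hy : y ∈ ((bfil hR).ps (2 * (e : ℤ))).G D)
    (hS : S ∈ (bfil hR).G e) (hδ : δ ∈ (bfil hR).G e)
    (hcnt : M * (R.natDegree * (I + R.natDegree * e + J + R.natDegree * D + 2 * e * M + 1)) <
      R.natDegree * (R.natDegree * (J * I))) :
    ∃ c : CIx R.natDegree J I → F, c ≠ 0 ∧ ∀ l < M, PowerSeries.coeff l (Eps R x y S δ c) = 0 := by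
  classical
  set N := R.natDegree with hNdef
  set v := I + N * e + J + N * D + 2 * e * M with hv
  let b := AdjoinRoot.powerBasisAux' hR
  let L : (CIx N J I → F) →ₗ[F] (Fin M × Fin N × Fin (v + 1) → F) :=
    { toFun := fun c t => ((b.repr (PowerSeries.coeff (t.1 : ℕ) (Eps R x y S δ c))) t.2.1).coeff t.2.2
      map_add' := fun c c' => by
        funext t
        simp only [map_add, Finsupp.add_apply, coeff_add, Pi.add_apply]
      map_smul' := fun r c => by
        funext t
        have h1 : ∀ z : AdjoinRoot R, r • z = (C r : F[X]) • z := fun z => by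
          rw [Algebra.smul_def, Algebra.smul_def]; rfl
        have h2 : PowerSeries.coeff (t.1 : ℕ) (r • Eps R x y S δ c) =
          r • PowerSeries.coeff (t.1 : ℕ) (Eps R x y S δ c) := rfl
        simp only [map_smul, h2, Pi.smul_apply, RingHom.id_apply]
        rw [h1, map_smul, Finsupp.smul_apply, smul_eq_mul, coeff_C_mul, smul_eq_mul] }
  have hfr : Module.finrank F (Fin M × Fin N × Fin (v + 1) → F) < Module.finrank F (CIx N J I → F) := by
    rw [Module.finrank_fintype_fun_eq_card, Module.finrank_fintype_fun_eq_card]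
    simpa [CIx] using hcnt
  have hker := LinearMap.ker_ne_bot_of_finrank_lt (f := L) hfr
  obtain ⟨c, hc, hc0⟩ := (Submodule.ne_bot_iff _).1 hker
  refine ⟨c, hc0, fun l hl => ?_⟩
  have hmem : PowerSeries.coeff l (Eps R x y S δ c) ∈ (bfil hR).G v := by
    rw [Eps_apply, map_sum]
    refine sum_mem fun p _ => ?_
    have h2 : ∀ z : PowerSeries (AdjoinRoot R), PowerSeries.coeff l (c p • z) = c p • PowerSeries.coeff l z := fun z => rfl
    rw [h2]
    refine bfil_smul hR ?_ _
    have hs : sB R ∈ (bfil hR).G 1 := bfil_algebraMap hR (v := 1) _ (by simp)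
    have h3 := ((bfil hR).ps (2 * (e : ℤ))).mul
      (MFil.ps_C _ (2 * (e : ℤ)) ((bfil hR).mul ((bfil hR).pow hs (p.2.2.2 : ℕ))
      ((bfil hR).mul ((bfil hR).pow hS (p.2.1 : ℕ)) ((bfil hR).pow hδ (N - 1 - (p.2.1 : ℕ))))))
      (((bfil hR).ps (2 * (e : ℤ))).mul (MFil.pow _ hx (p.2.2.1 : ℕ)) (MFil.pow _ hy (p.1 : ℕ)))
    refine (bfil hR).mono ?_ (h3 l)
    have i1 := p.2.2.2.2
    have i2 := p.2.2.1.2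
    have i3 := p.1.2
    have i4 := p.2.1.2
    have a1 : (p.2.1 : ℕ) * e + (N - 1 - (p.2.1 : ℕ)) * e ≤ N * e := by
      rw [← add_mul]; exact Nat.mul_le_mul_right _ (by omega)
    have a2 : (p.1 : ℕ) * D ≤ N * D := Nat.mul_le_mul_right _ (by omega)
    have a3 : 2 * e * l ≤ 2 * e * M := Nat.mul_le_mul_left _ hl.le
    have : (p.2.2.2 : ℕ) * 1 + ((p.2.1 : ℕ) * e + (N - 1 - (p.2.1 : ℕ)) * e) + ((p.2.2.1 : ℕ) * 1 + (p.1 : ℕ) * D) + 2 * e * l ≤ v := by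
      omega
    exact_mod_cast this
  apply b.repr.injective
  rw [map_zero]
  ext i n
  by_cases hn : n < v + 1
  · have := congrFun (LinearMap.mem_ker.1 hc) (⟨l, hl⟩, i, ⟨n, hn⟩)
    simpa [L] using this
  · have : ((b.repr (PowerSeries.coeff l (Eps R x y S δ c))) i).natDegree ≤ v := repr_natDegree hR hN hmem i
    rw [coeff_eq_zero_of_natDegree_lt (by omega)]; simp

end step

section stepB
variable {F : Type*} [Field F] [Fintype F] {R : F[X][X]} {κ : Type*} [Field κ] [Algebra F κ]

theorem frob_sub_const (f : PowerSeries κ) :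
    (PowerSeries.X : PowerSeries κ) ^ Fintype.card F ∣ f ^ Fintype.card F -
      PowerSeries.C (PowerSeries.constantCoeff f) ^ Fintype.card F := by
  have h := map_sub (FiniteField.frobeniusAlgHom F (PowerSeries κ)) f (PowerSeries.C (PowerSeries.constantCoeff f))
  simp only [FiniteField.coe_frobeniusAlgHom] at h
  rw [← h]
  apply pow_dvd_pow_of_dvd
  rw [PowerSeries.X_dvd_iff]
  simp

theorem hom_kk {E : Type*} [CommRing E] [Algebra F E] (L : AdjoinRoot R →+* E)
    (hL : ∀ c : F, L (algebraMap F _ c) = algebraMap F E c) {N J I : ℕ} (c : CIx N J I → F) (a j) :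
    L (kk R c a j) = ∑ a' : Fin N, ∑ i : Fin I, c (a, a', j, i) • (L (sB R) ^ (i : ℕ) * L (AdjoinRoot.root R) ^ (a' : ℕ)) := by
  simp only [kk, map_sum, Algebra.smul_def, map_mul, map_pow, hL]

theorem brlift_F {E : Type*} [CommRing E] [Algebra F E] (x z : E) (h : bev x z R = 0) (c : F) :
    brlift x z h (algebraMap F _ c) = algebraMap F E c := by
  have : algebraMap F (AdjoinRoot R) c = algebraMap F[X] (AdjoinRoot R) (C c) := rfl
  rw [this, brlift_alg]; simp

theorem stepU (w : PowerSeries (AdjoinRoot R)) {δ : AdjoinRoot R} (hδ : δ = AdjoinRoot.mk R (derivative R))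
    {x y : PowerSeries (AdjoinRoot R)}
    (hx : x = PowerSeries.C (sB R) + PowerSeries.C (δ ^ 2) * PowerSeries.X)
    (hy : y = PowerSeries.C (AdjoinRoot.root R) + PowerSeries.C δ * PowerSeries.X * w)
    (hw : bev x y R = 0) (s₀ u₀ : κ) (h0 : bev s₀ u₀ R = 0) (hd : bev s₀ u₀ (derivative R) ≠ 0) :
    ∃ (U : PowerSeries κ) (hU : bev (PowerSeries.C s₀ + PowerSeries.X) U R = 0),
      PowerSeries.constantCoeff U = u₀ ∧
      ∃ θ : PowerSeries (AdjoinRoot R) →+* PowerSeries κ, θ x = PowerSeries.C s₀ + PowerSeries.X ∧ θ y = U ∧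
        (∀ b, θ (PowerSeries.C b) = PowerSeries.C (brlift s₀ u₀ h0 b)) ∧
        (∀ z M, (∀ l < M, PowerSeries.coeff l z = 0) → PowerSeries.X ^ M ∣ θ z) := by
  set π := brlift s₀ u₀ h0 with hπ
  set δ₀ := bev s₀ u₀ (derivative R) with hδ₀
  have hπδ : π δ = δ₀ := by rw [hδ, hπ, brlift_mk]
  set θ : PowerSeries (AdjoinRoot R) →+* PowerSeries κ := (PowerSeries.rescale (δ₀⁻¹ ^ 2)).comp (PowerSeries.map π) with hθ
  have hC : ∀ b, θ (PowerSeries.C b) = PowerSeries.C (π b) := by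
    intro b
    simp only [hθ, RingHom.comp_apply, PowerSeries.map_C]
    ext n
    rw [PowerSeries.coeff_rescale, PowerSeries.coeff_C]
    split_ifs with h
    · simp [h]
    · simp
  have hX : θ PowerSeries.X = PowerSeries.C (δ₀⁻¹ ^ 2) * PowerSeries.X := by
    simp only [hθ, RingHom.comp_apply, PowerSeries.map_X, PowerSeries.rescale_X]
  have hθx : θ x = PowerSeries.C s₀ + PowerSeries.X := by
    rw [hx, map_add, map_mul, hC, hC, hX, map_pow, hπδ, ← mul_assoc, ← map_mul, ← mul_pow, mul_inv_cancel₀ hd]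
    rw [hπ, brlift_alg]; simp
  have hF : ∀ c : F, θ (algebraMap F _ c) = algebraMap F (PowerSeries κ) c := by
    intro c
    have : algebraMap F (PowerSeries (AdjoinRoot R)) c = PowerSeries.C (algebraMap F (AdjoinRoot R) c) :=
      PowerSeries.algebraMap_apply
    rw [this, hC, hπ, brlift_F]; exact PowerSeries.algebraMap_apply.symm
  have hU : bev (PowerSeries.C s₀ + PowerSeries.X) (θ y) R = 0 := by
    rw [← hθx, ← map_bev θ hF, hw, map_zero]
  refine ⟨θ y, hU, ?_, θ, hθx, rfl, hC, ?_⟩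
  · rw [hy, map_add, map_mul, map_mul, hX, hC, hπ, brlift_root]; simp
  · intro z M hz
    rw [PowerSeries.X_pow_dvd_iff]
    intro m hm
    simp only [hθ, RingHom.comp_apply, PowerSeries.coeff_rescale, PowerSeries.coeff_map, hz m hm, map_zero, mul_zero]

theorem stepB {N J I M : ℕ} (c : CIx N J I → F) (hMq : M ≤ Fintype.card F)
    {x y : PowerSeries (AdjoinRoot R)} {S : F[X][X]} {δ : AdjoinRoot R} (hδ : δ = AdjoinRoot.mk R (derivative R))
    (hE : ∀ l < M, PowerSeries.coeff l (Eps R x y (AdjoinRoot.mk R S) δ c) = 0)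
    (s₀ : F) (u₀ : κ) (h0 : bev (algebraMap F κ s₀) u₀ R = 0) (hd : bev (algebraMap F κ s₀) u₀ (derivative R) ≠ 0)
    (hS : bev (algebraMap F κ s₀) u₀ (derivative R) * u₀ ^ Fintype.card F = bev (algebraMap F κ s₀) u₀ S)
    (U : PowerSeries κ) (hU : bev (PowerSeries.C (algebraMap F κ s₀) + PowerSeries.X) U R = 0)
    (hUc : PowerSeries.constantCoeff U = u₀)
    (θ : PowerSeries (AdjoinRoot R) →+* PowerSeries κ) (hθx : θ x = PowerSeries.C (algebraMap F κ s₀) + PowerSeries.X) (hθy : θ y = U)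
    (hθC : ∀ b, θ (PowerSeries.C b) = PowerSeries.C (brlift (algebraMap F κ s₀) u₀ h0 b))
    (hθz : ∀ z M, (∀ l < M, PowerSeries.coeff l z = 0) → PowerSeries.X ^ M ∣ θ z) :
    PowerSeries.X ^ M ∣ brlift _ _ hU (hh R c) := by
  set q := Fintype.card F with hq
  set Λ := brlift _ _ hU with hΛ
  set π := brlift (algebraMap F κ s₀) u₀ h0 with hπ
  set δ₀ := bev (algebraMap F κ s₀) u₀ (derivative R) with hδ₀
  have hπδ : π δ = δ₀ := by rw [hδ, hπ, brlift_mk]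
  set s' : PowerSeries κ := PowerSeries.C (algebraMap F κ s₀) + PowerSeries.X with hs'
  have hΛs : Λ (sB R) = s' := by rw [hΛ, brlift_alg]; simp [hs']
  have hΛT : Λ (AdjoinRoot.root R) = U := by rw [hΛ, brlift_root]
  have hπs : π (sB R) = algebraMap F κ s₀ := by rw [hπ, brlift_alg]; simp
  have hπT : π (AdjoinRoot.root R) = u₀ := by rw [hπ, brlift_root]
  have hcc : ∀ b, PowerSeries.constantCoeff (Λ b) = π b := by
    intro b
    obtain ⟨p, rfl⟩ := AdjoinRoot.mk_surjective b
    rw [hΛ, hπ, brlift_mk, brlift_mk, map_bev (E := PowerSeries κ) (E' := κ) (PowerSeries.constantCoeff (R := κ)), hUc]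
    · simp [hs']
    · intro c; exact PowerSeries.constantCoeff_C _
  have hpi : ∀ a j, δ₀ ^ (N - 1) * π (kk R c a j) ^ q =
      ∑ a' : Fin N, ∑ i : Fin I, c (a, a', j, i) • ((algebraMap F κ s₀) ^ (i : ℕ) *
        (bev (algebraMap F κ s₀) u₀ S ^ (a' : ℕ) * δ₀ ^ (N - 1 - (a' : ℕ)))) := by
    intro a j
    rw [hπ, hom_kk _ (brlift_F _ _ h0), ← hπ, hπs, hπT]
    have h := fun z => congrFun (FiniteField.coe_frobeniusAlgHom F κ) z
    rw [← hq] at h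
    rw [← h, map_sum, Finset.mul_sum]
    refine Finset.sum_congr rfl fun a' _ => ?_
    rw [map_sum, Finset.mul_sum]
    refine Finset.sum_congr rfl fun i _ => ?_
    rw [map_smul, h, mul_pow, mul_smul_comm]
    congr 1
    have e1 : ((algebraMap F κ) s₀ ^ (i : ℕ)) ^ q = (algebraMap F κ) s₀ ^ (i : ℕ) := by
      rw [← map_pow, ← map_pow, FiniteField.pow_card]
    have e2 : δ₀ ^ (N - 1) = δ₀ ^ (a' : ℕ) * δ₀ ^ (N - 1 - (a' : ℕ)) := by
      rw [← pow_add]; congr 1; have := a'.2; omega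
    rw [e1, e2, ← hS, mul_pow, ← pow_mul, ← pow_mul, mul_comm q]; ring
  have hmain : PowerSeries.C (δ₀ ^ (N - 1)) * ∑ a : Fin N, ∑ j : Fin J, s' ^ (j : ℕ) * U ^ (a : ℕ) * PowerSeries.C (π (kk R c a j) ^ q)
      = θ (Eps R x y (AdjoinRoot.mk R S) δ c) := by
    rw [Eps_apply, map_sum, Fintype.sum_prod_type, Finset.mul_sum]
    refine Finset.sum_congr rfl fun a _ => ?_
    rw [Fintype.sum_prod_type, Finset.mul_sum]
    simp_rw [Fintype.sum_prod_type]
    rw [Finset.sum_comm]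
    refine Finset.sum_congr rfl fun j _ => ?_
    rw [mul_left_comm, ← map_mul, hpi, map_sum, Finset.mul_sum]
    refine Finset.sum_congr rfl fun a' _ => ?_
    rw [map_sum, Finset.mul_sum]
    refine Finset.sum_congr rfl fun i _ => ?_
    have hsm : ∀ (r : F) (z : PowerSeries (AdjoinRoot R)), θ (r • z) = PowerSeries.C (algebraMap F κ r) * θ z := by
      intro r z
      have : r • z = PowerSeries.C (algebraMap F (AdjoinRoot R) r) * z := by
        rw [Algebra.smul_def, PowerSeries.algebraMap_apply]
      rw [this, map_mul, hθC, hπ, brlift_F]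
    have hπS : π (AdjoinRoot.mk R S) = bev (algebraMap F κ s₀) u₀ S := by rw [hπ, brlift_mk]
    rw [hsm, map_mul θ, map_mul θ, hθC, map_pow θ, map_pow θ, hθx, hθy, map_mul π, map_mul π, map_pow π, map_pow π,
      map_pow π, hπs, hπδ, hπS, Algebra.smul_def, map_mul PowerSeries.C (algebraMap F κ _)]
    ring
  have h1 : PowerSeries.X ^ M ∣ ∑ a : Fin N, ∑ j : Fin J, s' ^ (j : ℕ) * U ^ (a : ℕ) * PowerSeries.C (π (kk R c a j) ^ q) := by
    have h2 := hθz _ M hE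
    rw [← hmain] at h2
    have hunit : IsUnit (PowerSeries.C (δ₀ ^ (N - 1)) : PowerSeries κ) :=
      (IsUnit.mk0 _ (pow_ne_zero _ hd)).map _
    exact (hunit.dvd_mul_left).1 h2
  have h3 : PowerSeries.X ^ M ∣ Λ (hh R c) - ∑ a : Fin N, ∑ j : Fin J, s' ^ (j : ℕ) * U ^ (a : ℕ) * PowerSeries.C (π (kk R c a j) ^ q) := by
    rw [hh, map_sum, ← Finset.sum_sub_distrib]
    refine Finset.dvd_sum fun a _ => ?_
    rw [map_sum, ← Finset.sum_sub_distrib]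
    refine Finset.dvd_sum fun j _ => ?_
    rw [map_mul, map_mul, map_pow, map_pow, map_pow, hΛs, hΛT, ← mul_sub]
    refine Dvd.dvd.mul_left ?_ _
    have := frob_sub_const (F := F) (Λ (kk R c a j))
    rw [hcc] at this
    have e : (PowerSeries.C (π (kk R c a j) ^ q) : PowerSeries κ) = PowerSeries.C (π (kk R c a j)) ^ q := map_pow _ _ _
    rw [e]
    exact (pow_dvd_pow _ hMq).trans this
  have := dvd_add h3 h1
  rwa [sub_add_cancel] at this

end stepB

section stepC
variable {F : Type*} [Field F] [Fintype F] {R : F[X][X]}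

theorem aeval_psX (p : F[X]) : aeval (PowerSeries.X : PowerSeries F) p = (p : PowerSeries F) := by
  have : (aeval (PowerSeries.X : PowerSeries F) : F[X] →ₐ[F] _) = Polynomial.coeToPowerSeries.algHom F := by
    ext; simp
  rw [this]; simp

theorem ord_lemma [IsDomain (AdjoinRoot R)] (hR : R.Monic) (hN : 0 < R.natDegree) (u : PowerSeries F)
    (hu : bev PowerSeries.X u R = 0) {v n : ℕ} {y : AdjoinRoot R} (hy : y ∈ (bfil hR).G v)
    (hn : R.natDegree * v < n) (hd : PowerSeries.X ^ n ∣ brlift _ _ hu y) : y = 0 := by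
  by_contra hy0
  have h1 := hd.trans (brlift_dvd_norm hR hN _ _ hu y)
  have h2 : Algebra.norm F[X] y ≠ 0 := by
    rw [Ne, Algebra.norm_eq_zero_iff_of_basis (AdjoinRoot.powerBasisAux' hR)]; exact hy0
  rw [aeval_psX, PowerSeries.X_pow_dvd_iff] at h1
  have h3 := norm_natDegree hR hy
  have h4 := h1 (Algebra.norm F[X] y).natDegree (by omega)
  rw [Polynomial.coeff_coe] at h4
  exact h2 (leadingCoeff_eq_zero.1 h4)

theorem lin_indep (hR : R.Monic) {J : ℕ} (g : Fin R.natDegree → Fin J → F)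
    (h : ∑ a, ∑ j, g a j • (sB R ^ (j : ℕ) * AdjoinRoot.root R ^ (a : ℕ)) = 0) (a j) : g a j = 0 := by
  have h1 : ∑ a, (∑ j : Fin J, C (g a j) * X ^ (j : ℕ)) • AdjoinRoot.powerBasisAux' hR a = 0 := by
    rw [← h]
    refine Finset.sum_congr rfl fun a _ => ?_
    rw [Finset.sum_smul]
    refine Finset.sum_congr rfl fun j _ => ?_
    rw [pb_eq, Algebra.smul_def, map_mul, map_pow, Algebra.smul_def, mul_assoc]; rfl
  have h2 := (Fintype.linearIndependent_iff.1 (AdjoinRoot.powerBasisAux' hR).linearIndependent) _ h1 a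
  have h3 := congrArg (fun p => p.coeff (j : ℕ)) h2
  simp only [finsetSum_coeff, coeff_C_mul, coeff_X_pow, coeff_zero, mul_ite, mul_one, mul_zero] at h3
  rw [Finset.sum_eq_single j] at h3
  · simpa using h3
  · intro b _ hb
    rw [if_neg]; exact fun h => hb (Fin.ext h.symm)
  · simp

theorem sT_mem (hR : R.Monic) {D : ℕ} (hD : ∀ n, (R.coeff n).natDegree ≤ D) {J : ℕ} (g : Fin R.natDegree → Fin J → F) :
    ∑ a, ∑ j, g a j • (sB R ^ (j : ℕ) * AdjoinRoot.root R ^ (a : ℕ)) ∈ (bfil hR).G (J + R.natDegree * D : ℕ) := by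
  refine sum_mem fun a _ => sum_mem fun j _ => bfil_smul hR ?_ _
  refine (bfil hR).mul' ((bfil hR).pow (bfil_algebraMap hR (v := 1) _ (by simp)) _)
    ((bfil hR).pow (bfil_root hR hD) _) ?_
  have : (j : ℕ) * 1 + (a : ℕ) * D ≤ J + R.natDegree * D := by
    have := Nat.mul_le_mul_right D a.2.le
    have := j.2; omega
  exact_mod_cast this

theorem stepC [IsDomain (AdjoinRoot R)] (hR : R.Monic) (hN : 0 < R.natDegree)
    {D : ℕ} (hD : ∀ n, (R.coeff n).natDegree ≤ D) (u : PowerSeries F)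
    (hu : bev PowerSeries.X u R = 0) {J I : ℕ} (c : CIx R.natDegree J I → F) (hc : c ≠ 0)
    (hJ : R.natDegree * (J + R.natDegree * D) < Fintype.card F) : hh R c ≠ 0 := by
  classical
  intro hh0
  set ψ := brlift _ _ hu with hψ
  set q := Fintype.card F with hq
  set K : Fin R.natDegree → Fin J → PowerSeries F := fun a j => ψ (kk R c a j) with hK
  have hex : ∃ n, ∃ a j, PowerSeries.coeff n (K a j) ≠ 0 := by
    by_contra hcon
    push Not at hcon
    apply hc
    funext ⟨a, a', j, i⟩
    have h1 : K a j = 0 := by ext n; simpa using hcon n a j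
    have h2 : kk R c a j = 0 := by
      refine ord_lemma hR hN u hu (sT_mem hR hD fun a' i => c (a, a', j, i)) (Nat.lt_succ_self _) ?_
      show PowerSeries.X ^ _ ∣ ψ (kk R c a j)
      have h1' : ψ (kk R c a j) = 0 := h1
      rw [h1']; exact dvd_zero _
    exact lin_indep hR (fun a' i => c (a, a', j, i)) h2 a' i
  set m := Nat.find hex with hm
  obtain ⟨a0, j0, h0⟩ := Nat.find_spec hex
  rw [← hm] at h0
  have hlt : ∀ n < m, ∀ a j, PowerSeries.coeff n (K a j) = 0 := by
    intro n hn a j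
    by_contra h
    exact Nat.find_min hex hn ⟨a, j, h⟩
  have hdv : ∀ a j, ∃ L : PowerSeries F, K a j = PowerSeries.X ^ m * L := fun a j =>
    PowerSeries.X_pow_dvd_iff.2 fun n hn => hlt n hn a j
  choose L hL using hdv
  have hLc : ∀ a j, PowerSeries.constantCoeff (L a j) = PowerSeries.coeff m (K a j) := by
    intro a j
    rw [hL, PowerSeries.coeff_X_pow_mul', if_pos le_rfl, Nat.sub_self, PowerSeries.coeff_zero_eq_constantCoeff]
  have h1 : ψ (hh R c) = (PowerSeries.X ^ m) ^ q * ∑ a : Fin R.natDegree, ∑ j : Fin J, PowerSeries.X ^ (j : ℕ) * u ^ (a : ℕ) * L a j ^ q := by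
    rw [hh, map_sum, Finset.mul_sum]
    refine Finset.sum_congr rfl fun a _ => ?_
    rw [map_sum, Finset.mul_sum]
    refine Finset.sum_congr rfl fun j _ => ?_
    have : ψ (kk R c a j) = PowerSeries.X ^ m * L a j := hL a j
    rw [map_mul, map_mul, map_pow, map_pow, map_pow, this, hψ, brlift_root, brlift_alg, mul_pow]
    simp; ring
  rw [hh0, map_zero] at h1
  have h2 : ∑ a : Fin R.natDegree, ∑ j : Fin J, PowerSeries.X ^ (j : ℕ) * u ^ (a : ℕ) * L a j ^ q = 0 := by
    rcases mul_eq_zero.1 h1.symm with h | h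
    · exact absurd h (pow_ne_zero _ (pow_ne_zero _ PowerSeries.X_ne_zero))
    · exact h
  set g : Fin R.natDegree → Fin J → F := fun a j => PowerSeries.coeff m (K a j) with hg
  have h3 : PowerSeries.X ^ q ∣ ψ (∑ a, ∑ j, g a j • (sB R ^ (j : ℕ) * AdjoinRoot.root R ^ (a : ℕ))) := by
    rw [← sub_zero (ψ _), ← h2, map_sum, ← Finset.sum_sub_distrib]
    refine Finset.dvd_sum fun a _ => ?_
    rw [map_sum, ← Finset.sum_sub_distrib]
    refine Finset.dvd_sum fun j _ => ?_
    have := frob_sub_const (F := F) (L a j)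
    rw [hLc, ← map_pow, FiniteField.pow_card] at this
    rw [Algebra.smul_def, map_mul, map_mul, map_pow, map_pow, hψ, brlift_F, brlift_root, brlift_alg, aeval_X, mul_comm,
      ← mul_sub]
    refine Dvd.dvd.mul_left ?_ _
    rw [← neg_sub, dvd_neg]
    exact this
  have h4 := ord_lemma hR hN u hu (sT_mem hR hD g) hJ h3
  exact h0 (lin_indep hR g h4 a0 j0)

end stepC

section stepD
variable {F : Type*} [Field F] [Fintype F] {R : F[X][X]} {κ : Type*} [Field κ] [Algebra F κ]

theorem le_rootMult_of_dvd (r : F[X]) (hr : r ≠ 0) (s₀ : F) (n : ℕ)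
    (h : (PowerSeries.X : PowerSeries κ) ^ n ∣ aeval (PowerSeries.C (algebraMap F κ s₀) + PowerSeries.X) r) :
    n ≤ r.rootMultiplicity s₀ := by
  rw [le_rootMultiplicity_iff hr]
  have h1 : aeval (PowerSeries.C (algebraMap F κ s₀) + PowerSeries.X) r =
      (((taylor s₀ r).map (algebraMap F κ) : κ[X]) : PowerSeries κ) := by
    have : (aeval (PowerSeries.C (algebraMap F κ s₀) + PowerSeries.X) : F[X] →ₐ[F] PowerSeries κ).toRingHom =
      (Polynomial.coeToPowerSeries.ringHom).comp ((mapRingHom (algebraMap F κ)).comp (taylorAlgHom s₀).toRingHom) := by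
      refine Polynomial.ringHom_ext (fun a => ?_) ?_
      · simp [PowerSeries.algebraMap_apply]
      · simp [add_comm]
    have := congrArg (fun f : F[X] →+* PowerSeries κ => f r) this
    simpa using this
  rw [h1, PowerSeries.X_pow_dvd_iff] at h
  have h2 : X ^ n ∣ taylor s₀ r := by
    rw [Polynomial.X_pow_dvd_iff]
    intro d hd
    have := h d hd
    rw [Polynomial.coeff_coe, coeff_map] at this
    exact (map_eq_zero _).1 this
  have h3 := map_dvd (taylorAlgHom (-s₀)) h2
  simp only [map_pow, taylorAlgHom_apply] at h3
  rw [taylor_taylor, neg_add_cancel, taylor_X, taylor_zero] at h3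
  simpa [sub_eq_add_neg] using h3

theorem sum_rootMult_le (r : F[X]) : ∑ s : F, r.rootMultiplicity s ≤ r.natDegree := by
  classical
  refine le_trans ?_ (card_roots' r)
  rw [← Multiset.toFinset_sum_count_eq]
  simp_rw [← count_roots]
  refine le_of_eq (Finset.sum_subset (Finset.subset_univ _) fun s _ hs => ?_).symm
  rw [Multiset.count_eq_zero]
  simpa using hs

theorem stepD (hR : R.Monic) (hirr : Irreducible R) {D : ℕ} (hD1 : 1 ≤ D)
    (hD : ∀ n, (R.coeff n).natDegree ≤ D) (hN : 0 < R.natDegree) (u : PowerSeries F)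
    (hu : bev PowerSeries.X u R = 0) (S : F[X][X]) (hSN : S.natDegree ≤ R.natDegree)
    (hSD : ∀ n, (S.coeff n).natDegree ≤ D) {J I M e N : ℕ} (hNe : N = R.natDegree) (he : e = D + N * D)
    (hJ : N * (J + N * D) < Fintype.card F) (hM : M ≤ Fintype.card F)
    (hcnt : M * (N * (I + N * e + J + N * D + 2 * e * M + 1)) < N * (N * (J * I)))
    (Z : Finset (F × κ))
    (hZ : ∀ z ∈ Z, bev (algebraMap F κ z.1) z.2 R = 0 ∧
      bev (algebraMap F κ z.1) z.2 (derivative R) * z.2 ^ Fintype.card F = bev (algebraMap F κ z.1) z.2 S ∧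
      ∃ y : Fin N → κ, Function.Injective y ∧
        (∀ u, bev (algebraMap F κ z.1) u R = 0 ↔ ∃ i, y i = u) ∧
        ∀ i, bev (algebraMap F κ z.1) (y i) (derivative R) ≠ 0) :
    M * Z.card ≤ N * (J + N * D + (I + N * D) * Fintype.card F) := by
  classical
  subst hNe
  haveI : IsDomain (AdjoinRoot R) := AdjoinRoot.isDomain_of_prime hirr.prime
  have hrm : (AdjoinRoot.mk R S) ∈ (bfil hR).G e := by
    rw [← bev_mk, he]
    refine MFil.bev_mem _ ?_ _ _ (bfil_algebraMap hR (v := 1) _ (by simp)) (bfil_root hR hD) S hSN hSD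
    exact fun c => bfil_algebraMap hR (v := 0) (C c) (by simp)
  obtain ⟨hδ, w, hwG, hw⟩ := newton hR hD1 hD (e := (e : ℤ)) (by rw [he]) _ rfl
  set δ := AdjoinRoot.mk R (derivative R) with hδd
  set x := PowerSeries.C (algebraMap F[X] (AdjoinRoot R) X) + PowerSeries.C (δ ^ 2) * PowerSeries.X with hx
  set y := PowerSeries.C (AdjoinRoot.root R) + PowerSeries.C δ * PowerSeries.X * w with hy
  set Φ := (bfil hR).ps (2 * (e : ℤ)) with hΦ
  have hxm : x ∈ Φ.G 1 := by
    refine add_mem (MFil.ps_C _ _ (bfil_algebraMap hR (v := 1) _ (by simp))) ?_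
    refine Φ.mul' (MFil.ps_C _ _ ((bfil hR).pow hδ 2)) (MFil.ps_X _ _) ?_
    push_cast; linarith
  have hym : y ∈ Φ.G D := by
    refine add_mem (MFil.ps_C _ _ (bfil_root hR hD)) ?_
    refine Φ.mul' (Φ.mul (MFil.ps_C _ _ hδ) (MFil.ps_X _ _)) hwG ?_
    have : (0 : ℤ) ≤ D := Int.natCast_nonneg _
    linarith
  obtain ⟨c, hc0, hcE⟩ := stepA hR hN hxm hym hrm hδ hcnt
  have hh0 := stepC hR hN hD u hu c hc0 hJ
  set r := Algebra.norm F[X] (hh R c) with hr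
  have hr0 : r ≠ 0 := by
    rw [hr, Ne, Algebra.norm_eq_zero_iff_of_basis (AdjoinRoot.powerBasisAux' hR)]; exact hh0
  have hdeg : r.natDegree ≤ R.natDegree * (J + R.natDegree * D + (I + R.natDegree * D) * Fintype.card F) := by
    refine norm_natDegree hR ?_
    refine sum_mem fun a _ => sum_mem fun j _ => ?_
    have h1 := (bfil hR).pow (sT_mem hR hD fun a' i => c (a, a', j, i)) (Fintype.card F)
    refine (bfil hR).mul' ((bfil hR).mul ((bfil hR).pow (bfil_algebraMap hR (v := 1) _ (by simp)) _)
      ((bfil hR).pow (bfil_root hR hD) _)) h1 ?_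
    have : (j : ℕ) * 1 + (a : ℕ) * D + Fintype.card F * (I + R.natDegree * D) ≤
        J + R.natDegree * D + (I + R.natDegree * D) * Fintype.card F := by
      have := Nat.mul_le_mul_right D a.2.le
      have := j.2
      rw [mul_comm (Fintype.card F)]
      omega
    exact_mod_cast this
  have hfib : ∀ s : F, M * (Z.filter fun z => z.1 = s).card ≤ r.rootMultiplicity s := by
    intro s
    rcases (Z.filter fun z => z.1 = s).eq_empty_or_nonempty with hE | ⟨z0, hz0⟩
    · rw [hE]; simp
    obtain ⟨hz0Z, rfl⟩ := Finset.mem_filter.1 hz0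
    obtain ⟨-, -, yy, hinj, hiff, hder⟩ := hZ z0 hz0Z
    apply le_rootMult_of_dvd (κ := κ) r hr0
    have hroot : ∀ i, bev (algebraMap F κ z0.1) (yy i) R = 0 := fun i => (hiff _).2 ⟨i, rfl⟩
    have hUs := fun i => stepU w hδd hx hy hw (algebraMap F κ z0.1) (yy i) (hroot i) (hder i)
    choose U hU hUc θ hθx hθy hθC hθz using hUs
    have hvand : IsUnit (Matrix.vandermonde U).det := by
      rw [PowerSeries.isUnit_iff_constantCoeff]
      have : PowerSeries.constantCoeff (Matrix.vandermonde U).det = (Matrix.vandermonde yy).det := by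
        rw [RingHom.map_det]
        congr 1
        ext i j
        simp [Matrix.vandermonde_apply, hUc]
      rw [this, isUnit_iff_ne_zero]
      exact Matrix.det_vandermonde_ne_zero_iff.2 hinj
    rw [hr, br_norm_prod hR _ U hU hvand]
    set A := Finset.univ.filter fun i => (z0.1, yy i) ∈ Z with hA
    have hcard : (Z.filter fun z => z.1 = z0.1).card ≤ A.card := by
      have : (Z.filter fun z => z.1 = z0.1) ⊆ A.image fun i => (z0.1, yy i) := by
        intro z hz
        obtain ⟨hzZ, hz1⟩ := Finset.mem_filter.1 hz
        obtain ⟨h1, -⟩ := hZ z hzZ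
        rw [hz1] at h1
        obtain ⟨i, hi⟩ := (hiff _).1 h1
        have e1 : (z0.1, yy i) = z := by rw [hi, ← hz1]
        exact Finset.mem_image.2 ⟨i, by simp [hA, e1, hzZ], e1⟩
      exact (Finset.card_le_card this).trans Finset.card_image_le
    refine (pow_dvd_pow _ (Nat.mul_le_mul_left M hcard)).trans ?_
    rw [pow_mul, ← Finset.prod_const]
    refine (Finset.prod_dvd_prod_of_dvd _ _ fun i hi => ?_).trans
      (Finset.prod_dvd_prod_of_subset A Finset.univ _ (Finset.subset_univ _))
    have hiZ : (z0.1, yy i) ∈ Z := by simpa [hA] using hi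
    obtain ⟨g1, g2, -⟩ := hZ _ hiZ
    exact stepB c hM hδd hcE z0.1 (yy i) g1 (hder i) g2 (U i) (hU i) (hUc i) (θ i) (hθx i) (hθy i) (hθC i) (hθz i)
  calc M * Z.card = ∑ s : F, M * (Z.filter fun z => z.1 = s).card := by
        rw [← Finset.mul_sum]
        congr 1
        exact Finset.card_eq_sum_card_fiberwise (f := fun z : F × κ => z.1) (t := Finset.univ) (by intro _ _; simp)
    _ ≤ ∑ s : F, r.rootMultiplicity s := Finset.sum_le_sum fun s _ => hfib s
    _ ≤ _ := (sum_rootMult_le r).trans hdeg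

end stepD

theorem stepanov_num (N D e : ℕ) (hN : 0 < N) : ∃ C q₀ : ℕ, ∀ q : ℕ, q₀ ≤ q → ∃ J I M : ℕ,
    N * (J + N * D) < q ∧ M ≤ q ∧
    M * (N * (I + N * e + J + N * D + 2 * e * M + 1)) < N * (N * (J * I)) ∧
    ∀ z : ℕ, M * z ≤ N * (J + N * D + (I + N * D) * q) → z ≤ q + C * Nat.sqrt q := by
  obtain ⟨A, hA⟩ : ∃ A, A = N * e + N * D + 1 := ⟨_, rfl⟩
  obtain ⟨L, hL⟩ : ∃ L, L = 4 * (2 * e + 1) := ⟨_, rfl⟩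
  obtain ⟨B, hB⟩ : ∃ B, B = 2 + N * (L + 1) + 2 * (N * N * D) := ⟨_, rfl⟩
  obtain ⟨W, hW⟩ : ∃ W, W = L * N + L + 1 + A + 1 + 2 * N * N * D + 1 := ⟨_, rfl⟩
  refine ⟨4 * B, W * W, fun q hq => ?_⟩
  have h1 : Nat.sqrt q * Nat.sqrt q ≤ q := Nat.sqrt_le q
  have h2 : q < (Nat.sqrt q + 1) * (Nat.sqrt q + 1) := Nat.lt_succ_sqrt q
  have h3 : W ≤ Nat.sqrt q := Nat.le_sqrt.2 hq
  obtain ⟨M, hM⟩ : ∃ M, M = Nat.sqrt q := ⟨_, rfl⟩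
  rw [← hM] at h1 h2 h3 ⊢
  have hM1 : 1 ≤ M := by omega
  obtain ⟨J, hJ⟩ : ∃ J, J = q / (2 * N) := ⟨_, rfl⟩
  have hJ1 : 2 * N * J ≤ q := by rw [hJ]; exact Nat.mul_div_le q (2 * N)
  have hJ2 : q < 2 * N * J + 2 * N := by
    have := Nat.lt_mul_div_succ q (show 0 < 2 * N by omega)
    rw [← hJ] at this; linarith
  obtain ⟨I0, hI0⟩ : ∃ I0, I0 = M / N := ⟨_, rfl⟩
  have hI1 : N * I0 ≤ M := by rw [hI0]; exact Nat.mul_div_le M N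
  have hI2 : M < N * I0 + N := by
    have := Nat.lt_mul_div_succ M hN
    rw [← hI0] at this; linarith
  have hMq : M ≤ q := (Nat.le_mul_of_pos_left M hM1).trans h1
  have hWM : W * M ≤ q := (Nat.mul_le_mul_right M h3).trans h1
  have hWq : W ≤ q := h3.trans hMq
  refine ⟨J, I0 + (L + 1), M, ?_, hMq, ?_, ?_⟩
  · have h5 : 2 * N * N * D < q := by omega
    have h6 : 2 * (N * (J + N * D)) = 2 * N * J + 2 * N * N * D := by ring
    omega
  · rw [mul_left_comm]
    refine Nat.mul_lt_mul_of_pos_left ?_ hN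
    have hI3 : I0 ≤ M := by rw [hI0]; exact Nat.div_le_self _ _
    have e1 : M * (I0 + (L + 1) + N * e + J + N * D + 2 * e * M + 1) ≤
      M * J + (2 * e + 1) * (M * M) + M * (L + 1 + A) := by
      have k1 := Nat.mul_le_mul_left M hI3
      rw [hA]
      have k2 : M * (I0 + (L + 1) + N * e + J + N * D + 2 * e * M + 1) = M * I0 + M * J + 2 * e * (M * M) +
        M * (L + 1 + (N * e + N * D + 1)) := by ring
      have k3 : (2 * e + 1) * (M * M) = 2 * e * (M * M) + M * M := by ring
      omega
    have e2 : J * M + J * (N * L) ≤ N * (J * (I0 + (L + 1))) := by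
      have k1 := Nat.mul_le_mul_left J hI2.le
      have k2 : N * (J * (I0 + (L + 1))) = J * (N * I0 + N) + J * (N * L) := by ring
      omega
    have e3 : (2 * e + 1) * (M * M) + M * (L + 1 + A) < J * (N * L) := by
      have f1 : L * (M * M) ≤ L * (2 * N * J + 2 * N) := Nat.mul_le_mul_left _ (by omega)
      have f2 : M * (L * N + L + 1 + A + 1) ≤ M * M := Nat.mul_le_mul_left _ (by omega)
      have f3 : L * N ≤ M * (L * N) := Nat.le_mul_of_pos_left _ hM1
      have f4 : L * (M * M) = 4 * ((2 * e + 1) * (M * M)) := by rw [hL]; ring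
      have f5 : M * M ≤ (2 * e + 1) * (M * M) := Nat.le_mul_of_pos_left _ (by omega)
      have f6 : L * (2 * N * J + 2 * N) = 2 * (J * (N * L)) + 2 * (L * N) := by ring
      have f7 : M * (L * N + L + 1 + A + 1) = M * (L * N) + M * (L + 1 + A) + M := by ring
      omega
    linarith
  · intro z hz
    have g1 : M * z ≤ M * q + B * q := by
      have : N * N * D ≤ N * N * D * q := Nat.le_mul_of_pos_right _ (by omega)
      have k1 : N * (J + N * D + (I0 + (L + 1) + N * D) * q) = N * J + N * N * D + (N * I0) * q + (N * (L + 1)) * q +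
        N * N * D * q := by ring
      have k2 := Nat.mul_le_mul_right q hI1
      have k3 : B * q = 2 * q + (N * (L + 1)) * q + 2 * (N * N * D * q) := by rw [hB]; ring
      have k4 : 2 * N * J = 2 * (N * J) := by ring
      omega
    have g2 : q ≤ 4 * (M * M) := by
      have k1 : (M + 1) * (M + 1) ≤ (M + M) * (M + M) := Nat.mul_le_mul (by omega) (by omega)
      have k2 : (M + M) * (M + M) = 4 * (M * M) := by ring
      omega
    have g3 : M * z ≤ M * (q + 4 * B * M) := by
      have k1 := Nat.mul_le_mul_left B g2
      have k2 : M * (q + 4 * B * M) = M * q + B * (4 * (M * M)) := by ring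
      omega
    exact Nat.le_of_mul_le_mul_left g3 hM1

/-- Point count upper bound on an irreducible plane curve with Frobenius condition. -/
theorem stepanov (N D : ℕ) (hN : 0 < N) (hD1 : 1 ≤ D) : ∃ C q₀ : ℕ,
    ∀ (F κ : Type) [Field F] [Fintype F] [Field κ] [Algebra F κ], q₀ ≤ Fintype.card F →
    ∀ (R : F[X][X]), R.Monic → Irreducible R → (∀ n, (R.coeff n).natDegree ≤ D) →
      N = R.natDegree → (∃ u : PowerSeries F, bev PowerSeries.X u R = 0) →
    ∀ S : F[X][X], S.natDegree ≤ R.natDegree → (∀ n, (S.coeff n).natDegree ≤ D) →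
    ∀ Z : Finset (F × κ), (∀ z ∈ Z, bev (algebraMap F κ z.1) z.2 R = 0 ∧
      bev (algebraMap F κ z.1) z.2 (derivative R) * z.2 ^ Fintype.card F = bev (algebraMap F κ z.1) z.2 S ∧
      ∃ y : Fin N → κ, Function.Injective y ∧
        (∀ u, bev (algebraMap F κ z.1) u R = 0 ↔ ∃ i, y i = u) ∧
        ∀ i, bev (algebraMap F κ z.1) (y i) (derivative R) ≠ 0) →
    Z.card ≤ Fintype.card F + C * Nat.sqrt (Fintype.card F) := by
  obtain ⟨C, q₀, h⟩ := stepanov_num N D (D + N * D) hN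
  refine ⟨C, q₀, fun F κ _ _ _ _ hq R hR hirr hD hNe ⟨u, hu⟩ S hSN hSD Z hZ => ?_⟩
  obtain ⟨J, I, M, hJ, hM, hc, hz⟩ := h _ hq
  exact hz _ (stepD hR hirr hD1 hD (hNe ▸ hN) u hu S hSN hSD hNe rfl hJ hM hc Z hZ)

section elim
variable {k : ℕ}

/-- Monomials of total degree at most `e`. -/
abbrev Mon (k e : ℕ) : Type := {a : Fin k → ℕ // ∑ i, a i ≤ e}

theorem Mon_le {k e : ℕ} (a : Mon k e) (i : Fin k) : a.1 i ≤ e :=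
  (Finset.single_le_sum (f := a.1) (fun _ _ => Nat.zero_le _) (Finset.mem_univ i)).trans a.2

instance Mon_fin (k e : ℕ) : Finite (Mon k e) := by
  refine Finite.of_injective (fun a : Mon k e => fun i => (⟨a.1 i, Nat.lt_succ_of_le (Mon_le a i)⟩ : Fin (e + 1))) ?_
  intro a b h
  apply Subtype.ext
  funext i
  have := congrFun h i
  simpa using this

noncomputable instance Mon_ft (k e : ℕ) : Fintype (Mon k e) := Fintype.ofFinite _

abbrev Idx (d : Fin k → ℕ) : Type := (i : Fin k) × Mon k (d i)

def mon {A : Type*} [CommRing A] (x : Fin k → A) (a : Fin k → ℕ) : A := ∏ j, x j ^ a j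

theorem mon_add {A : Type*} [CommRing A] (x : Fin k → A) (a b : Fin k → ℕ) :
    mon x (a + b) = mon x a * mon x b := by
  simp [mon, pow_add, Finset.prod_mul_distrib]

theorem mon_single {A : Type*} [CommRing A] (x : Fin k → A) (i : Fin k) (n : ℕ) :
    mon x (Pi.single i n) = x i ^ n := by
  rw [mon, Finset.prod_eq_single i]
  · simp
  · intro b _ hb; simp [hb]
  · simp

variable (d : Fin k → ℕ)

def eD : ℕ := ∑ i, (d i - 1) + 1
abbrev Box : Type := (i : Fin k) → Fin (d i)

theorem box_sum (a : Box d) : ∑ i, (a i : ℕ) ≤ ∑ i, (d i - 1) :=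
  Finset.sum_le_sum fun i _ => by have := (a i).2; omega

def bx (a : Box d) : Mon k (eD d) := ⟨fun i => a i, (box_sum d a).trans (Nat.le_succ _)⟩
def bxs (i : Fin k) (a : Box d) : Mon k (eD d) := ⟨(fun i => (a i : ℕ)) + Pi.single i 1, by
  simp only [Pi.add_apply, Finset.sum_add_distrib, Finset.sum_pi_single', eD]
  simpa using box_sum d a⟩

theorem bx_inj : Function.Injective (bx d) := by
  intro a b h
  funext i
  have := congrFun (congrArg Subtype.val h) i
  exact Fin.ext this

variable {A : Type*} [CommRing A] {A' : Type*} [CommRing A']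

noncomputable def sev {d : Fin k → ℕ} (c : Idx d → A) (i : Fin k) (x : Fin k → A) : A :=
  ∑ m : Mon k (d i), c ⟨i, m⟩ * mon x m.1

open Classical in
noncomputable def Tht {d : Fin k → ℕ} (c : Idx d → A) : Matrix (Mon k (eD d)) (Mon k (eD d)) A := fun b a =>
  if h : ∃ i, d i ≤ a.1 i then
    ∑ m : Mon k (d h.choose), if b.1 = a.1 - Pi.single h.choose (d h.choose) + m.1 then c ⟨h.choose, m⟩ else 0
  else if b = a then 1 else 0

noncomputable def Del {d : Fin k → ℕ} (c : Idx d → A) : A := (Tht c).det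

noncomputable def MM {d : Fin k → ℕ} (c : Idx d → A) (i : Fin k) : Matrix (Box d) (Box d) A :=
  fun a b => (Tht c).adjugate (bx d a) (bxs d i b)

noncomputable def PP {d : Fin k → ℕ} (μ : Fin k → A) (c : Idx d → A) : A[X] :=
  (∑ i, μ i • MM c i).charpoly

variable {d}

theorem Tht_map (f : A →+* A') (c : Idx d → A) : (Tht c).map f = Tht (f ∘ c) := by
  ext b a
  simp only [Matrix.map_apply, Tht]
  split_ifs with h h1
  · rw [map_sum]
    refine Finset.sum_congr rfl fun m _ => ?_
    split_ifs <;> simp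
  · simp
  · simp

theorem Del_map (f : A →+* A') (c : Idx d → A) : f (Del c) = Del (f ∘ c) := by
  rw [Del, RingHom.map_det, Del, ← Tht_map]; rfl

theorem MM_map (f : A →+* A') (c : Idx d → A) (i : Fin k) : (MM c i).map f = MM (f ∘ c) i := by
  ext a b
  simp only [Matrix.map_apply, MM]
  rw [← Tht_map, ← RingHom.mapMatrix_apply, ← RingHom.map_adjugate]; rfl

theorem PP_map (f : A →+* A') (μ : Fin k → A) (c : Idx d → A) :
    (PP μ c).map f = PP (f ∘ μ) (f ∘ c) := by
  rw [PP, PP, ← Matrix.charpoly_map]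
  congr 1
  ext a b
  simp [Matrix.sum_apply, ← MM_map]

theorem PP_monic (μ : Fin k → A) (c : Idx d → A) : (PP μ c).Monic := Matrix.charpoly_monic _

theorem mon_sub_single (a : Mon k (eD d)) (i : Fin k) (h : d i ≤ a.1 i) (m : Mon k (d i)) :
    ∑ j, (a.1 - Pi.single i (d i) + m.1 : Fin k → ℕ) j ≤ eD d := by
  have h1 : ∑ j, (a.1 - Pi.single i (d i) : Fin k → ℕ) j + d i = ∑ j, a.1 j := by
    have : a.1 = (a.1 - Pi.single i (d i)) + Pi.single i (d i) := by
      funext j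
      by_cases hj : j = i
      · subst hj; simp [h]
      · simp [hj]
    conv_rhs => rw [this]
    simp [Finset.sum_add_distrib]
  have h2 := a.2
  have h3 := m.2
  simp only [Pi.add_apply, Finset.sum_add_distrib]
  omega

theorem vecMul_Tht (c : Idx d → A) (x : Fin k → A) (hx : ∀ i, sev c i x = 0) :
    Matrix.vecMul (fun b : Mon k (eD d) => mon x b.1) (Tht c) =
      fun a => if ∃ i, d i ≤ a.1 i then 0 else mon x a.1 := by
  funext a
  simp only [Matrix.vecMul, dotProduct, Tht]
  by_cases h : ∃ i, d i ≤ a.1 i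
  · simp only [h, dite_true, if_true]
    obtain ⟨i, hi⟩ : ∃ i, i = h.choose := ⟨_, rfl⟩
    have hd : d i ≤ a.1 i := hi ▸ h.choose_spec
    rw [← hi]
    simp_rw [Finset.mul_sum]
    rw [Finset.sum_comm]
    refine Eq.trans ?_ ((congrArg (fun z => mon x (a.1 - Pi.single i (d i)) * z) (hx i)).trans (mul_zero _))
    simp only [sev, Finset.mul_sum]
    refine Finset.sum_congr rfl fun m _ => ?_
    rw [Finset.sum_eq_single ⟨_, mon_sub_single a i hd m⟩]
    · simp [mon_add]; ring
    · intro b _ hb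
      rw [if_neg, mul_zero]
      exact fun h => hb (Subtype.ext h)
    · simp
  · simp only [h, dite_false, if_false]
    rw [Finset.sum_eq_single a]
    · simp
    · intro b _ hb; simp [hb]
    · simp

theorem zero_eig (c : Idx d → A) (x : Fin k → A) (hx : ∀ i, sev c i x = 0) (i : Fin k) :
    Matrix.vecMul (fun a : Box d => mon x fun j => a j) (MM c i) =
      (Del c * x i) • (fun a : Box d => mon x fun j => a j) := by
  have h := congrArg (fun v => Matrix.vecMul v (Tht c).adjugate) (vecMul_Tht c x hx)
  simp only [Matrix.vecMul_vecMul, Matrix.mul_adjugate, Matrix.vecMul_smul, Matrix.vecMul_one] at h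
  funext b
  have hb := congrFun h (bxs d i b)
  simp only [Pi.smul_apply, smul_eq_mul] at hb ⊢
  rw [show mon x (bxs d i b).1 = (mon x fun j => b j) * x i from by
    rw [bxs, mon_add, mon_single, pow_one]] at hb
  rw [Del, mul_assoc, mul_comm (x i), hb]
  simp only [Matrix.vecMul, dotProduct, MM]
  refine Fintype.sum_of_injective (bx d) (bx_inj d) _ _ ?_ ?_
  · intro a ha
    rw [if_pos, zero_mul]
    by_contra hcon
    push Not at hcon
    exact ha ⟨fun j => ⟨a.1 j, hcon j⟩, Subtype.ext rfl⟩
  · intro a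
    rw [if_neg]
    · rfl
    · push Not; exact fun j => (a j).2

end elim

section elim2
variable {k : ℕ} {d : Fin k → ℕ} {A : Type*} [CommRing A]

def wt (w a : Fin k → ℕ) : ℕ := ∑ j, w j * a j

theorem wt_add (w a b : Fin k → ℕ) : wt w (a + b) = wt w a + wt w b := by
  simp [wt, mul_add, Finset.sum_add_distrib]

theorem wt_single (w : Fin k → ℕ) (i : Fin k) (n : ℕ) : wt w (Pi.single i n) = w i * n := by
  rw [wt, Finset.sum_eq_single i]
  · simp
  · intro b _ hb; simp [hb]
  · simp

theorem Tht_weight (c : Idx d → A) (w : Fin k → ℕ)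
    (h1 : ∀ i (m : Mon k (d i)), m.1 = Pi.single i (d i) → c ⟨i, m⟩ = 1)
    (h2 : ∀ i (m : Mon k (d i)), m.1 ≠ Pi.single i (d i) → c ⟨i, m⟩ ≠ 0 → wt w m.1 < w i * d i)
    (b a : Mon k (eD d)) (hab : wt w a.1 ≤ wt w b.1) : Tht c b a = if b = a then 1 else 0 := by
  rw [Tht]
  by_cases h : ∃ i, d i ≤ a.1 i
  · simp only [h, dite_true]
    obtain ⟨i, hi⟩ : ∃ i, i = h.choose := ⟨_, rfl⟩
    have hd : d i ≤ a.1 i := hi ▸ h.choose_spec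
    rw [← hi]
    have ha : a.1 - Pi.single i (d i) + Pi.single i (d i) = a.1 := by
      funext j
      by_cases hj : j = i
      · subst hj; simp [hd]
      · simp [hj]
    have hwa := congrArg (wt w) ha
    rw [wt_add, wt_single] at hwa
    rw [Finset.sum_eq_single (⟨Pi.single i (d i), by simp⟩ : Mon k (d i))]
    · simp only [ha, h1, Subtype.ext_iff]
    · intro m _ hm
      by_contra hne
      rw [ite_eq_right_iff] at hne
      push Not at hne
      have := h2 i m (fun h => hm (Subtype.ext h)) hne.2
      rw [hne.1, wt_add] at hab
      omega
    · simp
  · simp only [h, dite_false]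

theorem Del_weight (c : Idx d → A) (w : Fin k → ℕ)
    (h1 : ∀ i (m : Mon k (d i)), m.1 = Pi.single i (d i) → c ⟨i, m⟩ = 1)
    (h2 : ∀ i (m : Mon k (d i)), m.1 ≠ Pi.single i (d i) → c ⟨i, m⟩ ≠ 0 → wt w m.1 < w i * d i) :
    Del c = 1 := by
  have hB : (Tht c).BlockTriangular (fun b => wt w b.1) := by
    intro b a hba
    rw [Tht_weight c w h1 h2 b a hba.le, if_neg]
    rintro rfl; exact lt_irrefl _ hba
  rw [Del, hB.det]
  refine Finset.prod_eq_one fun v _ => ?_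
  have : (Tht c).toSquareBlock (fun b => wt w b.1) v = 1 := by
    ext b a
    rw [Matrix.toSquareBlock_def, Matrix.of_apply, Tht_weight c w h1 h2 b.1 a.1 (by rw [a.2, b.2])]
    simp [Matrix.one_apply, Subtype.ext_iff]
  rw [this, Matrix.det_one]

/-- left eigenvector of the combination -/
theorem zero_eig_sum (μ : Fin k → A) (c : Idx d → A) (x : Fin k → A) (hx : ∀ i, sev c i x = 0) :
    Matrix.vecMul (fun a : Box d => mon x fun j => a j) (∑ i, μ i • MM c i) =
      (Del c * ∑ i, μ i * x i) • (fun a : Box d => mon x fun j => a j) := by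
  rw [Matrix.vecMul_sum, Finset.mul_sum, Finset.sum_smul]
  refine Finset.sum_congr rfl fun i _ => ?_
  rw [Matrix.vecMul_smul, zero_eig c x hx, smul_smul]
  congr 1; ring

theorem monbox_ne [Nontrivial A] (hd : ∀ i, 0 < d i) (x : Fin k → A) :
    (fun a : Box d => mon x fun j => a j) ≠ 0 := by
  intro h
  have := congrFun h (fun i => ⟨0, hd i⟩)
  simp [mon] at this

theorem PP_root [IsDomain A] (hd : ∀ i, 0 < d i) (μ : Fin k → A) (c : Idx d → A) (x : Fin k → A)
    (hx : ∀ i, sev c i x = 0) : (PP μ c).IsRoot (Del c * ∑ i, μ i * x i) := by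
  rw [IsRoot, PP, Matrix.eval_charpoly, ← Matrix.exists_vecMul_eq_zero_iff]
  refine ⟨_, monbox_ne hd x, ?_⟩
  rw [Matrix.vecMul_sub, zero_eig_sum μ c x hx, sub_eq_zero]
  rw [Matrix.scalar_apply, ← Matrix.smul_one_eq_diagonal, Matrix.vecMul_smul, Matrix.vecMul_one]

theorem card_Box : Fintype.card (Box d) = ∏ i, d i := by simp [Box]

theorem PP_prod [IsDomain A] (hd : ∀ i, 0 < d i) (μ : Fin k → A) (c : Idx d → A) (x : Box d → Fin k → A)
    (hx : ∀ b i, sev c i (x b) = 0) (hinj : Function.Injective fun b => Del c * ∑ i, μ i * x b i) :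
    PP μ c = ∏ b, (X - C (Del c * ∑ i, μ i * x b i)) := by
  have hdvd : (∏ b, (X - C (Del c * ∑ i, μ i * x b i))) ∣ PP μ c := by
    have h := Multiset.prod_X_sub_C_dvd_iff_le_roots (PP_monic μ c).ne_zero
      ((Finset.univ : Finset (Box d)).val.map fun b => Del c * ∑ i, μ i * x b i)
    rw [Multiset.map_map] at h
    refine h.2 ?_
    rw [Multiset.le_iff_subset (Multiset.Nodup.map hinj Finset.univ.nodup)]
    intro y hy
    obtain ⟨b, -, rfl⟩ := Multiset.mem_map.1 hy
    exact (mem_roots (PP_monic μ c).ne_zero).2 (PP_root hd μ c _ (hx b))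
  refine (Polynomial.eq_of_monic_of_dvd_of_natDegree_le (monic_prod_of_monic _ _ fun b _ => monic_X_sub_C _)
    (PP_monic μ c) hdvd ?_)
  rw [PP, Matrix.charpoly_natDegree_eq_dim, natDegree_prod_of_monic _ _ fun b _ => monic_X_sub_C _]
  simp_rw [natDegree_X_sub_C]
  simp

/-- ordered matrix monomial -/
noncomputable def lmon (c : Idx d → A) (m : Fin k → ℕ) : Matrix (Box d) (Box d) A :=
  (List.ofFn fun j => MM c j ^ m j).prod

theorem vecMul_pow_eig {ι : Type*} [Fintype ι] [DecidableEq ι] (v : ι → A) (M : Matrix ι ι A) (y : A)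
    (h : Matrix.vecMul v M = y • v) (n : ℕ) : Matrix.vecMul v (M ^ n) = y ^ n • v := by
  induction n with
  | zero => simp
  | succ n ih => rw [pow_succ, ← Matrix.vecMul_vecMul, ih, Matrix.smul_vecMul, h, smul_smul, pow_succ]

theorem vecMul_ofFn_eig {ι : Type*} [Fintype ι] [DecidableEq ι] (v : ι → A) {n : ℕ} (M : Fin n → Matrix ι ι A)
    (y : Fin n → A) (h : ∀ j, Matrix.vecMul v (M j) = y j • v) :
    Matrix.vecMul v (List.ofFn M).prod = (∏ j, y j) • v := by
  induction n with
  | zero => simp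
  | succ n ih =>
    rw [List.ofFn_succ, List.prod_cons, ← Matrix.vecMul_vecMul, h, Matrix.smul_vecMul, ih _ _ fun j => h j.succ,
      smul_smul, Fin.prod_univ_succ]

theorem lmon_eig (c : Idx d → A) (v : Box d → A) (y : Fin k → A)
    (h : ∀ j, Matrix.vecMul v (MM c j) = y j • v) (m : Fin k → ℕ) :
    Matrix.vecMul v (lmon c m) = mon y m • v :=
  vecMul_ofFn_eig v _ _ fun j => vecMul_pow_eig v _ _ (h j) _

noncomputable def homf (c : Idx d → A) (i : Fin k) : Matrix (Box d) (Box d) A :=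
  ∑ m : Mon k (d i), (c ⟨i, m⟩ * Del c ^ (d i - ∑ j, m.1 j)) • lmon c m.1

theorem mon_smul (a : A) (x : Fin k → A) (m : Fin k → ℕ) :
    mon (fun j => a * x j) m = a ^ (∑ j, m j) * mon x m := by
  simp [mon, mul_pow, Finset.prod_mul_distrib, Finset.prod_pow_eq_pow_sum]

theorem homf_eig (c : Idx d → A) (v : Box d → A) (x : Fin k → A)
    (h : ∀ j, Matrix.vecMul v (MM c j) = (Del c * x j) • v) (i : Fin k) :
    Matrix.vecMul v (homf c i) = (Del c ^ d i * sev c i x) • v := by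
  rw [homf, Matrix.vecMul_sum, sev, Finset.mul_sum, Finset.sum_smul]
  refine Finset.sum_congr rfl fun m _ => ?_
  rw [Matrix.vecMul_smul, lmon_eig c v _ h, smul_smul, mon_smul]
  congr 1
  have : Del c ^ d i = Del c ^ (d i - ∑ j, m.1 j) * Del c ^ (∑ j, m.1 j) := by
    rw [← pow_add, Nat.sub_add_cancel m.2]
  rw [this]; ring

theorem mat_zero_of_eig [IsDomain A] {ι : Type*} [Fintype ι] [DecidableEq ι] (M W : Matrix ι ι A) (v : ι → ι → A)
    (y : ι → A) (hy : Function.Injective y) (hv : ∀ b, v b ≠ 0) (h : ∀ b, Matrix.vecMul (v b) M = y b • v b)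
    (hW : ∀ b, Matrix.vecMul (v b) W = 0) : W = 0 := by
  have hli : LinearIndependent A v := by
    refine Module.End.eigenvectors_linearIndependent' (Matrix.vecMulLinear M) y hy v fun b => ?_
    rw [Module.End.hasEigenvector_iff, Module.End.mem_eigenspace_iff]
    exact ⟨h b, hv b⟩
  have hdet : (Matrix.of v).det ≠ 0 := by
    intro h0
    obtain ⟨w, hw, hw0⟩ := Matrix.exists_vecMul_eq_zero_iff.2 h0
    apply hw
    have := Fintype.linearIndependent_iff.1 hli w (by
      rw [← hw0]; funext a; simp [Matrix.vecMul, dotProduct])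
    exact funext this
  have h0 : Matrix.of v * W = 0 := by
    ext b a
    have := congrFun (hW b) a
    simpa [Matrix.mul_apply, Matrix.vecMul, dotProduct] using this
  have h1 : (Matrix.of v).det • W = 0 := by
    have := congrArg (fun Z => (Matrix.of v).adjugate * Z) h0
    simpa [← Matrix.mul_assoc, Matrix.adjugate_mul] using this
  ext a b
  have := congrFun (congrFun h1 a) b
  simpa [hdet] using this

theorem ident_of_zeros [IsDomain A] (hd : ∀ i, 0 < d i) (μ : Fin k → A) (c : Idx d → A) (x : Box d → Fin k → A)
    (hx : ∀ b i, sev c i (x b) = 0) (hinj : Function.Injective fun b => Del c * ∑ i, μ i * x b i) :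
    (∀ i j, MM c i * MM c j = MM c j * MM c i) ∧ ∀ i, homf c i = 0 := by
  constructor
  · intro i j
    rw [← sub_eq_zero]
    refine mat_zero_of_eig _ _ _ _ hinj (fun b => monbox_ne hd (x b)) (fun b => zero_eig_sum μ c _ (hx b)) fun b => ?_
    rw [Matrix.vecMul_sub, ← Matrix.vecMul_vecMul, ← Matrix.vecMul_vecMul, zero_eig c _ (hx b), zero_eig c _ (hx b),
      Matrix.smul_vecMul, Matrix.smul_vecMul, zero_eig c _ (hx b), zero_eig c _ (hx b), smul_smul, smul_smul,
      mul_comm, sub_self]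
  · intro i
    refine mat_zero_of_eig _ _ _ _ hinj (fun b => monbox_ne hd (x b)) (fun b => zero_eig_sum μ c _ (hx b)) fun b => ?_
    rw [homf_eig c _ (x b) (zero_eig c _ (hx b)), hx b]
    simp

theorem lmon_map {A' : Type*} [CommRing A'] (f : A →+* A') (c : Idx d → A) (m : Fin k → ℕ) :
    (lmon c m).map f = lmon (f ∘ c) m := by
  rw [lmon, lmon, ← RingHom.mapMatrix_apply, map_list_prod, List.map_ofFn]
  congr 2
  funext j
  simp only [Function.comp]
  rw [map_pow, RingHom.mapMatrix_apply, MM_map]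

theorem homf_map {A' : Type*} [CommRing A'] (f : A →+* A') (c : Idx d → A) (i : Fin k) :
    (homf c i).map f = homf (f ∘ c) i := by
  ext a b
  simp only [homf, Matrix.map_apply, Matrix.sum_apply, Matrix.smul_apply, map_sum, smul_eq_mul, map_mul, map_pow,
    Del_map, ← lmon_map, Function.comp]

theorem exact_zeros {F : Type*} [Field F] [Finite F] (hd : ∀ i, 0 < d i) (μ : Fin k → F) (c : Idx d → F)
    (hD : Del c ≠ 0) (hcomm : ∀ i j, MM c i * MM c j = MM c j * MM c i) (hf : ∀ i, homf c i = 0)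
    (y : Box d → F) (hy : Function.Injective y) (hP : PP μ c = ∏ b, (X - C (y b))) :
    Nat.card {x : Fin k → F // ∀ i, sev c i x = 0} = ∏ i, d i := by
  classical
  rw [← card_Box, ← Nat.card_eq_fintype_card]
  set M := ∑ i, μ i • MM c i with hM
  have hex : ∀ b, ∃ v, v ≠ 0 ∧ Matrix.vecMul v M = y b • v := by
    intro b
    have h0 : (PP μ c).eval (y b) = 0 := by
      rw [hP, eval_prod]; exact Finset.prod_eq_zero (Finset.mem_univ b) (by simp)
    rw [PP, Matrix.eval_charpoly, ← Matrix.exists_vecMul_eq_zero_iff] at h0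
    obtain ⟨v, hv, h⟩ := h0
    refine ⟨v, hv, ?_⟩
    rw [Matrix.vecMul_sub, sub_eq_zero, Matrix.scalar_apply, ← Matrix.smul_one_eq_diagonal, Matrix.vecMul_smul,
      Matrix.vecMul_one] at h
    exact h.symm
  choose v hv0 hv using hex
  have hli : LinearIndependent F v := by
    refine Module.End.eigenvectors_linearIndependent' (Matrix.vecMulLinear M) y hy v fun b => ?_
    rw [Module.End.hasEigenvector_iff, Module.End.mem_eigenspace_iff]
    exact ⟨hv b, hv0 b⟩
  have hspan : ∀ u : Box d → F, ∃ a : Box d → F, u = ∑ b, a b • v b := by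
    intro u
    have : Nonempty (Box d) := ⟨fun i => ⟨0, hd i⟩⟩
    let B := basisOfLinearIndependentOfCardEqFinrank hli (by simp)
    refine ⟨fun b => B.repr u b, ?_⟩
    have := (B.sum_repr u).symm
    simpa [B] using this
  have hone : ∀ b u, Matrix.vecMul u M = y b • u → ∃ a : F, u = a • v b := by
    intro b u hu
    obtain ⟨a, ha⟩ := hspan u
    have h1 : ∑ b', (a b' * (y b' - y b)) • v b' = 0 := by
      have h2 := hu
      rw [ha, Matrix.sum_vecMul, Finset.smul_sum, ← sub_eq_zero, ← Finset.sum_sub_distrib] at h2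
      rw [← h2]
      refine Finset.sum_congr rfl fun b' _ => ?_
      rw [Matrix.smul_vecMul, hv, smul_smul, smul_smul, ← sub_smul]
      congr 1; ring
    have h3 := Fintype.linearIndependent_iff.1 hli _ h1
    refine ⟨a b, ha.trans (Finset.sum_eq_single b (fun b' _ hb => ?_) (by simp))⟩
    have := (mul_eq_zero.1 (h3 b')).resolve_right (sub_ne_zero.2 fun h => hb (hy h))
    rw [this, zero_smul]
  have hnu : ∀ b i, ∃ ν : F, Matrix.vecMul (v b) (MM c i) = ν • v b := by
    intro b i
    apply hone
    have hcm : MM c i * M = M * MM c i := by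
      rw [hM, Finset.mul_sum, Finset.sum_mul]
      refine Finset.sum_congr rfl fun j _ => ?_
      rw [Matrix.mul_smul, Matrix.smul_mul, hcomm]
    rw [Matrix.vecMul_vecMul, hcm, ← Matrix.vecMul_vecMul, hv, Matrix.smul_vecMul]
  choose ν hν using hnu
  have hyν : ∀ b, y b = ∑ i, μ i * ν b i := by
    intro b
    have h1 := hv b
    rw [hM, Matrix.vecMul_sum] at h1
    simp_rw [Matrix.vecMul_smul, hν, smul_smul, ← Finset.sum_smul] at h1
    exact (smul_left_injective F (hv0 b) h1).symm
  let X0 : Box d → Fin k → F := fun b i => ν b i / Del c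
  have hX0 : ∀ b j, Del c * X0 b j = ν b j := fun b j => by simp only [X0]; field_simp
  have hz : ∀ b i, sev c i (X0 b) = 0 := by
    intro b i
    have h1 := homf_eig c (v b) (X0 b) (fun j => by rw [hX0]; exact hν b j) i
    rw [hf, Matrix.vecMul_zero] at h1
    have := (smul_eq_zero.1 h1.symm).resolve_right (hv0 b)
    exact (mul_eq_zero.1 this).resolve_left (pow_ne_zero _ hD)
  symm
  refine Nat.card_eq_of_bijective (fun b => ⟨X0 b, hz b⟩) ⟨?_, ?_⟩
  · intro b b' h
    have h1 : X0 b = X0 b' := congrArg Subtype.val h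
    apply hy
    rw [hyν, hyν]
    simp_rw [← hX0, h1]
  · rintro ⟨x, hx⟩
    have hroot := PP_root hd μ c x hx
    rw [hP, IsRoot, eval_prod, Finset.prod_eq_zero_iff] at hroot
    obtain ⟨b, -, hb⟩ := hroot
    simp only [eval_sub, eval_X, eval_C, sub_eq_zero] at hb
    refine ⟨b, Subtype.ext ?_⟩
    have h1 := zero_eig_sum μ c x hx
    rw [hb] at h1
    obtain ⟨a, ha⟩ := hone b _ h1
    have ha0 : a ≠ 0 := by
      rintro rfl
      exact monbox_ne hd x (ha.trans (zero_smul _ _))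
    funext i
    have h2 := zero_eig c x hx i
    rw [ha, Matrix.smul_vecMul, hν, smul_smul, smul_smul] at h2
    have h3 := smul_left_injective F (hv0 b) h2
    have h4 : ν b i = Del c * x i := mul_left_cancel₀ ha0 (by simpa [mul_comm] using h3)
    simp only [X0, h4]
    field_simp

end elim2

section base
variable {k : ℕ} {d : Fin k → ℕ} {F : Type*} [Field F] (e : (i : Fin k) → Fin (d i) → F)

noncomputable def phi (i : Fin k) : F[X] := ∏ j, (X - C (e i j))

theorem phi_monic (i : Fin k) : (phi e i).Monic := monic_prod_of_monic _ _ fun _ _ => monic_X_sub_C _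

theorem phi_natDegree (i : Fin k) : (phi e i).natDegree = d i := by
  rw [phi, natDegree_prod_of_monic _ _ fun j _ => monic_X_sub_C _]
  simp_rw [natDegree_X_sub_C]; simp

noncomputable def c0 : Idx d → F := fun p => if p.2.1 = Pi.single p.1 (p.2.1 p.1) then (phi e p.1).coeff (p.2.1 p.1) else 0

theorem sev_c0 {E : Type*} [CommRing E] (ι : F →+* E) (i : Fin k) (x : Fin k → E) :
    sev (ι ∘ c0 e) i x = (phi e i).eval₂ ι (x i) := by
  rw [eval₂_eq_sum_range' ι (Nat.lt_succ_of_le (phi_natDegree e i).le), Finset.sum_range, sev]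
  symm
  refine Fintype.sum_of_injective (fun n : Fin (d i).succ =>
    (⟨Pi.single i (n : ℕ), by simpa using Nat.le_of_lt_succ n.2⟩ : Mon k (d i))) ?_ _ _ ?_ ?_
  · intro a b h
    have := congrFun (congrArg Subtype.val h) i
    simp only [Pi.single_eq_same] at this
    exact Fin.ext this
  · intro m hm
    simp only [c0, Function.comp]
    rw [if_neg, map_zero, zero_mul]
    intro h
    exact hm ⟨⟨m.1 i, Nat.lt_succ_of_le (Mon_le m i)⟩, Subtype.ext h.symm⟩
  · intro n
    simp [c0, mon_single]

theorem Del_c0 : Del (c0 e) = 1 := by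
  refine Del_weight _ 1 ?_ ?_
  · intro i m hm
    simp only [c0]
    rw [hm, Pi.single_eq_same, if_pos rfl]
    have := phi_monic e i
    rw [Monic, leadingCoeff, phi_natDegree] at this
    exact this
  · intro i m hm hne
    simp only [c0, ne_eq, ite_eq_right_iff, not_forall] at hne
    obtain ⟨h, h'⟩ := hne
    rw [h, wt_single]
    have h1 : m.1 i ≠ d i := fun h2 => hm (by rw [h, h2])
    have := Mon_le m i
    simp only [Pi.one_apply, one_mul]
    omega

theorem phi_der {i : Fin k} (he : Function.Injective (e i)) (j : Fin (d i)) :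
    (phi e i).eval (e i j) = 0 ∧ (derivative (phi e i)).eval (e i j) ≠ 0 := by
  constructor
  · rw [phi, eval_prod]; exact Finset.prod_eq_zero (Finset.mem_univ j) (by simp)
  · rw [phi, derivative_prod_finset, eval_finsetSum, Finset.sum_eq_single j]
    · simp only [derivative_sub, derivative_X, derivative_C, sub_zero, mul_one, eval_prod, eval_sub, eval_X, eval_C]
      rw [Finset.prod_ne_zero_iff]
      intro j' hj'
      exact sub_ne_zero.2 fun h => (Finset.ne_of_mem_erase hj') (he h).symm
    · intro j' _ hj'
      rw [eval_mul, eval_prod, Finset.prod_eq_zero (i := j), zero_mul]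
      · exact Finset.mem_erase.2 ⟨fun h => hj' h.symm, Finset.mem_univ _⟩
      · simp
    · simp

variable {A : Type*} [CommRing A] [Algebra F A]

variable (F A) in
noncomputable def iot : F →+* PowerSeries A := (PowerSeries.C).comp (algebraMap F A)

/-- the line through the base point -/
noncomputable def cline (g : Idx d → A) : Idx d → PowerSeries A :=
  fun p => iot F A (c0 e p) + PowerSeries.X * PowerSeries.C (g p)

theorem psmod {n : ℕ} (x y : PowerSeries A) :
    (PowerSeries.X ^ n ∣ x - y) ↔ Ideal.Quotient.mk (Ideal.span {(PowerSeries.X : PowerSeries A) ^ n}) x =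
      Ideal.Quotient.mk (Ideal.span {(PowerSeries.X : PowerSeries A) ^ n}) y := by
  rw [Ideal.Quotient.eq, Ideal.mem_span_singleton]

theorem map_mon {A A' : Type*} [CommRing A] [CommRing A'] (f : A →+* A') (x : Fin k → A) (m : Fin k → ℕ) :
    f (mon x m) = mon (fun j => f (x j)) m := by simp [mon]

theorem MFil.mon_mem {B : Type*} [CommRing B] (φ : MFil B) (x : Fin k → B) (hx : ∀ i, x i ∈ φ.G 0) (m : Fin k → ℕ) :
    mon x m ∈ φ.G 0 := by
  have : ∀ s : Finset (Fin k), ∏ j ∈ s, x j ^ m j ∈ φ.G 0 := by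
    intro s
    induction s using Finset.induction_on with
    | empty => simpa using φ.one
    | insert a s ha ih =>
      rw [Finset.prod_insert ha]
      exact φ.mul' (φ.pow (hx a) _) ih (by simp)
  exact this _

theorem MFil.eval₂_mem {B R : Type*} [CommRing B] [CommRing R] (φ : MFil B) (ι : R →+* B) (hι : ∀ c, ι c ∈ φ.G 0)
    (x : B) (hx : x ∈ φ.G 0) (p : R[X]) : p.eval₂ ι x ∈ φ.G 0 := by
  rw [eval₂_eq_sum_range]
  exact sum_mem fun n _ => φ.mul' (hι _) (φ.pow hx n) (by simp)

theorem newton_line (φ : MFil A) (hφ : ∀ c : F, algebraMap F A c ∈ φ.G 0) (g : Idx d → A) (hg : ∀ p, g p ∈ φ.G 1)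
    (he : ∀ i, Function.Injective (e i)) (b : Box d) :
    ∃ γ : Fin k → PowerSeries A, (∀ i, γ i ∈ (φ.ps 1).G 1) ∧
      ∀ i, sev (cline e g) i (fun j => iot F A (e j (b j)) + PowerSeries.X * γ j) = 0 := by
  set ι := iot F A with hι
  set ξ : Fin k → F := fun j => e j (b j) with hξ
  set x : (Fin k → PowerSeries A) → Fin k → PowerSeries A := fun γ j => ι (ξ j) + PowerSeries.X * γ j with hx
  set ψ : Fin k → F[X] := fun i => (taylor (ξ i) (phi e i)).divX.divX with hψ
  set cc : Fin k → F := fun i => ((derivative (phi e i)).eval (ξ i)) with hcc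
  set Ψ : (Fin k → PowerSeries A) → Fin k → PowerSeries A := fun γ i =>
    - (ι (cc i)⁻¹ * (sev (fun p => PowerSeries.C (g p)) i (x γ) +
      PowerSeries.X * γ i ^ 2 * (ψ i).eval₂ ι (PowerSeries.X * γ i))) with hΨ
  have hιm : ∀ c, ι c ∈ (φ.ps 1).G 0 := fun c => MFil.ps_C _ _ (hφ c)
  suffices H : ∃ γ, Ψ γ = γ ∧ ∀ (i : Fin k) (l : ℕ), PowerSeries.coeff l (γ i) ∈ φ.G (1 + 1 * l) by
    obtain ⟨γ, hγ, hγm⟩ := H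
    refine ⟨γ, fun i => hγm i, fun i => ?_⟩
    show sev (cline e g) i (x γ) = 0
    have h1 : sev (cline e g) i (x γ) = sev (ι ∘ c0 e) i (x γ) +
        PowerSeries.X * sev (fun p => PowerSeries.C (g p)) i (x γ) := by
      simp only [sev, cline, Finset.mul_sum, ← Finset.sum_add_distrib, Function.comp]
      exact Finset.sum_congr rfl fun m _ => by ring
    have h2 : (phi e i).eval₂ ι (x γ i) = (taylor (ξ i) (phi e i)).eval₂ ι (PowerSeries.X * γ i) := by
      rw [taylor_apply, eval₂_comp]
      simp [hx, add_comm]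
    have h3 : (taylor (ξ i) (phi e i)) = (ψ i * X + C (cc i)) * X := by
      have e1 := divX_mul_X_add (taylor (ξ i) (phi e i))
      have e2 := divX_mul_X_add (taylor (ξ i) (phi e i)).divX
      rw [taylor_coeff_zero, (phi_der e (he i) (b i)).1, C_0, add_zero] at e1
      rw [coeff_divX, zero_add, taylor_coeff_one] at e2
      rw [← e1, ← e2]
    have h4 : ι (cc i) * ι (cc i)⁻¹ = 1 := by
      rw [← map_mul, mul_inv_cancel₀ (phi_der e (he i) (b i)).2, map_one]
    have h5 := congrFun hγ i
    simp only [hΨ] at h5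
    have h6 : ι (cc i) * γ i = - (sev (fun p => PowerSeries.C (g p)) i (x γ) +
      PowerSeries.X * γ i ^ 2 * (ψ i).eval₂ ι (PowerSeries.X * γ i)) := by
      conv_lhs => rw [← h5]
      rw [mul_neg, ← mul_assoc, h4, one_mul]
    rw [h1, sev_c0, h2, h3]
    simp only [eval₂_mul, eval₂_add, eval₂_X, eval₂_C]
    linear_combination PowerSeries.X * h6
  refine fix_contract Ψ (fun _ l a => a ∈ φ.G (1 + 1 * l)) ?_ ?_ fun _ _ => zero_mem _
  · intro n y z hyz i
    have hX : ∀ j, PowerSeries.X ^ (n + 1) ∣ PowerSeries.X * y j - PowerSeries.X * z j := fun j => by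
      rw [← mul_sub, pow_succ']; exact mul_dvd_mul_left _ (hyz j)
    have hq : PowerSeries.X ^ (n + 1) ∣ PowerSeries.X * y i ^ 2 - PowerSeries.X * z i ^ 2 := by
      rw [← mul_sub, pow_succ']; exact mul_dvd_mul_left _ ((hyz i).trans (sub_dvd_pow_sub_pow _ _ _))
    simp only [psmod] at hX hq ⊢
    simp only [hΨ]
    rw [map_neg, map_neg, map_mul, map_mul, map_add, map_add, map_mul _ _ (eval₂ _ _ _), map_mul _ _ (eval₂ _ _ _),
      hq, hom_eval₂, hom_eval₂, hX i]
    congr 3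
    simp only [sev, map_sum, map_mul, map_mon, hx, map_add]
    refine Finset.sum_congr rfl fun m _ => ?_
    congr 2
    funext j
    have := hX j
    rw [map_mul, map_mul] at this
    rw [this]
  · intro y hy i
    have hy' : ∀ j, y j ∈ (φ.ps 1).G 1 := fun j => hy j
    have hXy : ∀ j, PowerSeries.X * y j ∈ (φ.ps 1).G 0 := fun j => MFil.mul' _ (MFil.ps_X _ _) (hy' j) (by simp)
    have hxm : ∀ j, x y j ∈ (φ.ps 1).G 0 := fun j => add_mem (hιm _) (hXy j)
    show Ψ y i ∈ (φ.ps 1).G 1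
    refine neg_mem (MFil.mul' _ (hιm _) (b := 1) (add_mem ?_ ?_) (by simp))
    · exact sum_mem fun m _ => MFil.mul' _ (MFil.ps_C _ _ (hg _)) (MFil.mon_mem _ _ hxm _) (by simp)
    · refine MFil.mul' _ (a := 1) (b := 0) ?_ (MFil.eval₂_mem _ _ hιm _ (hXy i) _) (by simp)
      rw [pow_two, ← mul_assoc]
      exact MFil.mul' _ (hXy i) (hy' i) (by simp)

end base

section resolv
variable {B : Type} [Fintype B] [DecidableEq B] {A : Type*} [CommRing A] {A' : Type*} [CommRing A']

/-- The resolvent elements. -/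
def uv (lam y : B → A) (τ : Equiv.Perm B) : A := ∑ b, lam b * y (τ b)

noncomputable def Rv (lam y : B → A) : A[X] := ∏ τ : Equiv.Perm B, (X - C (uv lam y τ))

noncomputable def Sv (σ : Equiv.Perm B) (lam y : B → A) : A[X] :=
  ∑ τ : Equiv.Perm B, C (uv lam y (τ * σ)) * ∏ τ' ∈ Finset.univ.erase τ, (X - C (uv lam y τ'))

theorem uv_map (f : A →+* A') (lam y : B → A) (τ : Equiv.Perm B) :
    f (uv lam y τ) = uv (f ∘ lam) (f ∘ y) τ := by
  simp [uv]

theorem Rv_map (f : A →+* A') (lam y : B → A) :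
    (Rv lam y).map f = Rv (f ∘ lam) (f ∘ y) := by
  simp only [Rv, Polynomial.map_prod, Polynomial.map_sub, Polynomial.map_X, Polynomial.map_C, ← uv_map f]

theorem Sv_map (f : A →+* A') (σ : Equiv.Perm B) (lam y : B → A) :
    (Sv σ lam y).map f = Sv σ (f ∘ lam) (f ∘ y) := by
  simp only [Sv, Polynomial.map_prod, Polynomial.map_sum, Polynomial.map_mul, Polynomial.map_sub, Polynomial.map_X, Polynomial.map_C, ← uv_map f]

theorem uv_comp (lam y : B → A) (ρ τ : Equiv.Perm B) : uv lam (y ∘ ρ) τ = uv lam y (ρ * τ) := rfl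

theorem Rv_comp (lam y : B → A) (ρ : Equiv.Perm B) : Rv lam (y ∘ ρ) = Rv lam y := by
  simp only [Rv, uv_comp]
  exact Fintype.prod_equiv (Equiv.mulLeft ρ) _ _ fun τ => rfl

theorem Sv_comp (σ : Equiv.Perm B) (lam y : B → A) (ρ : Equiv.Perm B) :
    Sv σ lam (y ∘ ρ) = Sv σ lam y := by
  simp only [Sv, uv_comp]
  refine Fintype.sum_equiv (Equiv.mulLeft ρ) _ _ fun τ => ?_
  simp only [Equiv.coe_mulLeft, mul_assoc]
  congr 1
  refine Finset.prod_bij (fun τ' _ => ρ * τ') ?_ ?_ ?_ ?_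
  · intro a ha; simpa using ha
  · intro a _ b _ h; exact mul_left_cancel h
  · intro b hb; refine ⟨ρ⁻¹ * b, ?_, by simp⟩
    simp only [Finset.mem_erase, Finset.mem_univ, and_true] at hb ⊢
    rintro rfl; simp at hb
  · intro a _; rfl

theorem Rv_monic (lam y : B → A) : (Rv lam y).Monic := monic_prod_of_monic _ _ fun _ _ => monic_X_sub_C _

theorem Rv_natDegree [Nontrivial A] (lam y : B → A) : (Rv lam y).natDegree = (Fintype.card B).factorial := by
  rw [Rv, natDegree_prod_of_monic _ _ fun j _ => monic_X_sub_C _]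
  simp [Fintype.card_perm]

theorem Sv_degree [Nontrivial A] (σ : Equiv.Perm B) (lam y : B → A) :
    (Sv σ lam y).natDegree ≤ (Fintype.card B).factorial := by
  refine natDegree_sum_le_of_forall_le _ _ fun τ _ => ?_
  refine (natDegree_C_mul_le _ _).trans ?_
  rw [natDegree_prod_of_monic _ _ fun j _ => monic_X_sub_C _]
  simp [Fintype.card_perm]

theorem Rv_der (lam y : B → A) (τ : Equiv.Perm B) :
    (derivative (Rv lam y)).eval (uv lam y τ) =
      ∏ τ' ∈ Finset.univ.erase τ, (uv lam y τ - uv lam y τ') := by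
  rw [Rv, derivative_prod_finset, eval_finsetSum, Finset.sum_eq_single τ]
  · simp [eval_prod]
  · intro b _ hb
    rw [eval_mul, eval_prod, Finset.prod_eq_zero (i := τ)]
    · simp
    · simp [hb.symm]
    · simp
  · simp

theorem Sv_eval (σ : Equiv.Perm B) (lam y : B → A) (τ : Equiv.Perm B) :
    (Sv σ lam y).eval (uv lam y τ) = uv lam y (τ * σ) * (derivative (Rv lam y)).eval (uv lam y τ) := by
  rw [Rv_der, Sv, eval_finsetSum, Finset.sum_eq_single τ]
  · simp [eval_prod]
  · intro b _ hb
    rw [eval_mul, eval_prod, Finset.prod_eq_zero (i := τ)]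
    · simp
    · simp [hb.symm]
    · simp
  · simp

abbrev LLr (B : Type) : Type := MvPolynomial B ℤ

theorem lift_sym (p : (MvPolynomial B (LLr B))[X])
    (hp : ∀ ρ : Equiv.Perm B, p.map (MvPolynomial.rename ρ : _ →ₐ[LLr B] _).toRingHom = p) :
    ∃ w : (MvPolynomial (Fin (Fintype.card B)) (LLr B))[X],
      w.map (MvPolynomial.aeval (fun i : Fin (Fintype.card B) => MvPolynomial.esymm B (LLr B) (i + 1)) :
        _ →ₐ[LLr B] _).toRingHom = p := by
  rw [← Polynomial.mem_lifts, Polynomial.lifts_iff_coeff_lifts]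
  intro n
  have hs : (p.coeff n).IsSymmetric := by
    intro ρ
    have := congrArg (fun r => r.coeff n) (hp ρ)
    simpa using this
  obtain ⟨w, hw⟩ := MvPolynomial.esymmAlgHom_surjective (σ := B) (LLr B) (n := Fintype.card B) le_rfl ⟨p.coeff n, hs⟩
  refine ⟨w, ?_⟩
  have := congrArg Subtype.val hw
  rw [MvPolynomial.esymmAlgHom_apply] at this
  exact this

theorem exists_Rw : ∃ w : (MvPolynomial (Fin (Fintype.card B)) (LLr B))[X],
      w.map (MvPolynomial.aeval (fun i : Fin (Fintype.card B) => MvPolynomial.esymm B (LLr B) (i + 1)) :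
        _ →ₐ[LLr B] _).toRingHom =
      Rv (A := MvPolynomial B (LLr B)) (fun b => MvPolynomial.C (MvPolynomial.X b)) (fun b => MvPolynomial.X b) := by
  apply lift_sym
  intro ρ
  rw [Rv_map]
  conv_rhs => rw [← Rv_comp _ _ ρ]
  congr 1 <;> (funext b; simp)

theorem exists_Sw (σ : Equiv.Perm B) : ∃ w : (MvPolynomial (Fin (Fintype.card B)) (LLr B))[X],
      w.map (MvPolynomial.aeval (fun i : Fin (Fintype.card B) => MvPolynomial.esymm B (LLr B) (i + 1)) :
        _ →ₐ[LLr B] _).toRingHom =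
      Sv σ (A := MvPolynomial B (LLr B)) (fun b => MvPolynomial.C (MvPolynomial.X b)) (fun b => MvPolynomial.X b) := by
  apply lift_sym
  intro ρ
  rw [Sv_map]
  conv_rhs => rw [← Sv_comp _ _ _ ρ]
  congr 1 <;> (funext b; simp)

variable (B) in
noncomputable def Rw : (MvPolynomial (Fin (Fintype.card B)) (LLr B))[X] := Classical.choose (exists_Rw (B := B))
noncomputable def Sw (σ : Equiv.Perm B) : (MvPolynomial (Fin (Fintype.card B)) (LLr B))[X] :=
  Classical.choose (exists_Sw σ)

noncomputable def etaH (lam : B → A) (P : A[X]) : MvPolynomial (Fin (Fintype.card B)) (LLr B) →+* A :=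
  MvPolynomial.eval₂Hom (MvPolynomial.eval₂Hom (Int.castRingHom A) lam)
    (fun j => (-1) ^ (j.1 + 1) * P.coeff (Fintype.card B - (j.1 + 1)))

theorem etaH_map (f : A →+* A') (lam : B → A) (P : A[X]) :
    f.comp (etaH lam P) = etaH (f ∘ lam) (P.map f) := by
  apply MvPolynomial.ringHom_ext'
  · apply MvPolynomial.ringHom_ext
    · intro n; simp [etaH]
    · intro b; simp [etaH]
  · intro j; simp [etaH]

theorem etaH_prod (lam y : B → A) :
    (MvPolynomial.eval₂Hom (MvPolynomial.eval₂Hom (Int.castRingHom A) lam) y).comp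
      (MvPolynomial.aeval (fun i : Fin (Fintype.card B) => MvPolynomial.esymm B (LLr B) (i + 1)) :
        _ →ₐ[LLr B] _).toRingHom = etaH lam (∏ b, (X - C (y b))) := by
  apply MvPolynomial.ringHom_ext'
  · apply MvPolynomial.ringHom_ext
    · intro n; simp [etaH]
    · intro b; simp [etaH]
  · intro j
    have h1 : (∏ b, (X - C (y b))) = ((Finset.univ.val.map y).map fun t => X - C t).prod := by
      rw [Multiset.map_map]; rfl
    have hc : Multiset.card (Finset.univ.val.map y) = Fintype.card B := by simp
    have h2 := Multiset.prod_X_sub_C_coeff (Finset.univ.val.map y) (k := Fintype.card B - (j.1 + 1))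
      (by rw [hc]; omega)
    have h3 : Fintype.card B - (Fintype.card B - (j.1 + 1)) = j.1 + 1 := by have := j.2; omega
    rw [hc, h3] at h2
    let _ : Algebra (LLr B) A := (MvPolynomial.eval₂Hom (Int.castRingHom A) lam).toAlgebra
    have h4 := MvPolynomial.aeval_esymm_eq_multiset_esymm B (LLr B) (j.1 + 1) y
    have h5 : (MvPolynomial.eval₂Hom (MvPolynomial.eval₂Hom (Int.castRingHom A) lam) y)
        (MvPolynomial.esymm B (LLr B) (j.1 + 1)) = (Finset.univ.val.map y).esymm (j.1 + 1) := h4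
    simp only [RingHom.comp_apply, etaH, MvPolynomial.eval₂Hom_X']
    rw [h1, h2, ← mul_assoc, ← pow_add, Even.neg_one_pow ⟨_, rfl⟩, one_mul, ← h5]
    simp

theorem Rw_prod (lam y : B → A) : (Rw B).map (etaH lam (∏ b, (X - C (y b)))) = Rv lam y := by
  rw [← etaH_prod, ← Polynomial.map_map, Rw, Classical.choose_spec (exists_Rw (B := B)), Rv_map]
  congr 1 <;> (funext b; simp)

theorem Sw_prod (σ : Equiv.Perm B) (lam y : B → A) :
    (Sw σ).map (etaH lam (∏ b, (X - C (y b)))) = Sv σ lam y := by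
  rw [← etaH_prod, ← Polynomial.map_map, Sw, Classical.choose_spec (exists_Sw σ), Sv_map]
  congr 1 <;> (funext b; simp)

end resolv

section resolv2
variable {B : Type} [Fintype B] [DecidableEq B] {A : Type*} [CommRing A] {A' : Type*} [CommRing A']

def Dv (lam y : B → A) : A := ∏ τ : Equiv.Perm B, ∏ τ' ∈ Finset.univ.erase τ, (uv lam y τ - uv lam y τ')

theorem Dv_map (f : A →+* A') (lam y : B → A) : f (Dv lam y) = Dv (f ∘ lam) (f ∘ y) := by
  simp only [Dv, map_prod, map_sub, uv_map f]

theorem Dv_comp (lam y : B → A) (ρ : Equiv.Perm B) : Dv lam (y ∘ ρ) = Dv lam y := by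
  have : ∀ y : B → A, Dv lam y = ∏ τ, (derivative (Rv lam y)).eval (uv lam y τ) := by
    intro y; simp only [Dv, Rv_der]
  rw [this, this, Rv_comp]
  exact Fintype.prod_equiv (Equiv.mulLeft ρ) _ _ fun τ => rfl

theorem exists_Dw : ∃ w : (MvPolynomial (Fin (Fintype.card B)) (LLr B))[X],
      w.map (MvPolynomial.aeval (fun i : Fin (Fintype.card B) => MvPolynomial.esymm B (LLr B) (i + 1)) :
        _ →ₐ[LLr B] _).toRingHom =
      C (Dv (A := MvPolynomial B (LLr B)) (fun b => MvPolynomial.C (MvPolynomial.X b)) (fun b => MvPolynomial.X b)) := by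
  apply lift_sym
  intro ρ
  rw [Polynomial.map_C, Dv_map]
  have h1 : (⇑(MvPolynomial.rename ρ : _ →ₐ[LLr B] _).toRingHom ∘ fun b : B =>
      (MvPolynomial.C (MvPolynomial.X b) : MvPolynomial B (LLr B))) = fun b => MvPolynomial.C (MvPolynomial.X b) := by
    funext b; simp
  have h2 : (⇑(MvPolynomial.rename ρ : _ →ₐ[LLr B] _).toRingHom ∘ fun b : B =>
      (MvPolynomial.X b : MvPolynomial B (LLr B))) = (fun b => MvPolynomial.X b) ∘ ρ := by
    funext b; simp
  rw [h1, h2, Dv_comp]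

variable (B) in
noncomputable def Dw : MvPolynomial (Fin (Fintype.card B)) (LLr B) :=
  (Classical.choose (exists_Dw (B := B))).coeff 0

theorem Dw_prod (lam y : B → A) : etaH lam (∏ b, (X - C (y b))) (Dw B) = Dv lam y := by
  rw [← etaH_prod, Dw, RingHom.comp_apply, ← Polynomial.coeff_map, Classical.choose_spec (exists_Dw (B := B)),
    coeff_C_zero, Dv_map]
  congr 1 <;> (funext b; simp)

theorem Dv_inj [Nontrivial A] (lam y : B → A) (h : Dv lam y ≠ 0) : Function.Injective (uv lam y) := by
  intro τ τ' e
  by_contra hne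
  apply h
  rw [Dv, Finset.prod_eq_zero (Finset.mem_univ τ)]
  exact Finset.prod_eq_zero (i := τ') (by simp [Ne.symm hne]) (by simp [e])

theorem Dv_ne [IsDomain A] (lam y : B → A) (h : Function.Injective (uv lam y)) : Dv lam y ≠ 0 := by
  refine Finset.prod_ne_zero_iff.2 fun τ _ => Finset.prod_ne_zero_iff.2 fun τ' h' => ?_
  rw [sub_ne_zero]
  intro e
  have := h e
  simp [this] at h'

theorem uv_inj_y (lam y : B → A) (h : Function.Injective (uv lam y)) : Function.Injective y := by
  intro b b' e
  by_contra hne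
  have : uv lam y (Equiv.swap b b') = uv lam y 1 := by
    refine Finset.sum_congr rfl fun c _ => ?_
    congr 1
    rcases eq_or_ne c b with rfl | h1
    · simp [e]
    rcases eq_or_ne c b' with rfl | h2
    · simp [e]
    rw [Equiv.swap_apply_of_ne_of_ne h1 h2]; rfl
  exact hne (Equiv.swap_eq_one_iff.1 (h this))

end resolv2

theorem bev_eval {F E : Type*} [CommRing F] [CommRing E] [Algebra F E] (x z : E) (p : F[X][X]) :
    bev x z p = (p.map (aeval (R := F) x : F[X] →+* E)).eval z := by
  rw [eval_map]; rfl

/-- Data at a point. -/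
theorem point_data {B : Type} [Fintype B] [DecidableEq B] {F : Type} [Field F] [Fintype F]
    {κ : Type} [Field κ] [Algebra F κ] [IsAlgClosed κ]
    (p : F[X]) (hp : p.Monic) (hd : p.natDegree = Fintype.card B) (lam : B → F)
    (hδ : etaH lam p (Dw B) ≠ 0) :
    ∃ (y : B → κ) (ρ : Equiv.Perm B), p.map (algebraMap F κ) = ∏ b, (X - C (y b)) ∧
      Function.Injective (uv (algebraMap F κ ∘ lam) y) ∧ ∀ b, y b ^ Fintype.card F = y (ρ b) := by
  obtain ⟨y, hy⟩ : ∃ y : B → κ, p.map (algebraMap F κ) = ∏ b, (X - C (y b)) := by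
    classical
    have h1 := IsAlgClosed.splits (p.map (algebraMap F κ))
    have h2 := h1.natDegree_eq_card_roots
    rw [natDegree_map, hd] at h2
    obtain ⟨e⟩ : Nonempty (B ≃ (p.map (algebraMap F κ)).roots.toEnumFinset) := by
      rw [← Fintype.card_eq]; simp [h2]
    refine ⟨fun b => (e b).1.1, ?_⟩
    have h3 := h1.eq_prod_roots_of_monic (hp.map _)
    conv_lhs => rw [h3]
    have : (∏ b, (X - C ((e b).1.1))) = ∏ z : (p.map (algebraMap F κ)).roots.toEnumFinset, (X - C z.1.1) :=
      Fintype.prod_equiv e _ _ fun _ => rfl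
    rw [this, Finset.univ_eq_attach, Finset.prod_attach (s := (p.map (algebraMap F κ)).roots.toEnumFinset) (fun z => X - C z.1)]
    rw [Finset.prod, ← Multiset.map_toEnumFinset_fst ((p.map (algebraMap F κ)).roots), Multiset.map_map,
      Multiset.map_toEnumFinset_fst]
    rfl
  have hi : Function.Injective (uv (algebraMap F κ ∘ lam) y) := by
    apply Dv_inj
    rw [← Dw_prod, ← hy, ← etaH_map]
    simpa using hδ
  have hyi := uv_inj_y _ _ hi
  have hroot : ∀ z : κ, (p.map (algebraMap F κ)).eval z = 0 ↔ ∃ b, y b = z := by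
    intro z
    rw [hy, eval_prod, Finset.prod_eq_zero_iff]
    simp [sub_eq_zero, eq_comm]
  have hfrob : ∀ b, ∃ b', y b' = y b ^ Fintype.card F := by
    intro b
    rw [← hroot]
    have h1 := (hroot (y b)).2 ⟨b, rfl⟩
    rw [eval_map_algebraMap] at h1 ⊢
    have := Polynomial.aeval_algHom_apply (FiniteField.frobeniusAlgHom F κ) (y b) p
    rw [FiniteField.coe_frobeniusAlgHom] at this
    rw [h1] at this
    rw [this]
    exact zero_pow Fintype.card_ne_zero
  choose ρ hρ using hfrob
  have hρi : Function.Injective ρ := by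
    intro b b' e
    have h1 := hρ b
    rw [e, hρ b'] at h1
    apply hyi
    exact (FiniteField.frobeniusAlgHom F κ).toRingHom.injective h1.symm
  refine ⟨y, Equiv.ofBijective ρ (Finite.injective_iff_bijective.1 hρi), hy, hi, fun b => (hρ b).symm⟩

theorem uv_frob {B : Type} [Fintype B] [DecidableEq B] {F : Type} [Field F] [Fintype F]
    {κ : Type} [Field κ] [Algebra F κ] (lam : B → F) (y : B → κ) (ρ : Equiv.Perm B)
    (h : ∀ b, y b ^ Fintype.card F = y (ρ b)) (τ : Equiv.Perm B) :
    uv (algebraMap F κ ∘ lam) y τ ^ Fintype.card F = uv (algebraMap F κ ∘ lam) y (ρ * τ) := by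
  have h1 : ∀ z : κ, z ^ Fintype.card F = (FiniteField.frobeniusAlgHom F κ).toRingHom z := fun z => rfl
  rw [h1, uv_map, ← uv_comp]
  congr 1
  · funext b; exact (FiniteField.frobeniusAlgHom F κ).commutes (lam b)
  · funext b; exact h (b)

theorem ff_fixed {F : Type} [Field F] [Fintype F] {κ : Type} [Field κ] [Algebra F κ] (z : κ)
    (h : z ^ Fintype.card F = z) : ∃ a : F, algebraMap F κ a = z := by
  have h1 : (X ^ Fintype.card F - X : F[X]) = ∏ a : F, (X - C a) := by
    have := FiniteField.roots_X_pow_card_sub_X F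
    have hm : (X ^ Fintype.card F - X : F[X]).Monic := monic_X_pow_sub (by
      rw [degree_X]; exact_mod_cast Fintype.one_lt_card)
    have h2 := prod_multiset_X_sub_C_of_monic_of_roots_card_eq hm (by
      rw [this, FiniteField.X_pow_card_sub_X_natDegree_eq F Fintype.one_lt_card]; rfl)
    rw [← h2, this]; rfl
  have h3 := congrArg (aeval z) h1
  simp only [map_sub, map_pow, aeval_X, map_prod, aeval_C, h, sub_self] at h3
  obtain ⟨a, -, ha⟩ := Finset.prod_eq_zero_iff.1 h3.symm
  exact ⟨a, (sub_eq_zero.1 ha).symm⟩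

theorem line_count (B : Type) [Fintype B] [DecidableEq B] (D : ℕ) (hD1 : 1 ≤ D) :
    ∃ C₀ q₀ : ℕ, ∀ (F : Type) [Field F] [Fintype F], q₀ ≤ Fintype.card F →
      ∀ (P : F[X][X]) (lam : B → F), P.Monic → P.natDegree = Fintype.card B →
      Irreducible ((Rw B).map (etaH (C ∘ lam) P)) →
      (∀ n, (((Rw B).map (etaH (C ∘ lam) P)).coeff n).natDegree ≤ D) →
      (∀ σ n, (((Sw σ).map (etaH (C ∘ lam) P)).coeff n).natDegree ≤ D) →
      etaH (C ∘ lam) P (Dw B) ≠ 0 → (etaH (C ∘ lam) P (Dw B)).natDegree ≤ D →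
      (∃ y : B → PowerSeries F, P.map (coeToPowerSeries.ringHom (R := F)) = ∏ b, (X - C (y b))) →
      Fintype.card F ≤ (Fintype.card B).factorial *
        Nat.card {s : F // ∃ y : B → F, Function.Injective y ∧ P.map (evalRingHom s) = ∏ b, (X - C (y b))} +
        C₀ * Nat.sqrt (Fintype.card F) := by
  obtain ⟨N, hN⟩ : ∃ N, N = (Fintype.card B).factorial := ⟨_, rfl⟩
  have hN0 : 0 < N := hN ▸ Nat.factorial_pos _
  obtain ⟨C₁, q₁, hst⟩ := stepanov N D hN0 hD1
  refine ⟨N * D + N * C₁, max q₁ 1, ?_⟩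
  intro F _ _ hq P lam hPm hPd hirr hR hS hδ0 hδ ⟨ys, hys⟩
  classical
  obtain ⟨R, hRdef⟩ : ∃ R, R = (Rw B).map (etaH (C ∘ lam) P) := ⟨_, rfl⟩
  obtain ⟨δ, hδdef⟩ : ∃ δ, δ = etaH (C ∘ lam) P (Dw B) := ⟨_, rfl⟩
  rw [← hRdef] at hirr hR
  rw [← hδdef] at hδ0 hδ
  let κ := AlgebraicClosure F
  have hspec : ∀ (s : F), (P.map (evalRingHom s)).Monic ∧ (P.map (evalRingHom s)).natDegree = Fintype.card B ∧
      δ.eval s = etaH lam (P.map (evalRingHom s)) (Dw B) := by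
    intro s
    refine ⟨hPm.map _, by rw [hPm.natDegree_map, hPd], ?_⟩
    have h1 := etaH_map (evalRingHom s) (C ∘ lam) P
    have h2 : (evalRingHom s) ∘ (C ∘ lam) = lam := by funext b; simp
    rw [h2] at h1
    rw [← h1, hδdef]; rfl
  have hpt : ∀ s : F, ∃ (y : B → κ) (ρ : Equiv.Perm B), δ.eval s ≠ 0 →
      (P.map (evalRingHom s)).map (algebraMap F κ) = ∏ b, (X - C (y b)) ∧
      Function.Injective (uv (algebraMap F κ ∘ lam) y) ∧ ∀ b, y b ^ Fintype.card F = y (ρ b) := by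
    intro s
    by_cases h : δ.eval s = 0
    · exact ⟨0, 1, fun h' => absurd h h'⟩
    · obtain ⟨y, ρ, h3⟩ := point_data (κ := κ) (P.map (evalRingHom s)) (hspec s).1 (hspec s).2.1 lam
        (by rw [← (hspec s).2.2]; exact h)
      exact ⟨y, ρ, fun _ => h3⟩
  choose y ρ hyρ using hpt
  have hcomp : ∀ s : F, (aeval (R := F) (algebraMap F κ s) : F[X] →+* κ) = (algebraMap F κ).comp (evalRingHom s) := by
    intro s
    apply Polynomial.ringHom_ext
    · intro a; simp
    · simp
  have hRs : ∀ s, δ.eval s ≠ 0 → R.map (aeval (R := F) (algebraMap F κ s) : F[X] →+* κ) =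
      Rv (algebraMap F κ ∘ lam) (y s) := by
    intro s hs
    rw [hRdef, Polynomial.map_map, etaH_map, hcomp, ← Polynomial.map_map, (hyρ s hs).1, ← Rw_prod]
    congr 2; funext b; simp
  have hSs : ∀ σ s, δ.eval s ≠ 0 → ((Sw σ).map (etaH (C ∘ lam) P)).map (aeval (R := F) (algebraMap F κ s) : F[X] →+* κ) =
      Sv σ (algebraMap F κ ∘ lam) (y s) := by
    intro σ s hs
    rw [Polynomial.map_map, etaH_map, hcomp, ← Polynomial.map_map, (hyρ s hs).1, ← Sw_prod]
    congr 2; funext b; simp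
  have hcoe : (coeToPowerSeries.ringHom (R := F)) = (aeval (R := F) (PowerSeries.X : PowerSeries F) : F[X] →+* PowerSeries F) := by
    apply RingHom.ext; intro p; simp [aeval_psX]
  have hRps : R.map (coeToPowerSeries.ringHom (R := F)) = Rv ((coeToPowerSeries.ringHom (R := F)) ∘ (C ∘ lam)) ys := by
    rw [hRdef, Polynomial.map_map, etaH_map, hys, Rw_prod]
  have hinjc : Function.Injective (coeToPowerSeries.ringHom (R := F)) := by
    intro a b h; simpa using h
  have hRm : R.Monic := by
    apply Polynomial.monic_of_injective hinjc
    rw [hRps]; exact Rv_monic _ _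
  have hRd : R.natDegree = N := by
    rw [← natDegree_map_eq_of_injective hinjc, hRps, Rv_natDegree, hN]
  have hroot : ∃ u : PowerSeries F, bev PowerSeries.X u R = 0 := by
    refine ⟨uv ((coeToPowerSeries.ringHom (R := F)) ∘ (C ∘ lam)) ys 1, ?_⟩
    rw [bev_eval, ← hcoe, hRps, Rv, eval_prod, Finset.prod_eq_zero (Finset.mem_univ 1)]
    simp
  have hSd : ∀ σ, ((Sw σ).map (etaH (C ∘ lam) P)).natDegree ≤ R.natDegree := by
    intro σ
    rw [← natDegree_map_eq_of_injective hinjc, hRd, Polynomial.map_map, etaH_map, hys, Sw_prod, hN]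
    exact Sv_degree _ _ _
  let good : Finset F := Finset.univ.filter fun s => δ.eval s ≠ 0
  let W : Equiv.Perm B → Finset (F × Equiv.Perm B) := fun σ =>
    (good ×ˢ Finset.univ).filter fun z => ρ z.1 * z.2 = z.2 * σ
  let ψ : F × Equiv.Perm B → F × κ := fun z => (z.1, uv (algebraMap F κ ∘ lam) (y z.1) z.2)
  have hWgood : ∀ σ, ∀ z ∈ W σ, δ.eval z.1 ≠ 0 ∧ ρ z.1 * z.2 = z.2 * σ := by
    intro σ z hz
    simpa [W, good] using hz
  have hZ : ∀ σ, (W σ).card ≤ Fintype.card F + C₁ * Nat.sqrt (Fintype.card F) := by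
    intro σ
    have hc : (W σ).card = ((W σ).image ψ).card := by
      rw [Finset.card_image_of_injOn]
      intro a ha b hb hab
      have h1 := congrArg Prod.fst hab
      have h2 := congrArg Prod.snd hab
      obtain ⟨a1, a2⟩ := a
      obtain ⟨b1, b2⟩ := b
      simp only [ψ] at h1 h2
      subst h1
      have := (hyρ a1 (hWgood σ _ ha).1).2.1 h2
      rw [this]
    rw [hc]
    refine hst F κ (le_trans (le_max_left _ _) hq) R hRm hirr hR hRd.symm hroot ((Sw σ).map (etaH (C ∘ lam) P)) (hSd σ) (hS σ) _ ?_
    intro z hz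
    obtain ⟨⟨s, τ⟩, hw, rfl⟩ := Finset.mem_image.1 hz
    obtain ⟨hs, hρτ⟩ := hWgood σ _ hw
    simp only at hs hρτ
    have hr : ∀ τ, bev (algebraMap F κ s) (uv (algebraMap F κ ∘ lam) (y s) τ) (derivative R) ≠ 0 := by
      intro τ
      rw [bev_eval, ← derivative_map, hRs s hs, Rv_der, Finset.prod_ne_zero_iff]
      intro τ' hτ'
      rw [sub_ne_zero]
      intro e
      have := (hyρ s hs).2.1 e
      simp [this] at hτ'
    have hz : ∀ u, bev (algebraMap F κ s) u R = 0 ↔ ∃ τ, uv (algebraMap F κ ∘ lam) (y s) τ = u := by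
      intro u
      rw [bev_eval, hRs s hs, Rv, eval_prod, Finset.prod_eq_zero_iff]
      refine exists_congr fun τ => ?_
      rw [eval_sub, eval_X, eval_C, sub_eq_zero]
      exact ⟨fun h => h.2.symm, fun h => ⟨Finset.mem_univ _, h.symm⟩⟩
    obtain ⟨e⟩ : Nonempty (Fin N ≃ Equiv.Perm B) := by
      rw [← Fintype.card_eq]; simp [hN, Fintype.card_perm]
    refine ⟨(hz _).2 ⟨τ, rfl⟩, ?_, fun i => uv (algebraMap F κ ∘ lam) (y s) (e i), ?_, ?_, fun i => hr _⟩
    · simp only [ψ]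
      rw [uv_frob lam (y s) (ρ s) (hyρ s hs).2.2, hρτ, bev_eval, bev_eval, ← derivative_map, hRs s hs, hSs σ s hs, Sv_eval]
      ring
    · exact (hyρ s hs).2.1.comp e.injective
    · intro u
      rw [hz]
      constructor
      · rintro ⟨τ, h⟩; exact ⟨e.symm τ, by simpa using h⟩
      · rintro ⟨i, h⟩; exact ⟨e i, h⟩
  have hcard : ∑ σ, (W σ).card = good.card * N := by
    have : (good ×ˢ (Finset.univ : Finset (Equiv.Perm B))).card = ∑ σ, (W σ).card := by
      rw [Finset.card_eq_sum_card_fiberwise (f := fun z : F × Equiv.Perm B => z.2⁻¹ * ρ z.1 * z.2) (t := Finset.univ)]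
      · refine Finset.sum_congr rfl fun σ _ => ?_
        congr 1
        ext z
        simp only [W, Finset.mem_filter]
        refine and_congr_right fun _ => ?_
        rw [mul_assoc, inv_mul_eq_iff_eq_mul]
      · intro z _; simp
    rw [← this, Finset.card_product, Finset.card_univ, Fintype.card_perm, hN]
  have hgood : Fintype.card F ≤ good.card + D := by
    have h1 : (Finset.univ.filter fun s : F => δ.eval s = 0) ⊆ δ.roots.toFinset := by
      intro s hs
      simp only [Finset.mem_filter, Finset.mem_univ, true_and] at hs
      simp [hδ0, hs]
    have h2 := (Finset.card_le_card h1).trans ((Multiset.toFinset_card_le _).trans ((card_roots' δ).trans hδ))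
    have h3 := Finset.card_filter_add_card_filter_not (s := (Finset.univ : Finset F)) (fun s => δ.eval s = 0)
    rw [Finset.card_univ] at h3
    change Fintype.card F ≤ (Finset.univ.filter fun s => ¬ (δ.eval s = 0)).card + D
    omega
  have hW1 : (W 1).card ≤ N * Nat.card {s : F // ∃ y : B → F, Function.Injective y ∧ P.map (evalRingHom s) = ∏ b, (X - C (y b))} := by
    have h1 : W 1 ⊆ (Finset.univ.filter fun s : F => ∃ y : B → F, Function.Injective y ∧ P.map (evalRingHom s) = ∏ b, (X - C (y b))) ×ˢ (Finset.univ : Finset (Equiv.Perm B)) := by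
      intro z hz
      obtain ⟨hs, h2⟩ := hWgood 1 z hz
      simp only [Finset.mem_product, Finset.mem_filter, Finset.mem_univ, true_and, and_true]
      have h3 : ρ z.1 = 1 := by simpa using h2
      obtain ⟨g1, g2, g3⟩ := hyρ z.1 hs
      have h4 : ∀ b, ∃ a : F, algebraMap F κ a = y z.1 b := by
        intro b
        have h5 := g3 b
        rw [h3] at h5
        exact ff_fixed _ h5
      choose a ha using h4
      refine ⟨a, ?_, ?_⟩
      · intro b b' e
        apply uv_inj_y _ _ g2
        rw [← ha, ← ha, e]
      · apply Polynomial.map_injective _ (algebraMap F κ).injective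
        rw [g1]
        simp [Polynomial.map_prod, ha]
    have h2 := Finset.card_le_card h1
    rw [Finset.card_product, Finset.card_univ, Fintype.card_perm, ← hN] at h2
    rw [Nat.card_eq_fintype_card, Fintype.card_subtype, mul_comm]
    exact h2
  have hsum : ∑ σ, (W σ).card ≤ (W 1).card + (N - 1) * (Fintype.card F + C₁ * Nat.sqrt (Fintype.card F)) := by
    rw [← Finset.add_sum_erase _ _ (Finset.mem_univ (1 : Equiv.Perm B))]
    gcongr
    refine (Finset.sum_le_card_nsmul _ _ _ fun σ _ => hZ σ).trans ?_
    rw [Finset.card_erase_of_mem (Finset.mem_univ _), Finset.card_univ, Fintype.card_perm, ← hN]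
    simp
  rw [hcard] at hsum
  rw [← hN]
  have hs1 : 1 ≤ Nat.sqrt (Fintype.card F) := Nat.le_sqrt.2 (by simpa using le_trans (le_max_right _ _) hq)
  obtain ⟨q, hqq⟩ : ∃ q, q = Fintype.card F := ⟨_, rfl⟩
  rw [← hqq] at hgood hsum hs1 ⊢
  obtain ⟨M, rfl⟩ : ∃ M, N = M + 1 := ⟨N - 1, by omega⟩
  obtain ⟨r, hr⟩ : ∃ r, r = Nat.sqrt q := ⟨_, rfl⟩
  rw [← hr] at hs1 hsum ⊢
  have e1 : (M + 1) * q ≤ (M + 1) * (good.card + D) := Nat.mul_le_mul_left _ hgood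
  have e2 : (M + 1) * D ≤ (M + 1) * D * r := Nat.le_mul_of_pos_right _ hs1
  simp only [Nat.add_sub_cancel] at hsum
  nlinarith [hW1, e1, e2, hsum, Nat.zero_le (C₁ * r)]

section bertini

theorem swap_coeff {F : Type*} [CommRing F] (p : F[X][X]) (m n : ℕ) :
    ((Polynomial.Bivariate.swap p).coeff m).coeff n = (p.coeff n).coeff m := by
  induction p using Polynomial.induction_on' with
  | add p q hp hq => simp only [map_add, coeff_add, hp, hq]
  | monomial i a =>
    induction a using Polynomial.induction_on' with
    | add p q hp hq => simp only [map_add, coeff_add, hp, hq]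
    | monomial j r =>
      rw [Polynomial.Bivariate.swap_monomial_monomial]
      simp only [coeff_monomial]
      by_cases h1 : j = m <;> by_cases h2 : i = n <;> simp [h1, h2, coeff_monomial]

theorem sdeg_iff {F : Type*} [CommRing F] (p : F[X][X]) (D : ℕ) :
    (Polynomial.Bivariate.swap p).natDegree ≤ D ↔ ∀ n, (p.coeff n).natDegree ≤ D := by
  simp only [natDegree_le_iff_coeff_eq_zero]
  constructor
  · intro h n m hm
    rw [← swap_coeff, h m hm, coeff_zero]
  · intro h m hm
    ext n
    rw [swap_coeff, h n m hm, coeff_zero]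

theorem sdeg_factor {F : Type*} [CommRing F] [IsDomain F] (f g : F[X][X]) (D : ℕ) (hf : f ≠ 0) (hg : g ≠ 0)
    (h : ∀ n, ((f * g).coeff n).natDegree ≤ D) :
    (∀ n, (f.coeff n).natDegree ≤ D) ∧ ∀ n, (g.coeff n).natDegree ≤ D := by
  rw [← sdeg_iff, ← sdeg_iff]
  rw [← sdeg_iff, map_mul, natDegree_mul] at h
  · constructor <;> omega
  · simpa using hf
  · simpa using hg

variable {I : Type*} [Fintype I] [DecidableEq I]

noncomputable def QS {A : Type*} [CommRing A] (u : I → A) (s : Finset I) : A[X] := ∏ τ ∈ s, (X - C (u τ))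

theorem QS_monic {A : Type*} [CommRing A] (u : I → A) (s : Finset I) : (QS u s).Monic :=
  monic_prod_of_monic _ _ fun _ _ => monic_X_sub_C _

theorem QS_natDegree {A : Type*} [CommRing A] [Nontrivial A] (u : I → A) (s : Finset I) : (QS u s).natDegree = s.card := by
  rw [QS, natDegree_prod_of_monic _ _ fun j _ => monic_X_sub_C _]
  simp

theorem QS_map {A A' : Type*} [CommRing A] [CommRing A'] (f : A →+* A') (u : I → A) (s : Finset I) :
    (QS u s).map f = QS (f ∘ u) s := by
  simp [QS, Polynomial.map_prod]

def QGood {A : Type*} [CommRing A] (D : ℕ) (u : I → PowerSeries A) (s : Finset I) : Prop :=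
  ∃ n m, D < m ∧ m ≤ 2 * D ∧ PowerSeries.coeff m ((QS u s).coeff n) ≠ 0

abbrev cps (A : Type*) [CommRing A] : A[X] →+* PowerSeries A := coeToPowerSeries.ringHom (R := A)

theorem cps_inj (A : Type*) [CommRing A] : Function.Injective (cps A) := by
  intro a b h; simpa using h

/-- truncation -/
theorem exists_trunc {A : Type*} [CommRing A] [IsDomain A] (D : ℕ) (u : I → PowerSeries A) (s : Finset I)
    (h : ¬ QGood D u s) : ∃ T : A[X][X], T.Monic ∧ T.natDegree = s.card ∧ (∀ n, (T.coeff n).natDegree ≤ D) ∧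
      C (PowerSeries.X ^ (2 * D + 1)) ∣ T.map (cps A) - QS u s := by
  have hh : ∀ n m, D < m → m ≤ 2 * D → PowerSeries.coeff m ((QS u s).coeff n) = 0 := by
    intro n m h1 h2
    by_contra h3
    exact h ⟨n, m, h1, h2, h3⟩
  let T : A[X][X] := ∑ n ∈ Finset.range (s.card + 1), monomial n (PowerSeries.trunc (D + 1) ((QS u s).coeff n))
  have hT : ∀ n, T.coeff n = PowerSeries.trunc (D + 1) ((QS u s).coeff n) := by
    intro n
    simp only [T, finsetSum_coeff, coeff_monomial]
    rw [Finset.sum_ite_eq']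
    split_ifs with h1
    · rfl
    · rw [coeff_eq_zero_of_natDegree_lt]
      · simp
      · rw [QS_natDegree]; simpa using h1
  have hd : T.natDegree ≤ s.card := by
    rw [natDegree_le_iff_coeff_eq_zero]
    intro n hn
    rw [hT, coeff_eq_zero_of_natDegree_lt]
    · simp
    · rw [QS_natDegree]; exact hn
  have hc : T.coeff s.card = 1 := by
    have := (QS_monic u s).coeff_natDegree
    rw [QS_natDegree] at this
    rw [hT, this, PowerSeries.trunc_one]
  have hm : T.Monic := monic_of_natDegree_le_of_coeff_eq_one _ hd hc
  refine ⟨T, hm, ?_, ?_, ?_⟩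
  · refine le_antisymm hd (le_natDegree_of_ne_zero ?_)
    rw [hc]; exact one_ne_zero
  · intro n
    rw [hT]
    exact Nat.lt_succ_iff.1 (PowerSeries.natDegree_trunc_lt _ _)
  · rw [C_dvd_iff_dvd_coeff]
    intro n
    rw [PowerSeries.X_pow_dvd_iff]
    intro m hm
    rw [coeff_sub, coeff_map, hT, map_sub]
    simp only [coeToPowerSeries.ringHom_apply, coeff_coe, PowerSeries.coeff_trunc]
    split_ifs with h1
    · simp
    · rw [hh n m (by omega) (by omega)]; simp

theorem QGood_of_irred {A : Type*} [CommRing A] [IsDomain A] (D : ℕ) (u : I → PowerSeries A) (R : A[X][X])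
    (hR : Irreducible R) (hRm : R.Monic) (hD : ∀ n, (R.coeff n).natDegree ≤ D)
    (hRu : R.map (cps A) = QS u Finset.univ) (s : Finset I) (h1 : s.Nonempty) (h2 : sᶜ.Nonempty) :
    QGood D u s ∨ QGood D u sᶜ := by
  by_contra hcon
  push Not at hcon
  obtain ⟨T₁, m1, d1, c1, e1⟩ := exists_trunc D u s hcon.1
  obtain ⟨T₂, m2, d2, c2, e2⟩ := exists_trunc D u sᶜ hcon.2
  have hQ : QS u s * QS u sᶜ = QS u Finset.univ := by
    simp only [QS]; exact Finset.prod_mul_prod_compl _ _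
  have hdvd : C (PowerSeries.X ^ (2 * D + 1)) ∣ (T₁ * T₂ - R).map (cps A) := by
    have : (T₁ * T₂ - R).map (cps A) = (T₁.map (cps A) - QS u s) * T₂.map (cps A) +
        QS u s * (T₂.map (cps A) - QS u sᶜ) := by
      rw [Polynomial.map_sub, Polynomial.map_mul, hRu, ← hQ]; ring
    rw [this]
    exact dvd_add (Dvd.dvd.mul_right e1 _) (Dvd.dvd.mul_left e2 _)
  have hz : T₁ * T₂ - R = 0 := by
    ext n m
    have hdeg : ((T₁ * T₂ - R).coeff n).natDegree ≤ 2 * D := by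
      rw [coeff_sub]
      refine (natDegree_sub_le _ _).trans (max_le ?_ ((hD n).trans (by omega)))
      rw [coeff_mul]
      refine natDegree_sum_le_of_forall_le _ _ fun z _ => natDegree_mul_le.trans ?_
      have := c1 z.1
      have := c2 z.2
      omega
    rw [coeff_zero, coeff_zero]
    by_cases hm : 2 * D < m
    · exact coeff_eq_zero_of_natDegree_lt (by omega)
    · rw [C_dvd_iff_dvd_coeff] at hdvd
      have := PowerSeries.X_pow_dvd_iff.1 (hdvd n) m (by omega)
      rw [coeff_map] at this
      simpa only [coeToPowerSeries.ringHom_apply, coeff_coe] using this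
  rw [sub_eq_zero] at hz
  rw [hRm.irreducible_iff_natDegree] at hR
  have := hR.2 T₁ T₂ m1 m2 hz
  rw [d1, d2, Finset.card_eq_zero, Finset.card_eq_zero] at this
  rcases this with h | h
  · simp [h] at h1
  · simp [h] at h2

theorem irred_of_QGood {F : Type*} [Field F] (D : ℕ) (u : I → PowerSeries F) (R : F[X][X])
    (hRm : R.Monic) (hR1 : R ≠ 1) (hD : ∀ n, (R.coeff n).natDegree ≤ D)
    (hRu : R.map (cps F) = QS u Finset.univ)
    (hg : ∀ s : Finset I, s.Nonempty → sᶜ.Nonempty → QGood D u s ∨ QGood D u sᶜ) : Irreducible R := by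
  rw [hRm.irreducible_iff_natDegree]
  refine ⟨hR1, fun f g hf hg' hfg => ?_⟩
  by_contra hcon
  push Not at hcon
  have hfm := hf.map (cps F)
  have hgm := hg'.map (cps F)
  have hprod : f.map (cps F) * g.map (cps F) = 1 * ∏ τ, (X - C (u τ)) := by
    rw [one_mul, ← Polynomial.map_mul, hfg, hRu]; rfl
  obtain ⟨s, s', b, c, hss, hdis, hbc, hfs, hgs⟩ := mul_eq_mul_prime_prod (fun i _ => prime_X_sub_C (u i)) hprod
  have hs' : s' = sᶜ := by
    ext i
    have h1 := Finset.ext_iff.1 hss i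
    have h2 := fun h : i ∈ s => Finset.disjoint_left.1 hdis h
    simp at h1 ⊢
    tauto
  subst hs'
  change _ = b * QS u s at hfs
  change _ = c * QS u sᶜ at hgs
  have hb : b = 1 := by
    have h1 : b.Monic := (QS_monic u s).of_mul_monic_right (hfs ▸ hfm)
    exact h1.eq_one_of_isUnit (IsUnit.of_mul_eq_one _ hbc.symm)
  rw [hb, one_mul] at hbc
  rw [← hbc, one_mul] at hgs
  rw [hb, one_mul] at hfs
  obtain ⟨df, dg⟩ := sdeg_factor f g D hf.ne_zero hg'.ne_zero (by rw [hfg]; exact hD)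
  have key : ∀ (f : F[X][X]) (s : Finset I), f.map (cps F) = QS u s → (∀ n, (f.coeff n).natDegree ≤ D) → ¬ QGood D u s := by
    rintro f s h1 h2 ⟨n, m, h3, h4, h5⟩
    apply h5
    rw [← h1, coeff_map]
    simp only [coeToPowerSeries.ringHom_apply, coeff_coe]
    exact coeff_eq_zero_of_natDegree_lt (lt_of_le_of_lt (h2 n) h3)
  have keyd : ∀ (f : F[X][X]) (s : Finset I), f.Monic → f.map (cps F) = QS u s → f.natDegree ≠ 0 → s.Nonempty := by
    intro f s hm h1 h2
    rw [← Finset.card_pos, ← QS_natDegree u s, ← h1, hm.natDegree_map]; omega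
  rcases hg s (keyd f s hf hfs hcon.1) (keyd g _ hg' hgs hcon.2) with h | h
  · exact key f s hfs df h
  · exact key g _ hgs dg h

/-- Bertini--Noether. -/
theorem bertini {A : Type*} [CommRing A] [IsDomain A] (D : ℕ) (u : I → PowerSeries A) (R : A[X][X])
    (hR : Irreducible R) (hRm : R.Monic) (hD : ∀ n, (R.coeff n).natDegree ≤ D)
    (hRu : R.map (cps A) = QS u Finset.univ) :
    ∃ Φ : Finset I → A, (∀ s, Φ s ≠ 0) ∧
      (∀ s, Φ s = 1 ∨ ∃ s' n m, m ≤ 2 * D ∧ Φ s = PowerSeries.coeff m ((QS u s').coeff n)) ∧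
      ∀ (F : Type) [Field F] (ev : A →+* F), (∀ s, ev (Φ s) ≠ 0) → Irreducible (R.map (mapRingHom ev)) := by
  have h : ∀ s : Finset I, ∃ Φ : A, Φ ≠ 0 ∧ (Φ = 1 ∨ ∃ s' n m, m ≤ 2 * D ∧ Φ = PowerSeries.coeff m ((QS u s').coeff n)) ∧
      (s.Nonempty → sᶜ.Nonempty → ∃ n m, D < m ∧ m ≤ 2 * D ∧ (Φ = PowerSeries.coeff m ((QS u s).coeff n) ∨
        Φ = PowerSeries.coeff m ((QS u sᶜ).coeff n))) := by
    intro s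
    by_cases h1 : s.Nonempty
    · by_cases h2 : sᶜ.Nonempty
      · rcases QGood_of_irred D u R hR hRm hD hRu s h1 h2 with ⟨n, m, h3, h4, h5⟩ | ⟨n, m, h3, h4, h5⟩
        · exact ⟨_, h5, Or.inr ⟨s, n, m, h4, rfl⟩, fun _ _ => ⟨n, m, h3, h4, Or.inl rfl⟩⟩
        · exact ⟨_, h5, Or.inr ⟨sᶜ, n, m, h4, rfl⟩, fun _ _ => ⟨n, m, h3, h4, Or.inr rfl⟩⟩
      · exact ⟨1, one_ne_zero, Or.inl rfl, fun _ h => absurd h h2⟩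
    · exact ⟨1, one_ne_zero, Or.inl rfl, fun h => absurd h h1⟩
  choose Φ p1 p2 p3 using h
  refine ⟨Φ, p1, p2, fun F _ ev hev => ?_⟩
  have hco : ∀ s n m, PowerSeries.coeff m ((QS (PowerSeries.map ev ∘ u) s).coeff n) =
      ev (PowerSeries.coeff m ((QS u s).coeff n)) := by
    intro s n m
    rw [← QS_map, coeff_map, PowerSeries.coeff_map]
  refine irred_of_QGood D (PowerSeries.map ev ∘ u) _ (hRm.map _) ?_ ?_ ?_ ?_
  · intro h1
    have h2 := congrArg natDegree h1
    rw [hRm.natDegree_map, natDegree_one] at h2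
    have := (hRm.natDegree_eq_zero).1 h2
    rw [this] at hR
    exact not_irreducible_one hR
  · intro n
    rw [coeff_map]
    exact natDegree_map_le.trans (hD n)
  · have hc : (cps F).comp (mapRingHom ev) = (PowerSeries.map ev).comp (cps A) := by
      apply RingHom.ext; intro p
      ext n; simp
    rw [Polynomial.map_map, hc, ← Polynomial.map_map, hRu, QS_map]
  · intro s h1 h2
    obtain ⟨n, m, h3, h4, h5 | h5⟩ := p3 s h1 h2
    · left; refine ⟨n, m, h3, h4, ?_⟩
      rw [hco, ← h5]; exact hev s
    · right; refine ⟨n, m, h3, h4, ?_⟩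
      rw [hco, ← h5]; exact hev s

end bertini

section monod
variable {B : Type} [Fintype B] [DecidableEq B]

theorem perm_top (H : Subgroup (Equiv.Perm B))
    (h2 : ∀ b c b' c' : B, b ≠ c → b' ≠ c' → ∃ h ∈ H, h b = b' ∧ h c = c')
    (x y : B) (hxy : x ≠ y) (hs : Equiv.swap x y ∈ H) : H = ⊤ := by
  rw [eq_top_iff, ← Equiv.Perm.closure_isSwap, Subgroup.closure_le]
  rintro σ ⟨u, v, huv, rfl⟩
  obtain ⟨h, hh, hu, hv⟩ := h2 x y u v hxy huv
  rw [← hu, ← hv, Equiv.swap_apply_apply]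
  exact H.mul_mem (H.mul_mem hh hs) (H.inv_mem hh)

theorem resolvent_irred {ι K L I : Type*} [Field K] [Field L] [Algebra K L] [Fintype I] [Nonempty I]
    (R : (MvPolynomial ι K)[X]) (hR : R.Monic) (u : I → MvPolynomial ι L) (hu : Function.Injective u)
    (hRu : R.map (MvPolynomial.map (algebraMap K L)) = ∏ τ, (X - C (u τ)))
    (hσ : ∀ τ ρ : I, ∃ σ : L ≃ₐ[K] L, MvPolynomial.map (σ : L →+* L) (u τ) = u ρ) : Irreducible R := by
  classical
  have hN : R.natDegree = Fintype.card I := by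
    rw [← hR.natDegree_map (MvPolynomial.map (algebraMap K L)), hRu,
      natDegree_prod_of_monic _ _ fun j _ => monic_X_sub_C _]
    simp
  have key : ∀ (f : (MvPolynomial ι K)[X]), f.Monic → ∀ τ, (f.map (MvPolynomial.map (algebraMap K L))).eval (u τ) = 0 →
      Fintype.card I ≤ f.natDegree := by
    intro f hf τ h0
    have hall : ∀ ρ, (f.map (MvPolynomial.map (algebraMap K L))).eval (u ρ) = 0 := by
      intro ρ
      obtain ⟨σ, h⟩ := hσ τ ρ
      have h1 := congrArg (MvPolynomial.map (σ : L →+* L)) h0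
      rw [map_zero, ← Polynomial.eval_map_apply, Polynomial.map_map, h] at h1
      have h2 : (MvPolynomial.map (σ : L →+* L)).comp (MvPolynomial.map (algebraMap K L)) =
          (MvPolynomial.map (algebraMap K L) : MvPolynomial ι K →+* _) := by
        refine MvPolynomial.ringHom_ext ?_ ?_ <;> intro x <;> simp
      rwa [h2] at h1
    have hm := hf.map (MvPolynomial.map (algebraMap K L) : MvPolynomial ι K →+* _)
    rw [← hf.natDegree_map (MvPolynomial.map (algebraMap K L) : MvPolynomial ι K →+* _)]
    have : (Finset.univ.image u).card ≤ _ := Polynomial.card_le_degree_of_subset_roots (p := f.map (MvPolynomial.map (algebraMap K L))) (Z := Finset.univ.image u) ?_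
    · rwa [Finset.card_image_of_injective _ hu, Finset.card_univ] at this
    · intro z hz
      simp only [Finset.image_val, Multiset.mem_dedup, Multiset.mem_map] at hz
      obtain ⟨ρ, _, rfl⟩ := hz
      rw [mem_roots hm.ne_zero]
      exact hall ρ
  have hne : R ≠ 1 := by
    rintro rfl
    simp [Fintype.card_eq_zero_iff] at hN
    exact (Fintype.card_pos (α := I)).ne hN
  rw [hR.irreducible_iff_natDegree]
  refine ⟨hne, fun f g hf hg hfg => ?_⟩
  obtain ⟨τ⟩ := ‹Nonempty I›
  have h0 : (R.map (MvPolynomial.map (algebraMap K L))).eval (u τ) = 0 := by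
    rw [hRu, eval_prod, Finset.prod_eq_zero (Finset.mem_univ τ)]; simp
  rw [← hfg, Polynomial.map_mul, eval_mul, mul_eq_zero] at h0
  have hd := hf.natDegree_mul hg
  rw [hfg, hN] at hd
  rcases h0 with h0 | h0
  · right
    have := key f hf τ h0
    omega
  · left
    have := key g hg τ h0
    omega

end monod

section gal
variable (F : Type) [Field F]

abbrev KK := FractionRing F[X][X]
abbrev OO := AlgebraicClosure (KK F)

noncomputable def oa : OO F := algebraMap F[X][X] (OO F) (C X)
noncomputable def ox : OO F := algebraMap F[X][X] (OO F) X

instance : IsScalarTower F F[X][X] (OO F) := inferInstance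
instance OO_alg : Algebra.IsAlgebraic F[X][X] (OO F) := by
  have : Algebra.IsAlgebraic F[X][X] (KK F) := IsLocalization.isAlgebraic _ (nonZeroDivisors F[X][X])
  exact Algebra.IsAlgebraic.trans F[X][X] (KK F) (OO F)

theorem OO_inj : Function.Injective (algebraMap F[X][X] (OO F)) :=
  by
  rw [IsScalarTower.algebraMap_eq F[X][X] (KK F) (OO F)]
  exact (algebraMap (KK F) (OO F)).injective.comp (IsFractionRing.injective F[X][X] (KK F))

instance OO_faith : FaithfulSMul F[X][X] (OO F) := (faithfulSMul_iff_algebraMap_injective _ _).2 (OO_inj F)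

theorem OO_trdeg : Algebra.trdeg F (OO F) = 2 := by
  have h1 := trdeg_add_eq F F[X] (A := F[X][X])
  have h2 := trdeg_add_eq F F[X][X] (A := OO F)
  rw [Polynomial.trdeg_of_isDomain, Polynomial.trdeg_of_isDomain] at h1
  rw [← h1, trdeg_eq_zero (R := F[X][X]) (A := OO F), add_zero] at h2
  rw [← h2]; norm_num

theorem OO_ext {A : Type*} [CommRing A] (φ ψ : OO F →+* A) (h : ∀ c : F, φ (algebraMap F (OO F) c) = ψ (algebraMap F (OO F) c))
    (ha : φ (oa F) = ψ (oa F)) (hx : φ (ox F) = ψ (ox F)) (z : KK F) :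
    φ (algebraMap (KK F) (OO F) z) = ψ (algebraMap (KK F) (OO F) z) := by
  have h1 : φ.comp (algebraMap F[X][X] (OO F)) = ψ.comp (algebraMap F[X][X] (OO F)) := by
    refine Polynomial.ringHom_ext' (Polynomial.ringHom_ext' ?_ ?_) ?_
    · ext c
      simpa [IsScalarTower.algebraMap_apply F F[X][X] (OO F)] using h c
    · exact ha
    · exact hx
  have h2 : φ.comp (algebraMap (KK F) (OO F)) = ψ.comp (algebraMap (KK F) (OO F)) := by
    refine IsLocalization.ringHom_ext (nonZeroDivisors F[X][X]) ?_
    rw [RingHom.comp_assoc, RingHom.comp_assoc, ← IsScalarTower.algebraMap_eq]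
    exact h1
  exact RingHom.congr_fun h2 z

theorem tb (y z : OO F) (ha : IsAlgebraic (Algebra.adjoin F (Set.range ![y,z])) (oa F))
    (hx : IsAlgebraic (Algebra.adjoin F (Set.range ![y,z])) (ox F)) :
    IsTranscendenceBasis F ![y, z] := by
  set R0 := Algebra.adjoin F (Set.range ![y,z])
  let S := Subalgebra.algebraicClosure R0 (OO F)
  have hmem : ∀ p : F[X][X], algebraMap F[X][X] (OO F) p ∈ S := by
    intro p
    induction p using Polynomial.induction_on' with
    | add p q hp hq => rw [map_add]; exact S.add_mem hp hq
    | monomial n p =>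
      rw [← C_mul_X_pow_eq_monomial, map_mul, map_pow]
      refine S.mul_mem ?_ (S.pow_mem hx n)
      induction p using Polynomial.induction_on' with
      | add p q hp hq => rw [C_add, map_add]; exact S.add_mem hp hq
      | monomial n c =>
        rw [← C_mul_X_pow_eq_monomial, C_mul, C_pow, map_mul, map_pow]
        refine S.mul_mem ?_ (S.pow_mem ha n)
        have : algebraMap F[X][X] (OO F) (C (C c)) = algebraMap R0 (OO F) (algebraMap F R0 c) := by
          rw [← IsScalarTower.algebraMap_apply, IsScalarTower.algebraMap_apply F F[X][X] (OO F)]; rfl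
        rw [this]
        exact S.algebraMap_mem _
  let f : F[X][X] →+* S := (algebraMap F[X][X] (OO F)).codRestrict S hmem
  have hS : Algebra.IsAlgebraic S (OO F) := by
    constructor
    intro w
    obtain ⟨p, hp, hw⟩ := Algebra.IsAlgebraic.isAlgebraic (R := F[X][X]) w
    refine ⟨p.map f, ?_, ?_⟩
    · rw [Polynomial.map_ne_zero_iff]
      · exact hp
      · intro a b hab
        exact OO_inj F (congrArg Subtype.val hab)
    · rw [aeval_def, eval₂_map]
      exact hw
  have : Algebra.IsAlgebraic R0 S := by
    constructor
    intro w
    obtain ⟨p, hp, h⟩ := w.2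
    refine ⟨p, hp, Subtype.ext ?_⟩
    have := Polynomial.aeval_algHom_apply S.val w p
    exact this.symm.trans h
  have : Algebra.IsAlgebraic R0 (OO F) := Algebra.IsAlgebraic.trans R0 S (OO F)
  refine Algebra.IsAlgebraic.isTranscendenceBasis_of_le_trdeg_of_finite F _ ?_
  rw [OO_trdeg]; simp

theorem tb_equiv (v w : Fin 2 → OO F) (hv : IsTranscendenceBasis F v) (hw : IsTranscendenceBasis F w) :
    ∃ σ : OO F ≃+* OO F, (∀ c : F, σ (algebraMap F (OO F) c) = algebraMap F (OO F) c) ∧ ∀ i, σ (v i) = w i := by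
  let _ := IsAlgClosed.isAlgClosure_of_transcendence_basis v hv
  let _ := IsAlgClosed.isAlgClosure_of_transcendence_basis w hw
  let e : Algebra.adjoin F (Set.range v) ≃ₐ[F] Algebra.adjoin F (Set.range w) :=
    hv.1.aevalEquiv.symm.trans hw.1.aevalEquiv
  refine ⟨IsAlgClosure.equivOfEquiv (OO F) (OO F) e.toRingEquiv, fun c => ?_, fun i => ?_⟩
  · have := IsAlgClosure.equivOfEquiv_algebraMap (OO F) (OO F) e.toRingEquiv (algebraMap F _ c)
    rw [← IsScalarTower.algebraMap_apply] at this
    rw [this]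
    have h : e.toRingEquiv (algebraMap F _ c) = algebraMap F _ c := e.commutes c
    rw [h]; rfl
  · have := IsAlgClosure.equivOfEquiv_algebraMap (OO F) (OO F) e.toRingEquiv ⟨v i, Algebra.subset_adjoin ⟨i, rfl⟩⟩
    have h : e.toRingEquiv ⟨v i, Algebra.subset_adjoin ⟨i, rfl⟩⟩ = ⟨w i, Algebra.subset_adjoin ⟨i, rfl⟩⟩ := by
      have h1 : hv.1.aevalEquiv (MvPolynomial.X i) = ⟨v i, Algebra.subset_adjoin ⟨i, rfl⟩⟩ := by
        apply Subtype.ext; simp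
      change hw.1.aevalEquiv (hv.1.aevalEquiv.symm _) = _
      rw [← h1, AlgEquiv.symm_apply_apply]
      apply Subtype.ext; simp
    rw [h] at this
    exact this

theorem tb_aut (v w : Fin 2 → OO F) (hv : IsTranscendenceBasis F v) (hw : IsTranscendenceBasis F w)
    (H : ∀ σ : OO F ≃+* OO F, (∀ c : F, σ (algebraMap F (OO F) c) = algebraMap F (OO F) c) → (∀ i, σ (v i) = w i) →
      σ (oa F) = oa F ∧ σ (ox F) = ox F) :
    ∃ σ : OO F ≃ₐ[KK F] OO F, ∀ i, σ (v i) = w i := by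
  obtain ⟨σ, h1, h2⟩ := tb_equiv F v w hv hw
  obtain ⟨h3, h4⟩ := H σ h1 h2
  exact ⟨AlgEquiv.ofRingEquiv (f := σ) fun z => OO_ext F (σ : OO F →+* OO F) (RingHom.id _) h1 h3 h4 z, h2⟩

end gal

section gal2

def ep (t : ℕ) : ℕ := if t ≤ 3 then 0 else 1
def ee (t : ℕ) : ℕ := if t = 2 then 1 else 2

noncomputable def pT {A : Type*} [CommRing A] (t : ℕ) (a x : A) : A[X] :=
  X ^ t + (C (ep t : A) * X ^ 3 + C a * X ^ ee t + C x)

theorem pT_map {A A' : Type*} [CommRing A] [CommRing A'] (f : A →+* A') (t : ℕ) (a x : A) :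
    (pT t a x).map f = pT t (f a) (f x) := by simp [pT]

theorem pT_low {A : Type*} [CommRing A] (t : ℕ) (ht : 2 ≤ t) (a x : A) :
    (C (ep t : A) * X ^ 3 + C a * X ^ ee t + C x).degree < (t : WithBot ℕ) := by
  have h1 : (C (ep t : A) * X ^ 3).degree < (t : WithBot ℕ) := by
    by_cases h : t ≤ 3
    · simp [ep, h]
    · refine lt_of_le_of_lt (degree_C_mul_X_pow_le _ _) ?_
      exact_mod_cast (by omega : 3 < t)
  have h2 : (C a * X ^ ee t).degree < (t : WithBot ℕ) := by
    refine lt_of_le_of_lt (degree_C_mul_X_pow_le _ _) ?_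
    have : ee t < t := by unfold ee; split_ifs <;> omega
    exact_mod_cast this
  have h3 : (C x).degree < (t : WithBot ℕ) := by
    refine lt_of_le_of_lt degree_C_le ?_
    exact_mod_cast (by omega : 0 < t)
  exact lt_of_le_of_lt (degree_add_le _ _) (max_lt (lt_of_le_of_lt (degree_add_le _ _) (max_lt h1 h2)) h3)

theorem pT_monic {A : Type*} [CommRing A] (t : ℕ) (ht : 2 ≤ t) (a x : A) : (pT t a x).Monic := by
  exact monic_X_pow_add (pT_low t ht a x)

theorem pT_natDegree {A : Type*} [CommRing A] [Nontrivial A] (t : ℕ) (ht : 2 ≤ t) (a x : A) : (pT t a x).natDegree = t := by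
  have : (pT t a x).degree = t := by
    rw [pT, degree_add_eq_left_of_degree_lt]
    · exact degree_X_pow t
    · rw [degree_X_pow]; exact pT_low t ht a x
  exact natDegree_eq_of_degree_eq_some this

theorem pT_eval {A : Type*} [CommRing A] (t : ℕ) (a x z : A) :
    (pT t a x).eval z = z ^ t + (ep t * z ^ 3 + a * z ^ ee t + x) := by simp [pT]

variable (F : Type) [Field F] (t : ℕ) (ht : 2 ≤ t)

theorem tb_root (γ : OO F) (hγ : (pT t (oa F) (ox F)).eval γ = 0) : IsTranscendenceBasis F ![γ, oa F] := by
  have hg : γ ∈ Algebra.adjoin F (Set.range ![γ, oa F]) := Algebra.subset_adjoin ⟨0, rfl⟩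
  have ha : oa F ∈ Algebra.adjoin F (Set.range ![γ, oa F]) := Algebra.subset_adjoin ⟨1, rfl⟩
  refine tb F _ _ (isAlgebraic_algebraMap (⟨_, ha⟩ : Algebra.adjoin F (Set.range ![γ, oa F]))) ?_
  have hx : ox F = - (γ ^ t + (ep t * γ ^ 3 + oa F * γ ^ ee t)) := by
    rw [pT_eval] at hγ; linear_combination hγ
  have hx' : ox F ∈ Algebra.adjoin F (Set.range ![γ, oa F]) := by
    rw [hx]
    refine neg_mem (add_mem (pow_mem hg _) (add_mem (mul_mem (natCast_mem _ _) (pow_mem hg _)) (mul_mem ha (pow_mem hg _))))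
  exact isAlgebraic_algebraMap (⟨_, hx'⟩ : Algebra.adjoin F (Set.range ![γ, oa F]))

include ht

theorem root_sep (γ : OO F) (hγ : (pT t (oa F) (ox F)).eval γ = 0) :
    (derivative (pT t (oa F) (ox F))).eval γ ≠ 0 := by
  intro h
  have hv := (tb_root F t γ hγ).1
  have hd : t * γ ^ (t - 1) + (ep t * (3 * γ ^ 2) + oa F * (ee t * γ ^ (ee t - 1))) = 0 := by
    simp only [pT, derivative_add, derivative_mul, derivative_C, derivative_X_pow, eval_add, eval_mul, eval_C, eval_pow, eval_X, eval_zero, Nat.cast_ofNat, C_ofNat, eval_ofNat] at h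
    simp only [eval_natCast, map_natCast, show 3 - 1 = 2 from rfl] at h
    linear_combination h
  let G : MvPolynomial (Fin 2) F := (t : MvPolynomial (Fin 2) F) * MvPolynomial.X 0 ^ (t-1) +
    ((ep t : MvPolynomial (Fin 2) F) * (3 * MvPolynomial.X 0 ^ 2) + MvPolynomial.X 1 * ((ee t : MvPolynomial (Fin 2) F) * MvPolynomial.X 0 ^ (ee t - 1)))
  have hG : MvPolynomial.aeval ![γ, oa F] G = 0 := by
    simp [G, ← hd]
  have hG0 : G = 0 := hv.eq_zero_of_aeval_eq_zero _ hG
  by_cases he : ((ee t : ℕ) : F) = 0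
  · have he2 : ee t = 2 ∧ t ≠ 2 := by
      unfold ee at he ⊢
      split_ifs at he ⊢ with h2
      · simp at he
      · exact ⟨rfl, h2⟩
    have h2 : (2 : F) = 0 := by rw [he2.1] at he; exact_mod_cast he
    have h1 := congrArg (fun G => (MvPolynomial.aeval (![X, 0] : Fin 2 → F[X]) G).coeff 2) hG0
    simp only [G, map_add, map_mul, map_natCast, map_pow, MvPolynomial.aeval_X, map_ofNat, map_zero, coeff_zero] at h1
    simp only [Matrix.cons_val_zero, Matrix.cons_val_one, zero_mul, add_zero] at h1
    have e1 : (((t : F[X]) * X ^ (t-1) + (ep t : F[X]) * (3 * X ^ 2) : F[X])) = C (t : F) * X ^ (t-1) + C ((ep t : F) * 3) * X ^ 2 := by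
      simp [mul_assoc, C_ofNat]
    rw [e1, coeff_add, coeff_C_mul, coeff_C_mul, coeff_X_pow, coeff_X_pow] at h1
    rcases eq_or_ne t 3 with h3 | h3
    · subst h3
      simp [ep] at h1
      apply one_ne_zero (α := F)
      linear_combination h1 - h2
    · have : ¬ t ≤ 3 := by omega
      rw [if_neg (by omega)] at h1
      simp [ep, this] at h1
      apply one_ne_zero (α := F)
      linear_combination h1 - h2
  · have h1 := congrArg (fun G => (MvPolynomial.aeval (![1, X] : Fin 2 → F[X]) G).coeff 1) hG0
    simp only [G, map_add, map_mul, map_natCast, map_pow, MvPolynomial.aeval_X, map_ofNat, map_zero, coeff_zero] at h1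
    simp only [Matrix.cons_val_zero, Matrix.cons_val_one, one_pow, mul_one] at h1
    have e1 : ((t : F[X]) + ((ep t : F[X]) * 3 + X * (ee t : F[X]))) = C ((t : F) + ep t * 3) + X * C (ee t : F) := by
      simp [add_assoc]
      exact Or.inl rfl
    rw [e1, coeff_add, coeff_X_mul, coeff_C_of_ne_zero one_ne_zero, coeff_C_zero, zero_add] at h1
    exact he h1

theorem root_ne (γ β : OO F) (hγ : (pT t (oa F) (ox F)).eval γ = 0) (hβ : (pT t (oa F) (ox F)).eval β = 0)
    (hne : γ ≠ β) : γ ^ ee t ≠ β ^ ee t := by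
  intro h
  by_cases h2 : t = 2
  · simp [ee, h2] at h; exact hne h
  simp only [ee, h2, if_false] at h
  have hb : β = - γ := by
    rcases sq_eq_sq_iff_eq_or_eq_neg.1 h with h | h
    · exact absurd h hne
    · rw [h, neg_neg]
  have h20 : (2 : F) ≠ 0 := by
    intro h0
    apply hne
    have : (2 : OO F) = 0 := by
      have := congrArg (algebraMap F (OO F)) h0
      rw [map_zero, map_ofNat] at this
      exact this
    rw [hb]; linear_combination γ * this
  have hv := (tb_root F t γ hγ).1.transcendental 0
  rw [pT_eval] at hγ hβ
  rw [show ee t = 2 by simp [ee, h2]] at hγ hβ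
  let G : F[X] := C (1 - (-1) ^ t) * X ^ t + C (2 * (ep t : F)) * X ^ 3
  have hG : aeval γ G = 0 := by
    simp only [G, map_add, map_mul, aeval_C, aeval_X, map_pow, map_sub, map_one, map_neg, map_natCast, map_ofNat]
    rw [hb, neg_pow γ t] at hβ
    linear_combination hγ - hβ
  have hG0 : G = 0 := by
    by_contra hG0
    exact hv ⟨G, hG0, hG⟩
  have h1 := congrArg (fun G => coeff G 3) hG0
  simp only [G, coeff_add, coeff_C_mul, coeff_X_pow, coeff_zero] at h1
  rcases eq_or_ne t 3 with h3 | h3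
  · subst h3
    simp [ep] at h1
    apply h20
    linear_combination h1
  · have h4 : ¬ t ≤ 3 := by omega
    rw [if_neg (by omega)] at h1
    simp [ep, h4] at h1
    exact h20 h1

theorem tb_pair (γ β : OO F) (hγ : (pT t (oa F) (ox F)).eval γ = 0) (hβ : (pT t (oa F) (ox F)).eval β = 0)
    (hne : γ ≠ β) : IsTranscendenceBasis F ![γ, β] := by
  have hn := root_ne F t ht γ β hγ hβ hne
  rw [pT_eval] at hγ hβ
  have hg : γ ∈ Algebra.adjoin F (Set.range ![γ, β]) := Algebra.subset_adjoin ⟨0, rfl⟩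
  have hb : β ∈ Algebra.adjoin F (Set.range ![γ, β]) := Algebra.subset_adjoin ⟨1, rfl⟩
  have ha : IsAlgebraic (Algebra.adjoin F (Set.range ![γ, β])) (oa F) := by
    let γ' : Algebra.adjoin F (Set.range ![γ, β]) := ⟨γ, hg⟩
    let β' : Algebra.adjoin F (Set.range ![γ, β]) := ⟨β, hb⟩
    refine ⟨C (γ' ^ ee t - β' ^ ee t) * X + C (γ' ^ t - β' ^ t + ep t * (γ' ^ 3 - β' ^ 3)), ?_, ?_⟩
    · intro h
      have := congrArg (fun G => coeff G 1) h
      simp only [coeff_add, coeff_C_mul, coeff_X_one, mul_one, coeff_C_of_ne_zero one_ne_zero, add_zero, coeff_zero] at this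
      have := congrArg (algebraMap _ (OO F)) this
      simp only [map_sub, map_pow, map_zero] at this
      exact hn (sub_eq_zero.1 this)
    · simp only [map_add, map_mul, aeval_C, aeval_X, map_sub, map_pow, map_natCast]
      change (γ ^ ee t - β ^ ee t) * oa F + (γ ^ t - β ^ t + ep t * (γ ^ 3 - β ^ 3)) = 0
      linear_combination hγ - hβ
  refine tb F _ _ ha ?_
  have hx : ox F = - (γ ^ t + (ep t * γ ^ 3 + oa F * γ ^ ee t)) := by
    linear_combination hγ
  rw [hx]
  have hg' := isAlgebraic_algebraMap (A := OO F) (⟨_, hg⟩ : Algebra.adjoin F (Set.range ![γ, β]))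
  change IsAlgebraic _ γ at hg'
  have hn' := isAlgebraic_algebraMap (A := OO F) ((ep t : ℕ) : Algebra.adjoin F (Set.range ![γ, β]))
  rw [map_natCast] at hn'
  exact ((hg'.pow _).add ((hn'.mul (hg'.pow _)).add (ha.mul (hg'.pow _)))).neg

theorem two_trans (γ β γ' β' : OO F) (hγ : (pT t (oa F) (ox F)).eval γ = 0) (hβ : (pT t (oa F) (ox F)).eval β = 0)
    (hne : γ ≠ β) (hγ' : (pT t (oa F) (ox F)).eval γ' = 0) (hβ' : (pT t (oa F) (ox F)).eval β' = 0)
    (hne' : γ' ≠ β') : ∃ σ : OO F ≃ₐ[KK F] OO F, σ γ = γ' ∧ σ β = β' := by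
  suffices H : _ by
    obtain ⟨σ, h⟩ := tb_aut F _ _ (tb_pair F t ht γ β hγ hβ hne) (tb_pair F t ht γ' β' hγ' hβ' hne') H
    exact ⟨σ, h 0, h 1⟩
  · intro σ _ h
    have h0 : σ γ = γ' := h 0
    have h1 : σ β = β' := h 1
    have hn := root_ne F t ht γ' β' hγ' hβ' hne'
    rw [pT_eval] at hγ hβ hγ' hβ'
    have e1 := congrArg σ hγ
    have e2 := congrArg σ hβ
    simp only [map_add, map_mul, map_pow, map_natCast, map_zero, h0, h1] at e1 e2
    have ha : σ (oa F) = oa F := by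
      have : (σ (oa F) - oa F) * (γ' ^ ee t - β' ^ ee t) = 0 := by
        linear_combination e1 - e2 - hγ' + hβ'
      rcases mul_eq_zero.1 this with h | h
      · exact sub_eq_zero.1 h
      · exact absurd (sub_eq_zero.1 h) hn
    refine ⟨ha, ?_⟩
    rw [ha] at e1
    linear_combination e1 - hγ'

theorem exists_roots (B : Type) [Fintype B] (hB : Fintype.card B = t) :
    ∃ α : B → OO F, Function.Injective α ∧ (pT t (oa F) (ox F)) = ∏ b, (X - C (α b)) := by
  classical
  have hm := pT_monic t ht (oa F) (ox F)
  have hs : (pT t (oa F) (ox F)).roots.Nodup := by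
    refine Multiset.nodup_iff_count_le_one.2 fun z => ?_
    rw [count_roots]
    by_contra! hc
    have h1 := (one_lt_rootMultiplicity_iff_isRoot hm.ne_zero).1 hc
    exact root_sep F t ht z h1.1 h1.2
  have hcard : (pT t (oa F) (ox F)).roots.card = t := by
    rw [(splits_iff_card_roots.1 (IsAlgClosed.splits _)), pT_natDegree t ht]
  have hc2 : (pT t (oa F) (ox F)).roots.toFinset.card = t := by
    rw [Multiset.toFinset_card_of_nodup hs, hcard]
  let f := Fintype.equivOfCardEq (α := B) (β := (pT t (oa F) (ox F)).roots.toFinset) (by rw [hB, Fintype.card_coe, hc2])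
  refine ⟨fun b => f b, fun a b h => f.injective (Subtype.ext h), ?_⟩
  have h1 := (IsAlgClosed.splits (pT t (oa F) (ox F))).eq_prod_roots_of_monic hm
  rw [f.prod_comp (fun z => X - C (z : OO F)), Finset.prod_coe_sort _ (fun z => X - C z)]
  conv_lhs => rw [h1]
  rw [Finset.prod, Multiset.toFinset_val, Multiset.dedup_eq_self.2 hs]

end gal2

section gal3

noncomputable def qT {A : Type*} [CommRing A] (t : ℕ) (a : A) : A[X] :=
  X ^ (t - 2) + (C (ep t : A) * X + C a)

theorem pT_qT {A : Type*} [CommRing A] (t : ℕ) (ht : 3 ≤ t) (a x : A) :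
    pT t a x = X ^ 2 * qT t a + C x := by
  have : (X : A[X]) ^ t = X ^ 2 * X ^ (t - 2) := by rw [← pow_add]; congr 1; omega
  rw [pT, qT, this, show ee t = 2 by unfold ee; rw [if_neg (by omega)]]
  ring

variable {k' : Type} [Field k'] [IsAlgClosed k']

theorem qT_monic (t : ℕ) (ht : 3 ≤ t) (a : k') : (qT t a).Monic := by
  have h := pT_monic t (by omega) a 0
  rw [pT_qT t ht, C_0, add_zero] at h
  exact (monic_X_pow 2).of_mul_monic_left h

theorem local_root (t : ℕ) (ht : 3 ≤ t) (a : k') (ha : a ≠ 0)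
    (z : k') (hz : (qT t a).eval z = 0) (hz' : (derivative (qT t a)).eval z ≠ 0) :
    ∃ ρ : PowerSeries k', (pT t (PowerSeries.C a) PowerSeries.X).eval ρ = 0 ∧ PowerSeries.constantCoeff ρ = z := by
  have hz0 : z ≠ 0 := by
    rintro rfl
    by_cases h3 : t = 3
    · subst h3
      simp [qT, ep] at hz
      exact ha hz
    · have : t - 2 ≠ 0 := by omega
      simp [qT, this] at hz
      exact ha hz
  have key := HenselianRing.is_henselian (R := PowerSeries k') (I := Ideal.span {PowerSeries.X})
    (pT t (PowerSeries.C a) PowerSeries.X) (pT_monic t (by omega) _ _) (PowerSeries.C z) ?_ ?_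
  · obtain ⟨ρ, h1, h2⟩ := key
    refine ⟨ρ, h1, ?_⟩
    rw [Ideal.mem_span_singleton, PowerSeries.X_dvd_iff] at h2
    simpa [sub_eq_zero] using h2
  · rw [Ideal.mem_span_singleton, PowerSeries.X_dvd_iff, ← Polynomial.eval_map_apply, pT_map]
    simp [pT_qT t ht, hz]
  · refine IsUnit.map _ ?_
    rw [PowerSeries.isUnit_iff_constantCoeff, ← Polynomial.eval_map_apply, ← derivative_map, pT_map]
    simp [pT_qT t ht, hz, derivative_mul, hz0, hz']

theorem local_fac (t : ℕ) (ht : 3 ≤ t) (a : k') (ha : a ≠ 0)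
    (hs : ∀ z : k', (qT t a).eval z = 0 → (derivative (qT t a)).eval z ≠ 0) :
    ∃ (Z : Finset k') (ρ : k' → PowerSeries k') (g : (PowerSeries k')[X]), g.Monic ∧ g.natDegree = 2 ∧ Irreducible g ∧
      pT t (PowerSeries.C a) PowerSeries.X = (∏ z ∈ Z, (X - C (ρ z))) * g := by
  classical
  have hm := qT_monic t ht a
  have hnd : (qT t a).roots.Nodup := by
    refine Multiset.nodup_iff_count_le_one.2 fun z => ?_
    rw [count_roots]
    by_contra! hc
    have h1 := (one_lt_rootMultiplicity_iff_isRoot hm.ne_zero).1 hc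
    exact hs z h1.1 h1.2
  have hq : qT t a = ∏ z ∈ (qT t a).roots.toFinset, (X - C z) := by
    conv_lhs => rw [(IsAlgClosed.splits (qT t a)).eq_prod_roots_of_monic hm]
    rw [Finset.prod, Multiset.toFinset_val, Multiset.dedup_eq_self.2 hnd]
  have hr : ∀ z : k', ∃ ρ : PowerSeries k', z ∈ (qT t a).roots.toFinset →
      (pT t (PowerSeries.C a) PowerSeries.X).eval ρ = 0 ∧ PowerSeries.constantCoeff ρ = z := by
    intro z
    by_cases hz : z ∈ (qT t a).roots.toFinset
    · have h0 : (qT t a).eval z = 0 := by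
        rw [Multiset.mem_toFinset, mem_roots hm.ne_zero] at hz; exact hz
      obtain ⟨ρ, h⟩ := local_root t ht a ha z h0 (hs z h0)
      exact ⟨ρ, fun _ => h⟩
    · exact ⟨0, fun h => absurd h hz⟩
  choose ρ hρ using hr
  generalize hZ : (qT t a).roots.toFinset = Z at hq hρ
  have hPm := pT_monic t (by omega : 2 ≤ t) (PowerSeries.C a) PowerSeries.X
  have hdvd : (∏ z ∈ Z, (X - C (ρ z))) ∣ pT t (PowerSeries.C a) PowerSeries.X := by
    have h := Multiset.prod_X_sub_C_dvd_iff_le_roots hPm.ne_zero (Z.val.map ρ)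
    rw [Multiset.map_map] at h
    refine h.2 ?_
    rw [Multiset.le_iff_subset]
    · intro y hy
      obtain ⟨z, hz, rfl⟩ := Multiset.mem_map.1 hy
      rw [mem_roots hPm.ne_zero]
      exact (hρ z hz).1
    · refine Multiset.Nodup.map_on ?_ Z.nodup
      intro z hz w hw hzw
      rw [← (hρ z hz).2, ← (hρ w hw).2, hzw]
  obtain ⟨g, hg⟩ := hdvd
  have hWm : (∏ z ∈ Z, (X - C (ρ z))).Monic := monic_prod_of_monic _ _ fun _ _ => monic_X_sub_C _
  have hgm : g.Monic := by rw [hg] at hPm; exact hWm.of_mul_monic_left hPm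
  have hgX : g.map (PowerSeries.constantCoeff (R := k')) = X ^ 2 := by
    have h1 := congrArg (Polynomial.map (PowerSeries.constantCoeff (R := k'))) hg
    rw [pT_map, Polynomial.map_mul, pT_qT t ht, Polynomial.map_prod] at h1
    have h2 : ∏ z ∈ Z, Polynomial.map (PowerSeries.constantCoeff (R := k')) (X - C (ρ z)) = qT t a := by
      rw [hq]
      refine Finset.prod_congr rfl fun z hz => ?_
      simp [(hρ z hz).2]
    rw [h2] at h1
    simp only [PowerSeries.constantCoeff_C, PowerSeries.constantCoeff_X, C_0, add_zero] at h1
    rw [mul_comm] at h1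
    exact (mul_left_cancel₀ hm.ne_zero h1).symm
  have hg2 : g.natDegree = 2 := by
    rw [← hgm.natDegree_map (PowerSeries.constantCoeff (R := k')), hgX, natDegree_X_pow]
  refine ⟨Z, ρ, g, hgm, hg2, ?_, hg⟩
  have hp : (Ideal.span {PowerSeries.X} : Ideal (PowerSeries k')).IsPrime := PowerSeries.span_X_isPrime
  refine IsEisensteinAt.irreducible (𝓟 := Ideal.span {PowerSeries.X}) ⟨?_, ?_, ?_⟩ hp hgm.isPrimitive (by omega)
  · rw [hgm.leadingCoeff]
    exact fun h => hp.ne_top ((Ideal.eq_top_iff_one _).2 h)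
  · intro n hn
    rw [Ideal.mem_span_singleton, PowerSeries.X_dvd_iff, ← Polynomial.coeff_map, hgX, coeff_X_pow, if_neg (by omega)]
  · rw [Ideal.span_singleton_pow, Ideal.mem_span_singleton]
    intro h
    have h0 := congrArg (fun p => eval 0 p) hg
    simp only [pT_qT t ht, eval_mul, eval_add, eval_pow, eval_X, eval_C] at h0
    rw [← coeff_zero_eq_eval_zero g] at h0
    have h1 : PowerSeries.X ^ 2 ∣ (PowerSeries.X : PowerSeries k') := by
      have h2 := Dvd.dvd.mul_left h (eval 0 (∏ z ∈ Z, (X - C (ρ z))))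
      rw [← h0] at h2
      simpa using h2
    rw [PowerSeries.X_pow_dvd_iff] at h1
    simpa using h1 1 (by norm_num)

end gal3

section gal4
variable (F : Type) [Field F]

abbrev kcl := AlgebraicClosure (FractionRing F[X])
noncomputable def ka : kcl F := algebraMap F[X] (kcl F) X

theorem kcl_inj : Function.Injective (algebraMap F[X] (kcl F)) := by
  rw [IsScalarTower.algebraMap_eq F[X] (FractionRing F[X]) (kcl F)]
  exact (algebraMap (FractionRing F[X]) (kcl F)).injective.comp (IsFractionRing.injective F[X] _)

theorem ka_tr : Transcendental F (ka F) := by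
  rw [transcendental_iff_injective]
  have : (aeval (ka F) : F[X] →ₐ[F] kcl F) = IsScalarTower.toAlgHom F F[X] (kcl F) := by
    ext; simp [ka]
  rw [this]
  exact kcl_inj F

theorem qT_sep (t : ℕ) (ht : 3 ≤ t) (z : kcl F) (hz : (qT t (ka F)).eval z = 0) :
    (derivative (qT t (ka F))).eval z ≠ 0 := by
  intro h
  apply ka_tr F
  let G : F[X] := C ((t - 2 : ℕ) : F) * X ^ (t - 3) + C (ep t : F)
  have hG : aeval z G = 0 := by
    simp only [qT, derivative_add, derivative_mul, derivative_C, derivative_X_pow, derivative_X, eval_add, eval_mul, eval_C, eval_pow, eval_X, eval_zero, eval_one] at h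
    simp only [G, map_add, map_mul, aeval_C, aeval_X, map_pow, map_natCast]
    rw [show t - 3 = t - 2 - 1 by omega]
    linear_combination h
  have hG0 : G ≠ 0 := by
    intro h0
    have h1 := congrArg (fun p => coeff p 0) h0
    simp only [G, coeff_add, coeff_C_mul, coeff_X_pow, coeff_zero, coeff_C_zero] at h1
    rcases eq_or_ne t 3 with h3 | h3
    · subst h3; simp [ep] at h1
    · rw [if_neg (by omega)] at h1
      have : ¬ t ≤ 3 := by omega
      simp [ep, this] at h1
  have hzal : IsAlgebraic F z := ⟨G, hG0, hG⟩
  have : ka F = - (z ^ (t - 2) + ep t * z) := by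
    simp only [qT, eval_add, eval_mul, eval_C, eval_pow, eval_X] at hz
    linear_combination hz
  rw [this]
  have hn : IsAlgebraic F ((ep t : ℕ) : kcl F) := by
    have := isAlgebraic_algebraMap (R := F) (A := kcl F) ((ep t : ℕ) : F)
    rwa [map_natCast] at this
  exact ((hzal.pow _).add (hn.mul hzal)).neg

theorem conj_swap {M L : Type} [Field M] [Field L] [Algebra M L] [IsAlgClosure M L] (g : M[X]) (hg : g.Monic)
    (hirr : Irreducible g) (β γ : L) (h1 : aeval β g = 0) (h2 : aeval γ g = 0) : ∃ σ : L ≃ₐ[M] L, σ β = γ := by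
  have : Normal M L := IsAlgClosure.normal M L
  have := minpoly.eq_of_irreducible_of_monic hirr h1 hg
  have h3 := minpoly.eq_of_irreducible_of_monic hirr h2 hg
  exact (isConjRoot_iff_exists_algEquiv (x := γ) (y := β)).1 (by rw [IsConjRoot, ← this, ← h3])

abbrev VV := PowerSeries (kcl F)
abbrev MMf := FractionRing (VV F)

noncomputable def jV : F[X][X] →+* VV F :=
  (Polynomial.coeToPowerSeries.ringHom (R := kcl F)).comp (mapRingHom (algebraMap F[X] (kcl F)))

theorem jV_inj : Function.Injective (jV F) :=
  (Polynomial.coe_injective _).comp (Polynomial.map_injective _ (kcl_inj F))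

noncomputable def jK : KK F →+* MMf F :=
  IsFractionRing.lift (g := (algebraMap (VV F) (MMf F)).comp (jV F))
    ((IsFractionRing.injective (VV F) (MMf F)).comp (jV_inj F))

theorem jK_apply (p : F[X][X]) : jK F (algebraMap _ _ p) = algebraMap (VV F) (MMf F) (jV F p) := by
  simp [jK]

theorem gal_swap (t : ℕ) (ht : 3 ≤ t) (B : Type) [Fintype B] [DecidableEq B] (α : B → OO F) (hα : Function.Injective α)
    (hP : pT t (oa F) (ox F) = ∏ b, (X - C (α b))) :
    ∃ x y : B, x ≠ y ∧ ∃ σ : OO F ≃ₐ[KK F] OO F, ∀ b, σ (α b) = α (Equiv.swap x y b) := by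
  have hka : ka F ≠ 0 := fun h => ka_tr F (h ▸ isAlgebraic_zero)
  obtain ⟨Z, ρ, g, hgm, hg2, hgi, hfac⟩ := local_fac t ht (ka F) hka (qT_sep F t ht)
  let _ : Algebra (KK F) (MMf F) := (jK F).toAlgebra
  let L := AlgebraicClosure (MMf F)
  let i : OO F →ₐ[KK F] L := IsAlgClosed.lift
  let _ : Algebra (OO F) L := i.toRingHom.toAlgebra
  have : IsScalarTower (KK F) (OO F) L := IsScalarTower.of_algebraMap_eq fun z => (i.commutes z).symm
  let v : VV F →+* L := (algebraMap (MMf F) L).comp (algebraMap (VV F) (MMf F))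
  have hi : ∀ p : F[X][X], i (algebraMap F[X][X] (OO F) p) = v (jV F p) := by
    intro p
    rw [IsScalarTower.algebraMap_apply F[X][X] (KK F) (OO F), i.commutes,
      IsScalarTower.algebraMap_apply (KK F) (MMf F) L]
    exact congrArg _ (jK_apply F p)
  have hia : i (oa F) = v (PowerSeries.C (ka F)) := by
    rw [oa, hi]; congr 1; simp [jV, ka]
  have hix : i (ox F) = v PowerSeries.X := by
    rw [ox, hi]; congr 1; simp [jV]
  have hPL : ∏ b, (X - C (i (α b))) = (∏ z ∈ Z, (X - C (v (ρ z)))) * g.map v := by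
    have h1 := congrArg (Polynomial.map (i : OO F →+* L)) hP
    have h2 := congrArg (Polynomial.map v) hfac
    rw [pT_map] at h1 h2
    simp only [Polynomial.map_prod, Polynomial.map_sub, Polynomial.map_X, Polynomial.map_C, Polynomial.map_mul] at h1 h2
    have h3 : pT t ((i : OO F →+* L) (oa F)) ((i : OO F →+* L) (ox F)) = pT t (v (PowerSeries.C (ka F))) (v PowerSeries.X) := by
      change pT t (i (oa F)) (i (ox F)) = _
      rw [hia, hix]
    rw [← h2, ← h3, h1]; rfl
  set gL := g.map v with hgL
  have hgLm : gL.Monic := hgm.map v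
  have hPm : (∏ b, (X - C (i (α b)))).Monic := monic_prod_of_monic _ _ fun _ _ => monic_X_sub_C _
  have hroots : (∏ b, (X - C (i (α b)))).roots = Finset.univ.val.map fun b => i (α b) := by
    have := Polynomial.roots_multiset_prod_X_sub_C (Finset.univ.val.map fun b => i (α b))
    rwa [Multiset.map_map] at this
  have hle : gL.roots ≤ Finset.univ.val.map fun b => i (α b) := by
    rw [← hroots]
    exact Polynomial.roots.le_of_dvd hPm.ne_zero ⟨_, by rw [hPL, mul_comm]⟩
  have hnd : gL.roots.Nodup := Multiset.nodup_of_le hle (Multiset.Nodup.map (i.injective.comp hα) Finset.univ.nodup)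
  have hcard : gL.roots.card = 2 := by
    rw [(splits_iff_card_roots.1 (IsAlgClosed.splits gL)), hgL, hgm.natDegree_map, hg2]
  obtain ⟨β₁, β₂, hβ⟩ := Multiset.card_eq_two.1 hcard
  have hβne : β₁ ≠ β₂ := by
    rw [hβ] at hnd; simpa using hnd
  have hm1 : β₁ ∈ gL.roots := by rw [hβ]; simp
  have hm2 : β₂ ∈ gL.roots := by rw [hβ]; simp
  obtain ⟨x, -, hx⟩ := Multiset.mem_map.1 (Multiset.mem_of_le hle hm1)
  obtain ⟨y, -, hy⟩ := Multiset.mem_map.1 (Multiset.mem_of_le hle hm2)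
  let gM := g.map (algebraMap (VV F) (MMf F))
  have hgM : Irreducible gM := (hgm.irreducible_iff_irreducible_map_fraction_map (K := MMf F)).1 hgi
  have hgMm : gM.Monic := hgm.map _
  have hroot : ∀ β : L, β ∈ gL.roots ↔ aeval β gM = 0 := by
    intro β
    rw [mem_roots hgLm.ne_zero, IsRoot, hgL, aeval_def, eval₂_eq_eval_map, Polynomial.map_map]
  obtain ⟨σ, hσ⟩ := conj_swap gM hgMm hgM β₁ β₂ ((hroot _).1 hm1) ((hroot _).1 hm2)
  have hσ2 : σ β₂ = β₁ := by
    have h1 : σ β₂ ∈ gL.roots := by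
      rw [hroot]
      have := Polynomial.aeval_algHom_apply (σ : L →ₐ[MMf F] L) β₂ gM
      change aeval (σ β₂) gM = σ _ at this
      rw [this, (hroot _).1 hm2, map_zero]
    rw [hβ] at h1
    simp only [Multiset.insert_eq_cons, Multiset.mem_cons, Multiset.mem_singleton] at h1
    rcases h1 with h1 | h1
    · exact h1
    · exact absurd (σ.injective (h1.trans hσ.symm)) hβne.symm
  have hxy : x ≠ y := by
    rintro rfl; exact hβne (hx.symm.trans hy)
  have : Normal (KK F) (OO F) := IsAlgClosure.normal (KK F) (OO F)
  let τ : OO F ≃ₐ[KK F] OO F := (σ.restrictScalars (KK F)).restrictNormal (OO F)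
  have hτ : ∀ z, i (τ z) = σ (i z) := fun z => AlgEquiv.restrictNormal_commutes (σ.restrictScalars (KK F)) (OO F) z
  refine ⟨x, y, hxy, τ, fun b => i.injective ?_⟩
  change i (τ (α b)) = i (α ((Equiv.swap x y) b))
  rw [hτ]
  rcases eq_or_ne b x with rfl | hbx
  · rw [Equiv.swap_apply_left, hx, hy, hσ]
  rcases eq_or_ne b y with rfl | hby
  · rw [Equiv.swap_apply_right, hx, hy, hσ2]
  rw [Equiv.swap_apply_of_ne_of_ne hbx hby]
  have hb : (∏ b, (X - C (i (α b)))).eval (i (α b)) = 0 := by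
    rw [eval_prod, Finset.prod_eq_zero (Finset.mem_univ b)]; simp
  rw [hPL, eval_mul, mul_eq_zero] at hb
  rcases hb with hb | hb
  · rw [eval_prod, Finset.prod_eq_zero_iff] at hb
    obtain ⟨z, hz, hb⟩ := hb
    rw [eval_sub, eval_X, eval_C, sub_eq_zero] at hb
    rw [hb]
    exact σ.commutes _
  · have : i (α b) ∈ gL.roots := (mem_roots hgLm.ne_zero).2 hb
    rw [hβ] at this
    simp only [Multiset.insert_eq_cons, Multiset.mem_cons, Multiset.mem_singleton, ← hx, ← hy] at this
    rcases this with h | h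
    · exact absurd (hα (i.injective h)) hbx
    · exact absurd (hα (i.injective h)) hby

end gal4

section gal5
variable (F : Type) [Field F]

theorem gal_full (t : ℕ) (ht : 2 ≤ t) (B : Type) [Fintype B] [DecidableEq B] (hB : Fintype.card B = t) :
    ∃ α : B → OO F, Function.Injective α ∧ (∀ b, (pT t (oa F) (ox F)).eval (α b) = 0) ∧
      ∀ ρ : Equiv.Perm B, ∃ σ : OO F ≃ₐ[KK F] OO F, ∀ b, σ (α b) = α (ρ b) := by
  obtain ⟨α, hα, hP⟩ := exists_roots F t ht B hB
  have hr : ∀ z, (pT t (oa F) (ox F)).eval z = 0 ↔ ∃ b, z = α b := by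
    intro z
    rw [hP, eval_prod, Finset.prod_eq_zero_iff]
    simp [sub_eq_zero]
  have hr' : ∀ b, (pT t (oa F) (ox F)).eval (α b) = 0 := fun b => (hr _).2 ⟨b, rfl⟩
  refine ⟨α, hα, hr', ?_⟩
  let H : Subgroup (Equiv.Perm B) :=
    { carrier := {ρ | ∃ σ : OO F ≃ₐ[KK F] OO F, ∀ b, σ (α b) = α (ρ b)}
      mul_mem' := by
        rintro a b ⟨σ, h⟩ ⟨τ, h'⟩
        exact ⟨τ.trans σ, fun c => by simp [h, h']⟩
      one_mem' := ⟨AlgEquiv.refl, fun b => rfl⟩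
      inv_mem' := by
        rintro a ⟨σ, h⟩
        refine ⟨σ.symm, fun b => ?_⟩
        rw [AlgEquiv.symm_apply_eq, h]; simp }
  have hperm : ∀ σ : OO F ≃ₐ[KK F] OO F, ∃ ρ : Equiv.Perm B, ∀ b, σ (α b) = α (ρ b) := by
    intro σ
    have h1 : ∀ b, ∃ b', σ (α b) = α b' := by
      intro b
      rw [← hr]
      have h0 := congrArg σ (hr' b)
      rw [pT_eval] at h0 ⊢
      have ha : σ (oa F) = oa F := by
        rw [oa, IsScalarTower.algebraMap_apply F[X][X] (KK F) (OO F)]; exact σ.commutes _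
      have hx : σ (ox F) = ox F := by
        rw [ox, IsScalarTower.algebraMap_apply F[X][X] (KK F) (OO F)]; exact σ.commutes _
      simpa only [map_add, map_mul, map_pow, map_natCast, map_zero, ha, hx] using h0
    choose f hf using h1
    have hinj : Function.Injective f := by
      intro b c h
      apply hα; apply σ.injective
      rw [hf, hf, h]
    exact ⟨Equiv.ofBijective f (Finite.injective_iff_bijective.1 hinj), hf⟩
  have h2 : ∀ b c b' c' : B, b ≠ c → b' ≠ c' → ∃ h ∈ H, h b = b' ∧ h c = c' := by
    intro b c b' c' h h'
    obtain ⟨σ, h1, h2⟩ := two_trans F t ht (α b) (α c) (α b') (α c') (hr' _) (hr' _) (hα.ne h) (hr' _) (hr' _) (hα.ne h')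
    obtain ⟨ρ, hρ⟩ := hperm σ
    refine ⟨ρ, ⟨σ, hρ⟩, hα ?_, hα ?_⟩
    · rw [← hρ, h1]
    · rw [← hρ, h2]
  have hsw : ∃ x y : B, x ≠ y ∧ Equiv.swap x y ∈ H := by
    rcases ht.eq_or_lt with h | h
    · have hc : Fintype.card B = 2 := by rw [hB, ← h]
      obtain ⟨x, y, hxy⟩ := Fintype.exists_pair_of_one_lt_card (by omega : 1 < Fintype.card B)
      obtain ⟨h, hh, hx, hy⟩ := h2 x y y x hxy hxy.symm
      refine ⟨x, y, hxy, ?_⟩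
      convert hh using 1
      ext b
      have hu : (Finset.univ : Finset B) = {x, y} := by
        symm
        rw [← Finset.card_eq_iff_eq_univ, Finset.card_pair hxy, hc]
      have hb : b ∈ (Finset.univ : Finset B) := Finset.mem_univ b
      rw [hu] at hb
      simp only [Finset.mem_insert, Finset.mem_singleton] at hb
      rcases hb with rfl | rfl
      · rw [Equiv.swap_apply_left, hx]
      · rw [Equiv.swap_apply_right, hy]
    · obtain ⟨x, y, hxy, σ, hσ⟩ := gal_swap F t h B α hα hP
      exact ⟨x, y, hxy, σ, hσ⟩
  obtain ⟨x, y, hxy, hs⟩ := hsw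
  have := perm_top H h2 x y hxy hs
  intro ρ
  have hρ : ρ ∈ H := by rw [this]; trivial
  exact hρ

end gal5

structure Chain (k : ℕ) (d : Fin k → ℕ) where
  E : Fin k → ℕ
  w : Fin k → ℕ
  i1 : Fin k
  l : Fin k
  nx : Fin k → Fin k
  m2 : Fin k → ℕ
  m3 : Fin k → ℕ
  E1 : E i1 = 1
  El : E l * d l = ∏ i, d i
  En : ∀ i, i ≠ l → E (nx i) = E i * d i
  wn : ∀ i, i ≠ l → w (nx i) < w i * d i
  wl : 0 < w l * d l
  d2 : ∑ j, m2 j ≤ d l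
  E2 : ∑ j, E j * m2 j = ee (∏ i, d i)
  w2 : wt w m2 < w l * d l
  d3 : 4 ≤ ∏ i, d i → ∑ j, m3 j ≤ d l
  E3 : 4 ≤ ∏ i, d i → ∑ j, E j * m3 j = 3
  w3 : 4 ≤ ∏ i, d i → wt w m3 < w l * d l

def Chain.perm {k : ℕ} {d : Fin k → ℕ} (π : Equiv.Perm (Fin k)) (c : Chain k (d ∘ π)) : Chain k d where
  E := c.E ∘ π.symm
  w := c.w ∘ π.symm
  i1 := π c.i1
  l := π c.l
  nx i := π (c.nx (π.symm i))
  m2 := c.m2 ∘ π.symm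
  m3 := c.m3 ∘ π.symm
  E1 := by simpa using c.E1
  El := by
    have := c.El
    rw [← Equiv.prod_comp π d]; simpa using this
  En i hi := by
    have := c.En (π.symm i) (by rintro h; apply hi; rw [← h]; simp)
    simpa using this
  wn i hi := by
    have := c.wn (π.symm i) (by rintro h; apply hi; rw [← h]; simp)
    simpa using this
  wl := by simpa using c.wl
  d2 := by
    simp only [Function.comp_apply]; rw [Equiv.sum_comp π.symm c.m2]; exact c.d2
  E2 := by
    simp only [Function.comp_apply]; rw [Equiv.sum_comp π.symm (fun j => c.E j * c.m2 j), ← Equiv.prod_comp π d]; exact c.E2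
  w2 := by
    simp only [wt, Function.comp_apply]; rw [Equiv.sum_comp π.symm (fun j => c.w j * c.m2 j)]
    simpa [wt] using c.w2
  d3 h := by
    simp only [Function.comp_apply]; rw [Equiv.sum_comp π.symm c.m3]; exact c.d3 (by rw [← Equiv.prod_comp π d] at h; exact h)
  E3 h := by
    simp only [Function.comp_apply]; rw [Equiv.sum_comp π.symm (fun j => c.E j * c.m3 j)]; exact c.E3 (by rw [← Equiv.prod_comp π d] at h; exact h)
  w3 h := by
    simp only [wt, Function.comp_apply]; rw [Equiv.sum_comp π.symm (fun j => c.w j * c.m3 j)]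
    simpa [wt] using c.w3 (by rw [← Equiv.prod_comp π d] at h; exact h)

theorem chain_exists_max (n : ℕ) (d : Fin (n+1) → ℕ) (hd : ∀ i, 0 < d i)
    (hmax : ∀ i, d i ≤ d (Fin.last n)) (ht : 2 ≤ ∏ i, d i) : Nonempty (Chain (n+1) d) := by
  let D : ℕ → ℕ := fun j => if h : j < n+1 then d ⟨j,h⟩ else 1
  have hD : ∀ i : Fin (n+1), D i = d i := fun i => dif_pos i.2
  have hDpos : ∀ j, 0 < D j := fun j => by
    by_cases h : j < n+1
    · simp only [D, dif_pos h]; exact hd _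
    · simp only [D, dif_neg h]; exact Nat.one_pos
  let E : ℕ → ℕ := fun i => ∏ j ∈ Finset.range i, D j
  have hE0 : E 0 = 1 := by simp [E]
  have hEs : ∀ i, E (i+1) = E i * D i := fun i => Finset.prod_range_succ _ _
  have hEpos : ∀ i, 0 < E i := fun i => Finset.prod_pos fun j _ => hDpos j
  have hprod : ∏ i, d i = E (n+1) := by
    simp only [E]
    rw [← Fin.prod_univ_eq_prod_range]
    exact Finset.prod_congr rfl fun i _ => (hD i).symm
  have hl2 : 2 ≤ d (Fin.last n) := by
    by_contra h
    have : ∏ i, d i ≤ 1 := Finset.prod_le_one' fun i _ => by have := hmax i; omega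
    omega
  have hDl : D n = d (Fin.last n) := by simpa using hD (Fin.last n)
  have hEl : E n * d (Fin.last n) = ∏ i, d i := by rw [hprod, hEs, hDl]
  have hwl : E n * (4*(n+1) - 1 - n) * d (Fin.last n) = (∏ i, d i) * (3*(n+1)) := by
    rw [← hEl, show 4*(n+1) - 1 - n = 3*(n+1) by omega]; ring
  have hm3 : 4 ≤ ∏ i, d i → ∃ m3 : Fin (n+1) → ℕ, ∑ j, m3 j ≤ d (Fin.last n) ∧
      ∑ j : Fin (n+1), E j * m3 j = 3 ∧ ∑ j : Fin (n+1), E j * (4*(n+1) - 1 - j) * m3 j ≤ 3 * (4*(n+1) - 1) := by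
    intro h4
    by_cases h3 : 3 ≤ d (Fin.last n)
    · refine ⟨Pi.single 0 3, ?_, ?_, ?_⟩
      · simpa using h3
      · simp [Pi.single_apply, hE0]
      · simp [Pi.single_apply, hE0]; omega
    · have hex : ∃ j, 2 ≤ E j := ⟨n+1, by omega⟩
      classical
      let j := Nat.find hex
      have hj : 2 ≤ E j := Nat.find_spec hex
      have hjn : j ≤ n := Nat.find_min' hex (by
        have : d (Fin.last n) = 2 := by omega
        rw [this] at hEl; omega)
      have hj0 : j ≠ 0 := by rintro h; rw [h] at hj; omega
      obtain ⟨i, hi⟩ := Nat.exists_eq_succ_of_ne_zero hj0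
      have hi1 : E i < 2 := by
        have := Nat.find_min hex (m := i) (by change i < j; omega); omega
      have hD2 : D i ≤ 2 := by
        by_cases h : i < n+1
        · have := hmax ⟨i,h⟩; simp only [D, h, dif_pos]; omega
        · simp only [D, dif_neg h]; omega
      have hE2 : E j = 2 := by
        have h1 := hEs i
        have : E i = 1 := by have := hEpos i; omega
        rw [this] at h1
        rw [hi, Nat.succ_eq_add_one] at hj ⊢; omega
      refine ⟨Pi.single 0 1 + Pi.single ⟨j, by omega⟩ 1, ?_, ?_, ?_⟩
      · simp [Finset.sum_add_distrib]; omega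
      · simp [Pi.single_apply, mul_add, Finset.sum_add_distrib, hE0, hE2]
      · simp [Pi.single_apply, mul_add, Finset.sum_add_distrib, hE0, hE2]; omega
  have hee : ee (∏ i, d i) ≤ d (Fin.last n) := by unfold ee; split_ifs <;> omega
  have hmul4 : 4 ≤ ∏ i, d i → 4 * (3*(n+1)) ≤ (∏ i, d i) * (3*(n+1)) := fun h => Nat.mul_le_mul_right _ h
  obtain ⟨m3, h3⟩ : ∃ m3 : Fin (n+1) → ℕ, 4 ≤ ∏ i, d i → ∑ j, m3 j ≤ d (Fin.last n) ∧
      ∑ j : Fin (n+1), E j * m3 j = 3 ∧ ∑ j : Fin (n+1), E j * (4*(n+1) - 1 - j) * m3 j ≤ 3 * (4*(n+1) - 1) := by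
    by_cases h : 4 ≤ ∏ i, d i
    · obtain ⟨m, hm⟩ := hm3 h; exact ⟨m, fun _ => hm⟩
    · exact ⟨0, fun h' => absurd h' h⟩
  refine ⟨{
    E := fun i => E i, w := fun i => E i * (4*(n+1) - 1 - i), i1 := 0, l := (Fin.last n), 
    nx := fun i => i + 1, m2 := Pi.single 0 (ee (∏ i, d i)), m3 := m3, E1 := by simpa using hE0,
    El := by simpa using hEl, En := ?_, wn := ?_, wl := ?_, d2 := ?_, E2 := ?_, w2 := ?_,
    d3 := fun h => (h3 h).1, E3 := fun h => (h3 h).2.1, w3 := ?_}⟩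
  · intro i hi
    have h1 : ((i+1 : Fin (n+1)) : ℕ) = i + 1 := Fin.val_add_one_of_lt (Fin.lt_last_iff_ne_last.2 hi)
    simp only [h1, hEs, hD]
  · intro i hi
    have h1 : ((i+1 : Fin (n+1)) : ℕ) = i + 1 := Fin.val_add_one_of_lt (Fin.lt_last_iff_ne_last.2 hi)
    have h2 := i.2
    simp only [h1, hEs, hD]
    have : E i * (4*(n+1) - 1 - i) * d i = E i * d i * (4*(n+1) - 1 - i) := by ring
    rw [this]
    exact Nat.mul_lt_mul_of_pos_left (by omega) (Nat.mul_pos (hEpos _) (hd _))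
  · simp only [Fin.val_last]; rw [hwl]; exact Nat.mul_pos (by omega) (by omega)
  · simpa using hee
  · simp [Pi.single_apply, hE0]
  · simp only [wt, Fin.val_last]; rw [hwl]
    simp only [Pi.single_apply, mul_ite, mul_zero, Finset.sum_ite_eq', Finset.mem_univ, if_true, Fin.val_zero, hE0]
    simp
    rcases Nat.lt_or_ge 2 (∏ i, d i) with h | h
    · have : 3 * (3*(n+1)) ≤ (∏ i, d i) * (3*(n+1)) := Nat.mul_le_mul_right _ h
      have e2 : ee (∏ i, d i) = 2 := by unfold ee; rw [if_neg (by omega)]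
      rw [e2]; omega
    · have h' : ∏ i, d i = 2 := by omega
      rw [h']; simp [ee]; omega
  · intro h
    simp only [wt, Fin.val_last]; rw [hwl]
    have := (h3 h).2.2
    have := hmul4 h
    omega

theorem chain_exists (k : ℕ) (d : Fin k → ℕ) (hd : ∀ i, 0 < d i) (ht : 2 ≤ ∏ i, d i) :
    Nonempty (Chain k d) := by
  cases k with
  | zero => simp at ht
  | succ n =>
    obtain ⟨i, -, hi⟩ := Finset.exists_max_image Finset.univ d Finset.univ_nonempty
    obtain ⟨c⟩ := chain_exists_max n (d ∘ Equiv.swap i (Fin.last n)) (fun j => hd _)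
      (fun j => by simpa using hi _ (Finset.mem_univ _)) (by
        simp only [Function.comp_apply]; rw [Equiv.prod_comp]; exact ht)
    exact ⟨c.perm⟩

section gen
variable {k : ℕ} {d : Fin k → ℕ}

theorem sum_mon {A : Type*} [CommRing A] {e : ℕ} (a : Fin k → ℕ) (h : ∑ j, a j ≤ e) (v : A) (f : (Fin k → ℕ) → A) :
    ∑ m : Mon k e, (if m.1 = a then v else 0) * f m.1 = v * f a := by
  rw [Finset.sum_eq_single (⟨a, h⟩ : Mon k e)]
  · simp
  · intro m _ hm
    rw [if_neg, zero_mul]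
    intro h'; exact hm (Subtype.ext h')
  · simp

theorem mon_pow {A : Type*} [CommRing A] (z : A) (E a : Fin k → ℕ) :
    mon (fun i => z ^ E i) a = z ^ (∑ j, E j * a j) := by
  simp [mon, ← pow_mul, Finset.prod_pow_eq_pow_sum]

open Classical in
noncomputable def cE {A : Type*} [CommRing A] (c : Chain k d) (a x : A) : Idx d → A := fun p =>
  (if p.2.1 = Pi.single p.1 (d p.1) then 1 else 0) +
    if p.1 = c.l then
      (if p.2.1 = c.m3 then (ep (∏ i, d i) : A) else 0) + (if p.2.1 = c.m2 then a else 0) + (if p.2.1 = 0 then x else 0)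
    else (if p.2.1 = Pi.single (c.nx p.1) 1 then -1 else 0)

theorem cE_map {A A' : Type*} [CommRing A] [CommRing A'] (f : A →+* A') (c : Chain k d) (a x : A) :
    f ∘ cE c a x = cE c (f a) (f x) := by
  funext p
  simp only [cE, Function.comp_apply, map_add, apply_ite f, map_one, map_zero, map_neg, map_natCast]

theorem Del_cE {A : Type*} [CommRing A] (hd : ∀ i, 0 < d i) (c : Chain k d) (a x : A) : Del (cE c a x) = 1 := by
  have hlead : ∀ i, wt c.w (Pi.single i (d i)) = c.w i * d i := fun i => by
    simp [wt, Pi.single_apply]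
  have key : ∀ i (m : Mon k (d i)), ((if i = c.l then
      (if m.1 = c.m3 then (ep (∏ i, d i) : A) else 0) + (if m.1 = c.m2 then a else 0) + (if m.1 = 0 then x else 0)
    else (if m.1 = Pi.single (c.nx i) 1 then -1 else 0)) ≠ 0) → wt c.w m.1 < c.w i * d i := by
    intro i m h
    by_cases hi : i = c.l
    · rw [if_pos hi] at h
      by_cases h3 : m.1 = c.m3
      · by_cases h4 : 4 ≤ ∏ i, d i
        · rw [h3, hi]; exact c.w3 h4
        · have : ep (∏ i, d i) = 0 := if_pos (by omega)
          by_cases h2 : m.1 = c.m2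
          · rw [h2, hi]; exact c.w2
          · by_cases h0 : m.1 = 0
            · rw [h0, hi]; simpa [wt] using c.wl
            · simp [this, h2, h0] at h
      · by_cases h2 : m.1 = c.m2
        · rw [h2, hi]; exact c.w2
        · by_cases h0 : m.1 = 0
          · rw [h0, hi]; simpa [wt] using c.wl
          · simp [h3, h2, h0] at h
    · rw [if_neg hi] at h
      by_cases h1 : m.1 = Pi.single (c.nx i) 1
      · rw [h1]
        have := c.wn i hi
        simpa [wt, Pi.single_apply] using this
      · simp [h1] at h
  apply Del_weight _ c.w
  · intro i m hm
    have : _ → _ := key i m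
    simp only [cE]
    rw [if_pos hm]
    by_contra hne
    have h2 := key i m (fun h0 => hne (by convert add_zero _))
    rw [hm, hlead] at h2
    exact lt_irrefl _ h2
  · intro i m hm h
    apply key i m
    simp only [cE] at h
    rw [if_neg hm, zero_add] at h
    convert h

theorem sev_cE {A : Type*} [CommRing A] (hd : ∀ i, 0 < d i) (c : Chain k d) (a x z : A)
    (hz : (pT (∏ i, d i) a x).eval z = 0) (i : Fin k) : sev (cE c a x) i (fun i => z ^ c.E i) = 0 := by
  simp only [sev, cE, add_mul, Finset.sum_add_distrib]
  rw [sum_mon (Pi.single i (d i)) (by simp)]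
  by_cases hi : i = c.l
  · simp only [if_pos hi, add_mul, Finset.sum_add_distrib]
    rw [sum_mon c.m2 (by rw [hi]; exact c.d2), sum_mon 0 (by simp)]
    have h3 : ∑ m : Mon k (d i), (if m.1 = c.m3 then (ep (∏ i, d i) : A) else 0) * mon (fun i => z ^ c.E i) m.1
        = (ep (∏ i, d i) : A) * z ^ 3 := by
      by_cases h4 : 4 ≤ ∏ i, d i
      · rw [sum_mon c.m3 (by rw [hi]; exact c.d3 h4), mon_pow, c.E3 h4]
      · have : ep (∏ i, d i) = 0 := if_pos (by omega)
        simp [this]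
    rw [h3]
    simp only [mon_pow, c.E2]
    rw [pT_eval] at hz
    have hl := c.El
    rw [← hi] at hl
    simp [Pi.single_apply, hl]
    rw [← hz]; try ring
  · simp only [if_neg hi]
    rw [sum_mon (Pi.single (c.nx i) 1) (by simpa using Nat.succ_le_of_lt (hd i))]
    simp [mon_pow, Pi.single_apply, c.En i hi]

end gen

theorem generic_irred (F : Type) [Field F] {k : ℕ} {d : Fin k → ℕ} (hd : ∀ i, 0 < d i) (ht : 2 ≤ ∏ i, d i) :
    ∃ c : Idx d → KK F, Irreducible ((Rw (Box d)).map (etaH (A := MvPolynomial (Box d ⊕ Fin k) (KK F))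
      (fun b => MvPolynomial.X (Sum.inl b)) (PP (fun i => MvPolynomial.X (Sum.inr i)) (MvPolynomial.C ∘ c)))) := by
  obtain ⟨ch⟩ := chain_exists k d hd ht
  obtain ⟨α, hα, hr, hσ⟩ := gal_full F (∏ i, d i) ht (Box d) card_Box
  let a : KK F := algebraMap F[X][X] (KK F) (C X)
  let x : KK F := algebraMap F[X][X] (KK F) X
  have ha : algebraMap (KK F) (OO F) a = oa F := rfl
  have hx : algebraMap (KK F) (OO F) x = ox F := rfl
  refine ⟨cE ch a x, ?_⟩
  let y : Box d → MvPolynomial (Box d ⊕ Fin k) (OO F) := fun b =>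
    ∑ i, MvPolynomial.X (Sum.inr i) * MvPolynomial.C (α b ^ ch.E i)
  let lam : Box d → MvPolynomial (Box d ⊕ Fin k) (OO F) := fun b => MvPolynomial.X (Sum.inl b)
  let ψ : MvPolynomial (Box d ⊕ Fin k) (KK F) →+* MvPolynomial (Box d ⊕ Fin k) (OO F) :=
    MvPolynomial.map (algebraMap (KK F) (OO F))
  have hψ : Function.Injective ψ := MvPolynomial.map_injective _ (algebraMap (KK F) (OO F)).injective
  have hEv : ∀ b0 b, MvPolynomial.eval (Sum.elim (Pi.single b0 1) (Pi.single ch.i1 1)) (y b) = α b := by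
    intro b0 b
    simp [y, Pi.single_apply, ch.E1]
  have hyinj : Function.Injective y := by
    intro b b' h
    apply hα
    rw [← hEv b b, h, hEv b b']
  have hcE : ψ ∘ (MvPolynomial.C ∘ cE ch a x) = cE ch (MvPolynomial.C (oa F)) (MvPolynomial.C (ox F)) := by
    have h1 : (ψ.comp MvPolynomial.C) a = MvPolynomial.C (oa F) := by
      rw [← ha]; exact MvPolynomial.map_C _ _
    have h2 : (ψ.comp MvPolynomial.C) x = MvPolynomial.C (ox F) := by
      rw [← hx]; exact MvPolynomial.map_C _ _
    rw [← h1, ← h2]; exact cE_map (ψ.comp MvPolynomial.C) ch a x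
  have hPP : (PP (fun i => MvPolynomial.X (Sum.inr i)) (MvPolynomial.C ∘ cE ch a x)).map ψ = ∏ b, (X - C (y b)) := by
    rw [PP_map, hcE]
    have hD := Del_cE hd ch (MvPolynomial.C (σ := Box d ⊕ Fin k) (oa F)) (MvPolynomial.C (ox F))
    have hμ : (ψ ∘ fun i => MvPolynomial.X (Sum.inr i)) = (fun i : Fin k => MvPolynomial.X (Sum.inr i)) := by
      funext i; simp [ψ]
    have := PP_prod hd (ψ ∘ fun i => MvPolynomial.X (Sum.inr i)) (cE ch (MvPolynomial.C (oa F)) (MvPolynomial.C (ox F)))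
      (fun b i => MvPolynomial.C (α b) ^ ch.E i) (fun b i => by
        apply sev_cE hd
        rw [← pT_map]
        rw [eval_map, eval₂_hom, hr, map_zero]) (by
        intro b b' h
        apply hyinj
        rw [hμ, hD] at h
        simpa [y] using h)
    rw [this, hD, hμ]
    simp [y]
  have hR : ((Rw (Box d)).map (etaH (A := MvPolynomial (Box d ⊕ Fin k) (KK F))
      (fun b => MvPolynomial.X (Sum.inl b)) (PP (fun i => MvPolynomial.X (Sum.inr i)) (MvPolynomial.C ∘ cE ch a x)))).map ψ
      = Rv lam y := by
    rw [Polynomial.map_map, etaH_map, hPP, Rw_prod]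
    congr 1
    funext b; simp [ψ, lam]
  refine resolvent_irred (I := Equiv.Perm (Box d)) _ ?_ (uv lam y) ?_ hR ?_
  · apply Polynomial.monic_of_injective hψ
    rw [hR]; exact Rv_monic _ _
  · intro τ τ' h
    ext1 b0
    apply hα
    have h2 := congrArg (MvPolynomial.eval (Sum.elim (Pi.single b0 1) (Pi.single ch.i1 1))) h
    simpa only [uv, map_sum, map_mul, hEv, lam, MvPolynomial.eval_X, Sum.elim_inl, Pi.single_apply, ite_mul, one_mul, zero_mul,
      Finset.sum_ite_eq', Finset.mem_univ, if_true] using h2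
  · intro τ ρ
    obtain ⟨σ, h⟩ := hσ (ρ * τ⁻¹)
    refine ⟨σ, ?_⟩
    simp [uv, lam, y, h]

section udeg
variable {k : ℕ} (d : Fin k → ℕ)

abbrev Lam : Type := Box d ⊕ (Fin k ⊕ Idx d)

variable {d}

noncomputable def thU {A : Type*} [CommRing A] (v : Lam d → A) : MvPolynomial (Lam d) ℤ →+* A :=
  MvPolynomial.eval₂Hom (Int.castRingHom A) v

theorem thU_X {A : Type*} [CommRing A] (v : Lam d → A) (j : Lam d) : thU v (MvPolynomial.X j) = v j := by
  simp [thU]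

noncomputable def PU : (MvPolynomial (Lam d) ℤ)[X] :=
  PP (fun i => MvPolynomial.X (Sum.inr (Sum.inl i))) (fun p => MvPolynomial.X (Sum.inr (Sum.inr p)))

noncomputable def eU : MvPolynomial (Fin (Fintype.card (Box d))) (LLr (Box d)) →+* MvPolynomial (Lam d) ℤ :=
  etaH (fun b => MvPolynomial.X (Sum.inl b)) PU

theorem eU_map {A : Type*} [CommRing A] (lam : Box d → A) (mu : Fin k → A) (c : Idx d → A) :
    etaH lam (PP mu c) = (thU (Sum.elim lam (Sum.elim mu c))).comp eU := by
  rw [eU, etaH_map, PU, PP_map]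
  have h1 : (thU (Sum.elim lam (Sum.elim mu c))) ∘ (fun b => MvPolynomial.X (Sum.inl b)) = lam := by
    funext b; simp [thU_X]
  have h2 : (thU (Sum.elim lam (Sum.elim mu c))) ∘ (fun i => MvPolynomial.X (Sum.inr (Sum.inl i))) = mu := by
    funext b; simp [thU_X]
  have h3 : (thU (Sum.elim lam (Sum.elim mu c))) ∘ (fun i => MvPolynomial.X (Sum.inr (Sum.inr i))) = c := by
    funext b; simp [thU_X]
  rw [h1, h2, h3]

theorem thU_deg {A : Type*} [CommRing A] (v : Lam d → A[X]) (hv : ∀ j, (v j).natDegree ≤ 1) (p : MvPolynomial (Lam d) ℤ) :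
    (thU v p).natDegree ≤ p.totalDegree := by
  have h := MvPolynomial.aeval_natDegree_le (R := A) (m := p.totalDegree) (n := 1)
    (MvPolynomial.map (Int.castRingHom A) p) ?_ v hv
  · have h2 : MvPolynomial.aeval v (MvPolynomial.map (Int.castRingHom A) p) = thU v p := by
      rw [MvPolynomial.aeval_def, MvPolynomial.eval₂_map, thU, MvPolynomial.coe_eval₂Hom]
      congr 1
    rw [h2, mul_one] at h
    exact h
  · exact Finset.sup_mono (MvPolynomial.support_map_subset _ _)

variable (d) in
theorem unif_deg : ∃ D : ℕ, 1 ≤ D ∧ ∀ (A : Type) [CommRing A] (lam : Box d → A[X]) (mu : Fin k → A[X]) (c : Idx d → A[X]),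
    (∀ b, (lam b).natDegree ≤ 1) → (∀ i, (mu i).natDegree ≤ 1) → (∀ p, (c p).natDegree ≤ 1) →
    (∀ n, (((Rw (Box d)).map (etaH lam (PP mu c))).coeff n).natDegree ≤ D) ∧
    (∀ σ n, (((Sw (B := Box d) σ).map (etaH lam (PP mu c))).coeff n).natDegree ≤ D) ∧
    (etaH lam (PP mu c) (Dw (Box d))).natDegree ≤ D ∧ (Del c).natDegree ≤ D := by
  have hQ : ∀ Q : (MvPolynomial (Lam d) ℤ)[X], ∃ D, ∀ n, (Q.coeff n).totalDegree ≤ D := by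
    intro Q
    refine ⟨∑ n ∈ Q.support, (Q.coeff n).totalDegree, fun n => ?_⟩
    by_cases hn : n ∈ Q.support
    · exact Finset.single_le_sum (f := fun n => (Q.coeff n).totalDegree) (fun _ _ => Nat.zero_le _) hn
    · rw [notMem_support_iff.1 hn]; simp
  obtain ⟨D1, h1⟩ := hQ ((Rw (Box d)).map eU)
  choose D2 h2 using fun σ => hQ ((Sw (B := Box d) σ).map eU)
  let DU : MvPolynomial (Lam d) ℤ := Del (d := d) (fun p => MvPolynomial.X (Sum.inr (Sum.inr p)))
  refine ⟨1 + D1 + ∑ σ, D2 σ + (eU (Dw (Box d))).totalDegree + DU.totalDegree, by omega, ?_⟩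
  intro A _ lam mu c hl hm hc
  have hv : ∀ j, ((Sum.elim lam (Sum.elim mu c)) j).natDegree ≤ 1 := by
    rintro (b | i | p)
    · exact hl b
    · exact hm i
    · exact hc p
  rw [eU_map]
  refine ⟨fun n => ?_, fun σ n => ?_, ?_, ?_⟩
  · rw [← Polynomial.map_map, coeff_map]
    refine (thU_deg _ hv _).trans ((h1 n).trans (by omega))
  · rw [← Polynomial.map_map, coeff_map]
    have := Finset.single_le_sum (f := D2) (fun _ _ => Nat.zero_le _) (Finset.mem_univ σ)
    refine (thU_deg _ hv _).trans ((h2 σ n).trans (by omega))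
  · exact (thU_deg _ hv _).trans (by omega)
  · have : Del c = thU (Sum.elim lam (Sum.elim mu c)) DU := by
      rw [Del_map]
      congr 1; funext p; simp [thU_X]
    rw [this]
    exact (thU_deg _ hv _).trans (by omega)
end udeg

section ul
variable {k : ℕ} (d : Fin k → ℕ) (F : Type) [Field F]

abbrev D1 : Type := MvPolynomial (Lam d) F

noncomputable def fil : MFil (D1 d F) where
  G v := { carrier := {p | ∀ m, p.coeff m ≠ 0 → (m.degree : ℤ) ≤ v}
           add_mem' := fun {p q} hp hq m hm => by
            by_cases h : p.coeff m = 0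
            · apply hq m; intro h'; apply hm; simp [h, h']
            · exact hp m h
           zero_mem' := fun m hm => by simp at hm
           neg_mem' := fun {p} hp m hm => hp m (by simpa using hm) }
  mono h _ hp m hm := (hp m hm).trans h
  one m hm := by
    classical
    rw [MvPolynomial.coeff_one] at hm
    split_ifs at hm with h
    · simp [← h]
    · exact absurd rfl hm
  mul := by
    classical
    intro a b x y hx hy m hm
    rw [MvPolynomial.coeff_mul] at hm
    obtain ⟨p, hp, hne⟩ := Finset.exists_ne_zero_of_sum_ne_zero hm
    have h1 := hx p.1 (left_ne_zero_of_mul hne)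
    have h2 := hy p.2 (right_ne_zero_of_mul hne)
    rw [Finset.HasAntidiagonal.mem_antidiagonal] at hp
    rw [← hp, map_add]; push_cast; linarith

variable {d F}

theorem fil_C (c : F) : (MvPolynomial.C c : D1 d F) ∈ (fil d F).G 0 := by
  classical
  intro m hm
  rw [MvPolynomial.coeff_C] at hm
  split_ifs at hm with h
  · simp [← h]
  · exact absurd rfl hm

theorem fil_X (j : Lam d) : (MvPolynomial.X j : D1 d F) ∈ (fil d F).G 1 := by
  classical
  intro m hm
  rw [MvPolynomial.coeff_X] at hm
  split_ifs at hm with h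
  · simp [← h]
  · exact absurd rfl hm

theorem fil_deg {p : D1 d F} {n : ℕ} (h : p ∈ (fil d F).G n) : p.totalDegree ≤ n := by
  rw [MvPolynomial.totalDegree]
  refine Finset.sup_le fun m hm => ?_
  have := h m (MvPolynomial.mem_support_iff.1 hm)
  exact_mod_cast this

def MFil.sub {A : Type*} [CommRing A] (φ : MFil A) : Subring A where
  carrier := φ.G 0
  one_mem' := φ.one
  mul_mem' := fun ha hb => by simpa using φ.mul ha hb
  zero_mem' := zero_mem _
  add_mem' := fun ha hb => add_mem ha hb
  neg_mem' := fun ha => neg_mem ha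

theorem MFil.Del_mem {A : Type*} [CommRing A] (φ : MFil A) (c : Idx d → A) (hc : ∀ p, c p ∈ φ.G 0) : Del c ∈ φ.G 0 := by
  have h := Del_map φ.sub.subtype (fun p => (⟨c p, hc p⟩ : φ.sub))
  have h2 : φ.sub.subtype ∘ (fun p => (⟨c p, hc p⟩ : φ.sub)) = c := rfl
  rw [h2] at h
  rw [← h]
  exact (Del (fun p => (⟨c p, hc p⟩ : φ.sub))).2

noncomputable def muU : Fin k → (D1 d F)[X] := fun i => C (MvPolynomial.X (Sum.inr (Sum.inl i)))
noncomputable def lamU : Box d → (D1 d F)[X] := fun b => C (MvPolynomial.X (Sum.inl b))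
noncomputable def cU (e : (i : Fin k) → Fin (d i) → F) : Idx d → (D1 d F)[X] := fun p =>
  C (MvPolynomial.C (c0 e p)) + X * C (MvPolynomial.X (Sum.inr (Sum.inr p)))
noncomputable def y0 (e : (i : Fin k) → Fin (d i) → F) : Box d → D1 d F := fun b =>
  ∑ i, MvPolynomial.X (Sum.inr (Sum.inl i)) * MvPolynomial.C (e i (b i))

theorem y0_inj (e : (i : Fin k) → Fin (d i) → F) (he : ∀ i, Function.Injective (e i)) : Function.Injective (y0 e) := by
  classical
  intro b b' h
  funext i
  apply he i
  have h2 := congrArg (MvPolynomial.eval (Sum.elim 0 (Sum.elim (Pi.single i 1) 0))) h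
  simpa [y0, Pi.single_apply] using h2

theorem uv0_inj (e : (i : Fin k) → Fin (d i) → F) (he : ∀ i, Function.Injective (e i)) :
    Function.Injective (uv (fun b => MvPolynomial.X (Sum.inl b)) (y0 e)) := by
  classical
  intro τ τ' h
  ext1 b
  funext i
  apply he i
  have h2 := congrArg (MvPolynomial.eval (Sum.elim (Pi.single b 1) (Sum.elim (Pi.single i 1) 0))) h
  simpa [uv, y0, Pi.single_apply] using h2

theorem univ_line (hd : ∀ i, 0 < d i) (e : (i : Fin k) → Fin (d i) → F) (he : ∀ i, Function.Injective (e i)) :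
    ∃ y : Box d → PowerSeries (D1 d F), (PP muU (cU e)).map (cps (D1 d F)) = ∏ b, (X - C (y b)) ∧
      (∀ b, PowerSeries.constantCoeff (y b) = y0 e b) ∧ (∀ b, y b ∈ ((fil d F).ps 1).G 1) ∧
      (∀ i j, MM (cU e) i * MM (cU e) j = MM (cU e) j * MM (cU e) i) ∧ ∀ i, homf (cU e) i = 0 := by
  let g : Idx d → D1 d F := fun p => MvPolynomial.X (Sum.inr (Sum.inr p))
  choose γ hγ hs using newton_line e (fil d F) (fun c => fil_C c) g (fun p => fil_X _) he
  have hcl : cps (D1 d F) ∘ cU e = cline e g := by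
    funext p
    simp [cU, cline, iot, g, cps]
    exact mul_comm _ _
  have hmu : ∀ i, cps (D1 d F) (muU i) = PowerSeries.C (MvPolynomial.X (Sum.inr (Sum.inl i))) := by
    intro i; simp [muU, cps]
  let x : Box d → Fin k → PowerSeries (D1 d F) := fun b j => iot F (D1 d F) (e j (b j)) + PowerSeries.X * γ b j
  let y : Box d → PowerSeries (D1 d F) := fun b => Del (cline e g) * ∑ i, (cps (D1 d F) ∘ muU) i * x b i
  have hD0 : PowerSeries.constantCoeff (Del (cline e g)) = 1 := by
    rw [Del_map]
    have : (PowerSeries.constantCoeff ∘ cline e g) = algebraMap F (D1 d F) ∘ c0 e := by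
      funext p; simp [cline, iot]
    rw [this, ← Del_map, Del_c0, map_one]
  have hyc : ∀ b, PowerSeries.constantCoeff (y b) = y0 e b := by
    intro b
    simp [y, hD0, y0, hmu, x, iot]
  have hinj : Function.Injective y := by
    intro b b' h
    apply y0_inj e he
    rw [← hyc, h, hyc]
  have hyG : ∀ b, y b ∈ ((fil d F).ps 1).G 1 := by
    intro b
    refine MFil.mul' _ (a := 0) (b := 1) (MFil.Del_mem _ _ fun p => ?_) (sum_mem fun i _ => ?_) (by norm_num)
    · refine add_mem (MFil.ps_C _ _ (fil_C _)) ?_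
      exact MFil.mul' _ (MFil.ps_X _ _) (MFil.ps_C _ _ (fil_X _)) (by norm_num)
    · refine MFil.mul' _ (a := 1) (b := 0) ?_ (add_mem (MFil.ps_C _ _ (fil_C _)) ?_) (by norm_num)
      · rw [Function.comp_apply, hmu]; exact MFil.ps_C _ _ (fil_X _)
      · exact MFil.mul' _ (MFil.ps_X _ _) (hγ _ _) (by norm_num)
  have hid := ident_of_zeros hd (cps (D1 d F) ∘ muU) (cline e g) x hs hinj
  have hPP := PP_prod hd (cps (D1 d F) ∘ muU) (cline e g) x hs hinj
  rw [← hcl] at hid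
  refine ⟨y, ?_, hyc, hyG, fun i j => ?_, fun i => ?_⟩
  · rw [PP_map, hcl]; exact hPP
  · have h := hid.1 i j
    rw [← MM_map, ← MM_map, ← Matrix.map_mul, ← Matrix.map_mul] at h
    exact Matrix.map_injective (cps_inj _) h
  · have h := hid.2 i
    rw [← homf_map] at h
    apply Matrix.map_injective (cps_inj (D1 d F))
    refine Eq.trans h ?_; ext; simp
end ul

section ri
variable {k : ℕ} {d : Fin k → ℕ} {F : Type} [Field F]

noncomputable def RU (e : (i : Fin k) → Fin (d i) → F) : (D1 d F)[X][X] :=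
  (Rw (Box d)).map (etaH lamU (PP muU (cU e)))

theorem RU_map (e : (i : Fin k) → Fin (d i) → F) (y : Box d → PowerSeries (D1 d F))
    (hy : (PP muU (cU e)).map (cps (D1 d F)) = ∏ b, (X - C (y b))) :
    (RU e).map (cps (D1 d F)) = QS (uv (cps (D1 d F) ∘ lamU) y) Finset.univ := by
  rw [RU, Polynomial.map_map, etaH_map, hy, Rw_prod]; rfl

theorem RU_irred (hd : ∀ i, 0 < d i) (e : (i : Fin k) → Fin (d i) → F) (he : ∀ i, Function.Injective (e i)) :
    (RU e).Monic ∧ Irreducible (RU e) := by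
  obtain ⟨y, hy, -⟩ := univ_line hd e he
  have hmap := RU_map e y hy
  have hm : (RU e).Monic := by
    apply Polynomial.monic_of_injective (cps_inj (D1 d F))
    rw [hmap]; exact QS_monic _ _
  refine ⟨hm, ?_⟩
  by_cases ht : 2 ≤ ∏ i, d i
  · obtain ⟨c, hc⟩ := generic_irred F hd ht
    let θ0 : D1 d F →+* MvPolynomial (Box d ⊕ Fin k) (KK F) :=
      MvPolynomial.eval₂Hom (MvPolynomial.C.comp (algebraMap F (KK F)))
        (Sum.elim (fun b => MvPolynomial.X (Sum.inl b)) (Sum.elim (fun i => MvPolynomial.X (Sum.inr i))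
          (fun p => MvPolynomial.C (c p - algebraMap F (KK F) (c0 e p)))))
    let θ : (D1 d F)[X] →+* MvPolynomial (Box d ⊕ Fin k) (KK F) := eval₂RingHom θ0 1
    refine hm.irreducible_of_irreducible_map θ _ ?_
    rw [RU, Polynomial.map_map, etaH_map, PP_map]
    have h1 : θ ∘ lamU = fun b => MvPolynomial.X (Sum.inl b) := by
      funext b; simp [θ, θ0, lamU]
    have h2 : θ ∘ muU = fun b => MvPolynomial.X (Sum.inr b) := by
      funext b; simp [θ, θ0, muU]
    have h3 : θ ∘ cU e = MvPolynomial.C ∘ c := by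
      funext b; simp [θ, θ0, cU]
    rw [h1, h2, h3]
    exact hc
  · have h1 : ∏ i, d i = 1 := by
      have : 0 < ∏ i, d i := Finset.prod_pos fun i _ => hd i
      omega
    have hdeg : (RU e).natDegree = 1 := by
      have h := congrArg natDegree hmap
      rw [hm.natDegree_map, QS_natDegree, Finset.card_univ, Fintype.card_perm, card_Box, h1] at h
      simpa using h
    exact Monic.irreducible_of_degree_eq_one (by rw [degree_eq_natDegree hm.ne_zero, hdeg]; rfl) hm
end ri

theorem MFil.prod_mem {A ι : Type*} [CommRing A] (φ : MFil A) (s : Finset ι) (f : ι → A) (a : ℤ)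
    (h : ∀ i ∈ s, f i ∈ φ.G a) : ∏ i ∈ s, f i ∈ φ.G (s.card * a) := by
  classical
  induction s using Finset.induction_on with
  | empty => simpa using φ.one
  | insert i s hi ih =>
    rw [Finset.prod_insert hi, Finset.card_insert_of_notMem hi]
    refine φ.mul' (h i (Finset.mem_insert_self _ _)) (ih fun j hj => h j (Finset.mem_insert_of_mem hj)) (le_of_eq ?_)
    push_cast; ring

section psi
variable {k : ℕ} {d : Fin k → ℕ} {F : Type} [Field F]

theorem MFil.uv_mem {A : Type*} {B : Type} [CommRing A] [Fintype B] [DecidableEq B] (φ : MFil A) (lam y : B → A) (hl : ∀ b, lam b ∈ φ.G 1)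
    (hy : ∀ b, y b ∈ φ.G 1) (τ : Equiv.Perm B) : uv lam y τ ∈ φ.G 2 :=
  sum_mem fun b _ => φ.mul' (hl _) (hy _) (by norm_num)

theorem psi_exists (hd : ∀ i, 0 < d i) (D : ℕ)
    (e : (i : Fin k) → Fin (d i) → F) (he : ∀ i, Function.Injective (e i)) (hD : ∀ n, ((RU e).coeff n).natDegree ≤ D)
    (N M : ℕ) (hN : N = Fintype.card (Equiv.Perm (Box d))) (hM : M = Fintype.card (Finset (Equiv.Perm (Box d)))) :
    ∃ Ψ : D1 d F, Ψ ≠ 0 ∧ Ψ.totalDegree ≤ N * (N * 2) + M * (N * 2 + 2 * D) ∧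
      ∀ v : Lam d → F, MvPolynomial.eval v Ψ ≠ 0 →
        Irreducible ((RU e).map (mapRingHom (MvPolynomial.eval v))) ∧
        MvPolynomial.eval v (Dv (fun b => MvPolynomial.X (Sum.inl b)) (y0 e)) ≠ 0 := by
  obtain ⟨y, hy, hy0, hyG, -⟩ := univ_line hd e he
  obtain ⟨hm, hirr⟩ := RU_irred hd e he
  obtain ⟨Φ, h1, h2, h3⟩ := bertini D (uv (cps (D1 d F) ∘ lamU) y) (RU e) hirr hm hD (RU_map e y hy)
  have hDv : Dv (fun b => MvPolynomial.X (Sum.inl b)) (y0 e) ≠ 0 := Dv_ne _ _ (uv0_inj e he)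
  refine ⟨Dv (fun b => MvPolynomial.X (Sum.inl b)) (y0 e) * ∏ s, Φ s, ?_, ?_, ?_⟩
  · exact mul_ne_zero hDv (Finset.prod_ne_zero_iff.2 fun s _ => h1 s)
  · apply fil_deg
    push_cast
    refine MFil.mul' _ (a := (N : ℤ) * (N * 2)) (b := M * (N * 2 + 2 * D)) ?_ ?_ le_rfl
    · have : ∀ τ : Equiv.Perm (Box d), uv (fun b => MvPolynomial.X (Sum.inl b)) (y0 e) τ ∈ (fil d F).G 2 := by
        apply MFil.uv_mem
        · intro b; exact fil_X _
        · intro b; exact sum_mem fun i _ => MFil.mul' _ (fil_X _) (fil_C _) (by norm_num)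
      rw [hN, ← Finset.card_univ]
      refine MFil.prod_mem _ _ _ _ fun τ _ => ?_
      refine MFil.mono _ ?_ (MFil.prod_mem _ _ _ 2 fun τ' _ => sub_mem (this _) (this _))
      have := Finset.card_le_univ (Finset.univ.erase τ)
      rw [Finset.card_univ]
      have : ((Finset.univ.erase τ).card : ℤ) ≤ Fintype.card (Equiv.Perm (Box d)) := by exact_mod_cast this
      linarith
    · rw [hM, ← Finset.card_univ]
      refine MFil.prod_mem _ _ _ _ fun s _ => ?_
      rcases h2 s with h | ⟨s', n, m, hmD, h⟩
      · rw [h]; exact MFil.mono _ (by positivity) (MFil.one _)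
      · rw [h]
        have hu : ∀ τ, uv (cps (D1 d F) ∘ lamU) y τ ∈ ((fil d F).ps 1).G 2 := by
          apply MFil.uv_mem
          · intro b
            have : (cps (D1 d F) ∘ lamU) b = PowerSeries.C (MvPolynomial.X (Sum.inl b)) := by simp [lamU, cps]
            rw [this]; exact MFil.ps_C _ _ (fil_X _)
          · exact hyG
        have hq : QS (uv (cps (D1 d F) ∘ lamU) y) s' ∈ ((fil d F).ps 1).poly.G (s'.card * 2) :=
          MFil.prod_mem _ _ _ _ fun τ _ => sub_mem (MFil.mono _ (by norm_num) (MFil.poly_X _)) (MFil.poly_C _ (hu τ))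
        refine MFil.mono _ ?_ (hq n m)
        have hs := Finset.card_le_univ s'
        rw [← hN] at hs
        have : (s'.card : ℤ) ≤ N := by exact_mod_cast hs
        have : (m : ℤ) ≤ 2 * D := by exact_mod_cast hmD
        linarith
  · intro v hv
    rw [map_mul, map_prod] at hv
    refine ⟨h3 F _ fun s => ?_, left_ne_zero_of_mul hv⟩
    exact Finset.prod_ne_zero_iff.1 (right_ne_zero_of_mul hv) s (Finset.mem_univ _)

end psi

def Good {k : ℕ} {d : Fin k → ℕ} {F : Type} [Field F] (c : Idx d → F) : Prop :=
  Nat.card {x : Fin k → F // ∀ i, sev c i x = 0} = ∏ i, d i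

theorem line_good {k : ℕ} {d : Fin k → ℕ} (hd : ∀ i, 0 < d i) : ∃ C₀ q₀ T : ℕ, ∀ (F : Type) [Field F] [Fintype F],
    q₀ ≤ Fintype.card F → ∀ e : (i : Fin k) → Fin (d i) → F, (∀ i, Function.Injective (e i)) →
    ∃ Ψ : D1 d F, Ψ ≠ 0 ∧ Ψ.totalDegree ≤ T ∧ ∀ v : Lam d → F, MvPolynomial.eval v Ψ ≠ 0 →
      Fintype.card F ≤ (∏ i, d i).factorial *
        Nat.card {s : F // Good (d := d) (fun p => c0 e p + s * v (Sum.inr (Sum.inr p)))} + C₀ * Nat.sqrt (Fintype.card F) := by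
  obtain ⟨D, hD1, hD⟩ := unif_deg d
  obtain ⟨C₁, q₀, hline⟩ := line_count (Box d) D hD1
  refine ⟨C₁ + (∏ i, d i).factorial * D, q₀, 
    Fintype.card (Equiv.Perm (Box d)) * (Fintype.card (Equiv.Perm (Box d)) * 2) +
      Fintype.card (Finset (Equiv.Perm (Box d))) * (Fintype.card (Equiv.Perm (Box d)) * 2 + 2 * D), fun F _ _ hq e he => ?_⟩
  have hdU := hD (D1 d F) lamU muU (cU e) (fun b => by simp [lamU]) (fun b => by simp [muU])
    (fun p => by
      refine (natDegree_add_le _ _).trans ?_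
      simp [natDegree_X_le])
  obtain ⟨y, hy, hy0, -, hcomm, hhom⟩ := univ_line hd e he
  obtain ⟨Ψ, h1, h2, h3⟩ := psi_exists hd D e he hdU.1 _ _ rfl rfl
  refine ⟨Ψ, h1, h2, fun v hv => ?_⟩
  obtain ⟨hirr, hDv⟩ := h3 v hv
  let lam : Box d → F := fun b => v (Sum.inl b)
  let mu : Fin k → F := fun i => v (Sum.inr (Sum.inl i))
  let cF : Idx d → F[X] := fun p => C (c0 e p) + X * C (v (Sum.inr (Sum.inr p)))
  let ev : D1 d F →+* F := MvPolynomial.eval v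
  have el : mapRingHom ev ∘ lamU = C ∘ lam := by funext b; simp [lamU, lam, ev]
  have em : mapRingHom ev ∘ muU = C ∘ mu := by funext b; simp [muU, mu, ev]
  have ec : mapRingHom ev ∘ cU e = cF := by funext b; simp [cU, cF, ev]
  have hP : PP (C ∘ mu) cF = (PP muU (cU e)).map (mapRingHom ev) := by rw [PP_map, em, ec]
  have heta : etaH (C ∘ lam) (PP (C ∘ mu) cF) = (mapRingHom ev).comp (etaH lamU (PP muU (cU e))) := by
    rw [etaH_map, el, hP]
  have hdF := hD F (C ∘ lam) (C ∘ mu) cF (fun b => by simp) (fun b => by simp)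
    (fun p => by
      refine (natDegree_add_le _ _).trans (max_le (by simp) (natDegree_mul_le.trans ?_))
      rw [natDegree_C, add_zero]; exact natDegree_X_le)
  have hR : (Rw (Box d)).map (etaH (C ∘ lam) (PP (C ∘ mu) cF)) = (RU e).map (mapRingHom ev) := by
    rw [heta, ← Polynomial.map_map]; rfl
  have hDw0 : (etaH (C ∘ lam) (PP (C ∘ mu) cF) (Dw (Box d))).eval 0 ≠ 0 := by
    have hW : cps (D1 d F) (etaH lamU (PP muU (cU e)) (Dw (Box d))) = Dv (cps (D1 d F) ∘ lamU) y := by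
      rw [← Dw_prod, ← hy, ← etaH_map]; rfl
    have hW0 := congrArg PowerSeries.constantCoeff hW
    rw [Dv_map] at hW0
    have e1 : PowerSeries.constantCoeff ∘ (cps (D1 d F) ∘ lamU) = fun b => MvPolynomial.X (Sum.inl b) := by
      funext b; simp [lamU, cps]
    have e2 : PowerSeries.constantCoeff ∘ y = y0 e := funext hy0
    rw [e1, e2] at hW0
    rw [heta, RingHom.comp_apply, coe_mapRingHom, ← coeff_zero_eq_eval_zero, coeff_map]
    have e3 : (etaH lamU (PP muU (cU e)) (Dw (Box d))).coeff 0 = Dv (fun b => MvPolynomial.X (Sum.inl b)) (y0 e) := by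
      rw [← hW0]; simp [cps]
    rw [e3]; exact hDv
  have hc := hline F hq (PP (C ∘ mu) cF) lam (PP_monic _ _) (by
      rw [PP, Matrix.charpoly_natDegree_eq_dim])
    (by rw [hR]; exact hirr) hdF.1 hdF.2.1 (by intro h; rw [h] at hDw0; simp at hDw0) hdF.2.2.1
    ⟨fun b => PowerSeries.map ev (y b), by
      have : (coeToPowerSeries.ringHom (R := F)).comp (mapRingHom ev) = (PowerSeries.map ev).comp (cps (D1 d F)) := by
        apply Polynomial.ringHom_ext
        · intro a; simp [cps]
        · simp [cps]
      rw [hP, Polynomial.map_map, this, ← Polynomial.map_map, hy, Polynomial.map_prod]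
      simp⟩
  have hDel0 : (Del cF).eval 0 = 1 := by
    have h := Del_map (evalRingHom (0 : F)) cF
    have h' : evalRingHom (0 : F) ∘ cF = c0 e := by funext p; simp [cF]
    rw [h', Del_c0] at h
    exact h
  have hDelne : Del cF ≠ 0 := by intro h; rw [h] at hDel0; simp at hDel0
  classical
  have hsub : {s : F | ∃ y : Box d → F, Function.Injective y ∧ (PP (C ∘ mu) cF).map (evalRingHom s) = ∏ b, (X - C (y b))} ⊆
      {s : F | Good (d := d) (fun p => c0 e p + s * v (Sum.inr (Sum.inr p)))} ∪ ((Del cF).roots.toFinset : Set F) := by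
    rintro s ⟨z, hz, hPz⟩
    by_cases hs : (Del cF).eval s = 0
    · right; simpa [hDelne] using hs
    · left
      have ecs : evalRingHom s ∘ cF = (fun p => c0 e p + s * v (Sum.inr (Sum.inr p))) := by
        funext p; simp [cF]; exact mul_comm _ _
      have ecs' : ((evalRingHom s).comp (mapRingHom ev)) ∘ cU e = (fun p => c0 e p + s * v (Sum.inr (Sum.inr p))) := by
        rw [← ecs, ← ec]; rfl
      have ems : evalRingHom s ∘ (C ∘ mu) = mu := by funext p; simp
      rw [PP_map, ecs, ems] at hPz
      refine exact_zeros hd mu _ ?_ ?_ ?_ z hz hPz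
      · rw [← ecs, ← Del_map]; exact hs
      · intro i j
        have h := congrArg (fun M => M.map ((evalRingHom s).comp (mapRingHom ev))) (hcomm i j)
        simp only [Matrix.map_mul, MM_map, ecs'] at h
        exact h
      · intro i
        rw [← ecs', ← homf_map, hhom i]
        ext; simp
  have hcard := (Set.ncard_le_ncard hsub (Set.toFinite _)).trans (Set.ncard_union_le _ _)
  have hroots : ((Del cF).roots.toFinset : Set F).ncard ≤ D := by
    rw [Set.ncard_coe_finset]
    exact (Multiset.toFinset_card_le _).trans ((card_roots' _).trans hdF.2.2.2)
  rw [← Nat.card_coe_set_eq, ← Nat.card_coe_set_eq] at hcard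
  have hsq : 1 ≤ Nat.sqrt (Fintype.card F) := by
    rw [Nat.le_sqrt]; exact Fintype.card_pos
  rw [card_Box] at hc
  set N := (∏ i, d i).factorial
  calc Fintype.card F ≤ _ := hc
    _ ≤ N * (Nat.card {s : F // Good (d := d) (fun p => c0 e p + s * v (Sum.inr (Sum.inr p)))} + D) + C₁ * Nat.sqrt (Fintype.card F) :=
      Nat.add_le_add_right (Nat.mul_le_mul_left _ (hcard.trans (Nat.add_le_add_left hroots _))) _
    _ ≤ _ := by
      rw [mul_add, add_mul]
      have := Nat.mul_le_mul_left (N * D) hsq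
      omega

lemma fin_sz {σ F : Type} [Fintype σ] [Field F] [Fintype F] (p : MvPolynomial σ F) (hp : p ≠ 0)
    (T : ℕ) (hT : p.totalDegree ≤ T) :
    Nat.card {v : σ → F // MvPolynomial.eval v p = 0} * Fintype.card F
      ≤ T * Fintype.card F ^ Fintype.card σ := by
  classical
  let ε := Fintype.equivFin σ
  have hp2 : MvPolynomial.rename ε p ≠ 0 := by
    intro h
    exact hp (MvPolynomial.rename_injective ε ε.injective (by rw [h, map_zero]))
  have h1 := MvPolynomial.schwartz_zippel_totalDegree hp2 (Finset.univ : Finset F)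
  have hd : (MvPolynomial.rename ε p).totalDegree ≤ T :=
    (MvPolynomial.totalDegree_rename_le _ _).trans hT
  have hq : 0 < Fintype.card F := Fintype.card_pos
  have hcard : Nat.card {v : σ → F // MvPolynomial.eval v p = 0} ≤
      (Finset.filter (fun f => MvPolynomial.eval f (MvPolynomial.rename ε p) = 0)
        (Fintype.piFinset fun _ : Fin (Fintype.card σ) => (Finset.univ : Finset F))).card := by
    rw [Nat.card_eq_fintype_card, Fintype.card_subtype]
    refine Finset.card_le_card_of_injOn (fun v => v ∘ ε.symm) ?_ ?_
    · intro v hv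
      simp only [Finset.coe_filter, Finset.mem_univ, true_and, Set.mem_ofPred_eq] at hv
      simp only [Finset.coe_filter, Set.mem_ofPred_eq, Fintype.mem_piFinset, Finset.mem_univ,
        implies_true, true_and, MvPolynomial.eval_rename]
      have : (v ∘ ε.symm) ∘ ε = v := by funext x; simp
      rw [this, hv]
    · intro v _ w _ h
      funext x
      have := congrFun h (ε x)
      simpa using this
  rw [Finset.card_univ] at h1
  have hq' : (0 : ℚ≥0) < (Fintype.card F : ℚ≥0) := by exact_mod_cast hq
  rw [div_le_div_iff₀ (pow_pos hq' _) hq'] at h1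
  have h2 : (Finset.filter (fun f => MvPolynomial.eval f (MvPolynomial.rename ε p) = 0)
        (Fintype.piFinset fun _ : Fin (Fintype.card σ) => (Finset.univ : Finset F))).card * Fintype.card F
      ≤ (MvPolynomial.rename ε p).totalDegree * Fintype.card F ^ Fintype.card σ := by exact_mod_cast h1
  calc _ ≤ _ := Nat.mul_le_mul_right _ hcard
    _ ≤ _ := h2
    _ ≤ _ := Nat.mul_le_mul_right _ hd

lemma fin_upper {α β ι F : Type} [Fintype α] [Fintype β] [Fintype ι] [Field F] [Fintype F]
    (P : (ι → F) → Prop) (c : ι → F) :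
    Nat.card (Σ v : α ⊕ (β ⊕ ι) → F, {s : F // P (fun p => c p + s * v (Sum.inr (Sum.inr p)))})
      ≤ Fintype.card F ^ Fintype.card α * Fintype.card F ^ Fintype.card β *
        (Fintype.card F * Nat.card {c : ι → F // P c} + Fintype.card F ^ Fintype.card ι) := by
  classical
  let φ : (Σ v : α ⊕ (β ⊕ ι) → F, {s : F // P (fun p => c p + s * v (Sum.inr (Sum.inr p)))}) →
      ((α → F) × (β → F)) × ((F × {c : ι → F // P c}) ⊕ (ι → F)) := fun z =>
    ((fun a => z.1 (Sum.inl a), fun b => z.1 (Sum.inr (Sum.inl b))),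
      if z.2.1 = 0 then Sum.inr (fun p => z.1 (Sum.inr (Sum.inr p)))
      else Sum.inl (z.2.1, ⟨_, z.2.2⟩))
  have hφ : Function.Injective φ := by
    rintro ⟨v, s, hs⟩ ⟨w, u, hu⟩ h
    simp only [φ, Prod.mk.injEq] at h
    obtain ⟨⟨h1, h2⟩, h3⟩ := h
    have key : s = u ∧ ∀ p, v (Sum.inr (Sum.inr p)) = w (Sum.inr (Sum.inr p)) := by
      by_cases hs0 : s = 0 <;> by_cases hu0 : u = 0
      · simp only [hs0, hu0, if_true, Sum.inr.injEq] at h3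
        exact ⟨hs0.trans hu0.symm, fun p => congrFun h3 p⟩
      · simp [hs0, hu0] at h3
      · simp [hs0, hu0] at h3
      · simp only [hs0, hu0, if_false, Sum.inl.injEq, Prod.mk.injEq, Subtype.mk.injEq] at h3
        obtain ⟨h4, h5⟩ := h3
        refine ⟨h4, fun p => ?_⟩
        have := congrFun h5 p
        simp only [h4] at this
        exact mul_left_cancel₀ hu0 (add_left_cancel this)
    obtain ⟨h4, h5⟩ := key
    have hv : v = w := by
      funext x
      rcases x with a | b | p
      · exact congrFun h1 a
      · exact congrFun h2 b
      · exact h5 p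
    subst hv
    subst h4
    rfl
  have := Nat.card_le_card_of_injective φ hφ
  simpa [Nat.card_eq_fintype_card, Nat.card_prod, Nat.card_sum, Fintype.card_sum] using this

lemma fin_count {α β ι F : Type} [Fintype α] [Fintype β] [Fintype ι] [Field F] [Fintype F]
    (P : (ι → F) → Prop) (c : ι → F) (N K T : ℕ) (Ψ : MvPolynomial (α ⊕ (β ⊕ ι)) F) (hΨ : Ψ ≠ 0)
    (hT : Ψ.totalDegree ≤ T)
    (H : ∀ v : α ⊕ (β ⊕ ι) → F, MvPolynomial.eval v Ψ ≠ 0 → Fintype.card F ≤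
      N * Nat.card {s : F // P (fun p => c p + s * v (Sum.inr (Sum.inr p)))} + K) :
    Fintype.card F * Fintype.card F ^ Fintype.card ι ≤
      N * (Fintype.card F * Nat.card {c : ι → F // P c} + Fintype.card F ^ Fintype.card ι) +
        (K + T) * Fintype.card F ^ Fintype.card ι := by
  classical
  have hU := fin_upper (α := α) (β := β) P c
  have hZ := fin_sz Ψ hΨ T hT
  have hq : 0 < Fintype.card F := Fintype.card_pos
  rw [Nat.card_sigma] at hU
  have hsum : ∑ v : α ⊕ (β ⊕ ι) → F, Fintype.card F ≤ ∑ v : α ⊕ (β ⊕ ι) → F,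
      (N * Nat.card {s : F // P (fun p => c p + s * v (Sum.inr (Sum.inr p)))} + K
        + (if MvPolynomial.eval v Ψ = 0 then Fintype.card F else 0)) := by
    refine Finset.sum_le_sum fun v _ => ?_
    by_cases hv : MvPolynomial.eval v Ψ = 0
    · simp [hv]
    · simpa [hv] using H v hv
  rw [Finset.sum_add_distrib, Finset.sum_add_distrib, ← Finset.mul_sum, ← Finset.sum_filter] at hsum
  simp only [Finset.sum_const, smul_eq_mul, Finset.card_univ] at hsum
  have hZ2 : (Finset.filter (fun v => MvPolynomial.eval v Ψ = 0) Finset.univ).card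
      = Nat.card {v : α ⊕ (β ⊕ ι) → F // MvPolynomial.eval v Ψ = 0} := by
    rw [Nat.card_eq_fintype_card, Fintype.card_subtype]
  rw [hZ2] at hsum
  have hcf : Fintype.card (α ⊕ (β ⊕ ι) → F) = Fintype.card F ^ Fintype.card α *
      Fintype.card F ^ Fintype.card β * Fintype.card F ^ Fintype.card ι := by
    simp [Fintype.card_sum, pow_add, mul_assoc]
  have hcp : Fintype.card F ^ Fintype.card (α ⊕ (β ⊕ ι)) = Fintype.card F ^ Fintype.card α *
      Fintype.card F ^ Fintype.card β * Fintype.card F ^ Fintype.card ι := by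
    simp [Fintype.card_sum, pow_add, mul_assoc]
  rw [hcf] at hsum
  rw [hcp] at hZ
  set Q := Fintype.card F ^ Fintype.card α * Fintype.card F ^ Fintype.card β with hQ
  have hQ0 : 0 < Q := by positivity
  refine le_of_mul_le_mul_left (a := Q) ?_ hQ0
  have hU2 := Nat.mul_le_mul_left N hU
  calc _ = Q * Fintype.card F ^ Fintype.card ι * Fintype.card F := by ring
    _ ≤ _ := hsum
    _ ≤ N * (Q * (Fintype.card F * Nat.card {c : ι → F // P c} + Fintype.card F ^ Fintype.card ι))
        + Q * Fintype.card F ^ Fintype.card ι * K + T * (Q * Fintype.card F ^ Fintype.card ι) :=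
      Nat.add_le_add (Nat.add_le_add_right hU2 _) hZ
    _ = _ := by ring

noncomputable def polyOf {k : ℕ} {d : Fin k → ℕ} {F : Type} [Field F] (c : Idx d → F) (i : Fin k) :
    MvPolynomial (Fin k) F :=
  ∑ m : Mon k (d i), MvPolynomial.monomial (Finsupp.equivFunOnFinite.symm m.1) (c ⟨i, m⟩)

lemma polyOf_eval {k : ℕ} {d : Fin k → ℕ} {F : Type} [Field F] (c : Idx d → F) (i : Fin k)
    (x : Fin k → F) : MvPolynomial.eval x (polyOf c i) = sev c i x := by
  unfold polyOf sev
  rw [map_sum]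
  refine Finset.sum_congr rfl fun m _ => ?_
  rw [MvPolynomial.eval_monomial, Finsupp.prod_fintype _ _ (by simp)]
  rfl

lemma polyOf_coeff {k : ℕ} {d : Fin k → ℕ} {F : Type} [Field F] (c : Idx d → F) (i : Fin k)
    (b : Fin k →₀ ℕ) : MvPolynomial.coeff b (polyOf c i) =
      if h : ∑ j, b j ≤ d i then c ⟨i, ⟨b, h⟩⟩ else 0 := by
  classical
  unfold polyOf
  rw [MvPolynomial.coeff_sum]
  simp only [MvPolynomial.coeff_monomial]
  split_ifs with h
  · rw [Finset.sum_eq_single (⟨b, h⟩ : Mon k (d i))]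
    · rw [if_pos]
      ext j; simp
    · intro m _ hm
      rw [if_neg]
      intro h2
      apply hm
      apply Subtype.ext
      funext j
      have := DFunLike.congr_fun h2 j
      simpa using this
    · simp
  · refine Finset.sum_eq_zero fun m _ => ?_
    rw [if_neg]
    intro h2
    apply h
    rw [← h2]
    simpa using m.2

lemma polyOf_deg {k : ℕ} {d : Fin k → ℕ} {F : Type} [Field F] (c : Idx d → F) (i : Fin k) :
    (polyOf c i).totalDegree ≤ d i := by
  refine MvPolynomial.totalDegree_finsetSum_le fun m _ => ?_
  refine (MvPolynomial.totalDegree_monomial_le _ _).trans ?_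
  rw [Finsupp.sum_fintype _ _ (by simp)]
  simpa using m.2

lemma polyOf_inj {k : ℕ} {d : Fin k → ℕ} {F : Type} [Field F] :
    Function.Injective (fun c : Idx d → F => fun i => polyOf c i) := by
  intro c c2 h
  funext ⟨i, m⟩
  have h1 := congrFun h i
  have h2 := congrArg (MvPolynomial.coeff (Finsupp.equivFunOnFinite.symm m.1)) h1
  simp only [polyOf_coeff] at h2
  have hm : ∑ j, (Finsupp.equivFunOnFinite.symm m.1) j ≤ d i := by simpa using m.2
  rw [dif_pos hm, dif_pos hm] at h2
  simpa using h2

lemma polyOf_surj {k : ℕ} {d : Fin k → ℕ} {F : Type} [Field F]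
    (f : (i : Fin k) → MvPolynomial (Fin k) F) (hf : ∀ i, (f i).totalDegree ≤ d i) :
    ∃ c : Idx d → F, (fun i => polyOf c i) = f := by
  refine ⟨fun p => MvPolynomial.coeff (Finsupp.equivFunOnFinite.symm p.2.1) (f p.1), ?_⟩
  funext i
  ext b
  rw [polyOf_coeff]
  split_ifs with h
  · simp
  · symm
    apply MvPolynomial.coeff_eq_zero_of_totalDegree_lt
    have : ∑ j ∈ b.support, b j = ∑ j, b j := Finset.sum_subset (Finset.subset_univ _) (by
      intro j _ hj; simpa using hj)
    rw [this]
    have := hf i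
    omega

lemma fin_total {k : ℕ} {d : Fin k → ℕ} {F : Type} [Field F] [Fintype F] :
    Nat.card {f : (i : Fin k) → MvPolynomial (Fin k) F // ∀ i, (f i).totalDegree ≤ d i}
      = Fintype.card F ^ Fintype.card (Idx d) := by
  classical
  have e : Function.Bijective (fun c : Idx d → F => (⟨fun i => polyOf c i, fun i => polyOf_deg c i⟩ :
      {f : (i : Fin k) → MvPolynomial (Fin k) F // ∀ i, (f i).totalDegree ≤ d i})) := by
    refine ⟨fun c c2 h => polyOf_inj (congrArg Subtype.val h), fun f => ?_⟩
    obtain ⟨c, hc⟩ := polyOf_surj f.1 f.2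
    exact ⟨c, Subtype.ext hc⟩
  rw [← Nat.card_congr (Equiv.ofBijective _ e), Nat.card_eq_fintype_card, Fintype.card_fun]

lemma fin_good {k : ℕ} {d : Fin k → ℕ} {F : Type} [Field F] [Fintype F] :
    Nat.card {c : Idx d → F // Good c} ≤ Nat.card {f : (i : Fin k) → MvPolynomial (Fin k) F //
            (∀ i, (f i).totalDegree ≤ d i) ∧
            Nat.card {x : Fin k → F // ∀ i, MvPolynomial.eval x (f i) = 0} =
              ∏ i, d i} := by
  classical
  have hfin : Finite {f : (i : Fin k) → MvPolynomial (Fin k) F //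
            (∀ i, (f i).totalDegree ≤ d i) ∧
            Nat.card {x : Fin k → F // ∀ i, MvPolynomial.eval x (f i) = 0} =
              ∏ i, d i} := by
    have : ∀ f : {f : (i : Fin k) → MvPolynomial (Fin k) F //
            (∀ i, (f i).totalDegree ≤ d i) ∧
            Nat.card {x : Fin k → F // ∀ i, MvPolynomial.eval x (f i) = 0} =
              ∏ i, d i}, ∃ c : Idx d → F, (fun i => polyOf c i) = f.1 :=
      fun f => polyOf_surj f.1 f.2.1
    choose g hg using this
    refine Finite.of_injective g fun a b h => Subtype.ext ?_
    rw [← hg a, ← hg b, h]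
  refine Nat.card_le_card_of_injective (fun c => ⟨fun i => polyOf c.1 i,
    fun i => polyOf_deg c.1 i, ?_⟩) ?_
  · simp only [polyOf_eval]
    exact c.2
  · intro a b h
    exact Subtype.ext (polyOf_inj (congrArg Subtype.val h))

theorem final_bound {k : ℕ} (d : Fin k → ℕ) (hd : ∀ i, 0 < d i) :
    ∃ c : ℝ, 0 < c ∧
      ∀ (F : Type) [Field F] [Fintype F],
        (1 - c * (Fintype.card F : ℝ) ^ (-(1 / 2 : ℝ))) /
              (Nat.factorial (∏ i, d i) : ℝ) * (Fintype.card F : ℝ) ^ Fintype.card (Idx d)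
              ≤ (Nat.card {c : Idx d → F // Good c} : ℝ) := by
  classical
  obtain ⟨C₀, q₀, T, H⟩ := line_good hd
  set N := (∏ i, d i).factorial with hN
  have hN0 : 0 < N := Nat.factorial_pos _
  refine ⟨C₀ + T + N + q₀ + ∑ i, d i, by positivity, ?_⟩
  intro F _ _
  have hq : 0 < Fintype.card F := Fintype.card_pos
  set q := Fintype.card F with hqdef
  set D := ∑ i, d i with hD
  have hNr : (0 : ℝ) < N := by exact_mod_cast hN0
  have hqr : (1 : ℝ) ≤ q := by exact_mod_cast hq
  have hpow : (q : ℝ) ^ (-(1 / 2 : ℝ)) = 1 / Real.sqrt q := by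
    rw [Real.rpow_neg (by positivity), ← Real.sqrt_eq_rpow, one_div]
  rw [hpow]
  set r := Real.sqrt q with hr
  have hr1 : 1 ≤ r := Real.one_le_sqrt.mpr hqr
  have hrr : r * r = q := Real.mul_self_sqrt (by positivity)
  set G := Nat.card {c : Idx d → F // Good c} with hG
  by_cases hsmall : q₀ ≤ q ∧ D ≤ q
  · obtain ⟨hs1, hs2⟩ := hsmall
    have hex : ∀ i, ∃ f : Fin (d i) → F, Function.Injective f := by
      intro i
      have h1 : d i ≤ q := (Finset.single_le_sum (f := d) (fun _ _ => Nat.zero_le _)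
        (Finset.mem_univ i)).trans hs2
      have h2 : Fintype.card (Fin (d i)) ≤ Fintype.card F := by simpa using h1
      obtain ⟨f⟩ := Function.Embedding.nonempty_of_card_le h2
      exact ⟨f, f.injective⟩
    choose e he using hex
    obtain ⟨Ψ, h1, h2, h3⟩ := H F hs1 e he
    have h4 := fin_count (fun c : Idx d → F => Good c) (c0 e) N (C₀ * Nat.sqrt q) T Ψ h1 h2 h3
    have h5 : (q : ℝ) * (q : ℝ) ^ Fintype.card (Idx d) ≤ N * (q * G + (q : ℝ) ^ Fintype.card (Idx d))
        + (C₀ * Nat.sqrt q + T) * (q : ℝ) ^ Fintype.card (Idx d) := by exact_mod_cast h4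
    have h6 : (Nat.sqrt q : ℝ) ≤ r := Real.nat_sqrt_le_real_sqrt
    set Q := (q : ℝ) ^ Fintype.card (Idx d) with hQ
    have hQ0 : 0 ≤ Q := by positivity
    have h7 : (C₀ * Nat.sqrt q + T + N : ℝ) ≤ (C₀ + T + N + q₀ + D) * r := by
      have a1 : (C₀ : ℝ) * Nat.sqrt q ≤ C₀ * r := mul_le_mul_of_nonneg_left h6 (by positivity)
      have a2 : (T + N : ℝ) ≤ (T + N) * r := le_mul_of_one_le_right (by positivity) hr1
      have a3 : (0 : ℝ) ≤ (q₀ + D) * r := by positivity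
      linarith
    have h8 := mul_le_mul_of_nonneg_right h7 hQ0
    have h9 : (q : ℝ) * Q - (C₀ + T + N + q₀ + D) * r * Q ≤ N * (q * G) := by linarith
    have hr0 : 0 < r := by linarith
    have h10 : (1 - ((C₀ : ℝ) + T + N + q₀ + D) * (1 / r)) / N * Q
        = (q * Q - (C₀ + T + N + q₀ + D) * r * Q) / (N * q) := by
      rw [← hrr]; field_simp
    rw [h10, div_le_iff₀ (by positivity)]
    linarith
  · have hlt : (q : ℝ) ≤ q₀ + D := by
      have : q ≤ q₀ + D := by
        by_contra h
        exact hsmall ⟨by omega, by omega⟩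
      exact_mod_cast this
    have hG0 : (0 : ℝ) ≤ (G : ℝ) := by positivity
    refine le_trans ?_ hG0
    refine mul_nonpos_of_nonpos_of_nonneg (div_nonpos_of_nonpos_of_nonneg ?_ hNr.le) (by positivity)
    have hr0 : 0 < r := by linarith
    rw [sub_nonpos, mul_one_div, le_div_iff₀ hr0]
    have : r ≤ r * r := le_mul_of_one_le_right hr0.le hr1
    have c1 : (0 : ℝ) ≤ C₀ := by positivity
    have c2 : (0 : ℝ) ≤ T := by positivity
    linarith

/-- Fix `k` and degrees `d₁, …, d_k`, and set `t = d₁⋯d_k`. There is a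
constant `c > 0` (depending only on the `dᵢ`) such that for every finite field `F` (of order
`q = Fintype.card F`): if `f₁, …, f_k` are chosen independently, each uniform on the
polynomials in `k` variables of total degree at most `dᵢ`, then the probability that the
number of common zeros in `F^k` is exactly `t` is at least `(1 − c·q^{−1/2})/t!`.
Probabilities are expressed as counts: the number of tuples realizing the event is at least
`(1 − c·q^{−1/2})/t!` times the total number of tuples. -/
theorem statement_4 (k : ℕ) (hk : 0 < k) (d : Fin k → ℕ) (hd : ∀ i, 0 < d i) :
    ∃ c : ℝ, 0 < c ∧
      ∀ (F : Type) [Field F] [Fintype F],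
        (1 - c * (Fintype.card F : ℝ) ^ (-(1 / 2 : ℝ))) /
              (Nat.factorial (∏ i, d i) : ℝ) *
            (Nat.card {f : (i : Fin k) → MvPolynomial (Fin k) F //
              ∀ i, (f i).totalDegree ≤ d i} : ℝ) ≤
          (Nat.card {f : (i : Fin k) → MvPolynomial (Fin k) F //
            (∀ i, (f i).totalDegree ≤ d i) ∧
            Nat.card {x : Fin k → F // ∀ i, MvPolynomial.eval x (f i) = 0} =
              ∏ i, d i} : ℝ) := by
  obtain ⟨c, hc, H⟩ := final_bound d hd
  refine ⟨c, hc, ?_⟩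
  intro F _ _
  rw [fin_total]
  refine le_trans ?_ (Nat.cast_le.mpr fin_good)
  have := H F
  push_cast
  exact this
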